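/- The Hochschild cohomology algebra HH^•(FK(3)) is isomorphic as a bigraded k-algebra to the quotient of the free graded-commutative algebra on 14 generators x₁,...,x₁₄ (with homological degrees 0,0,0,1,1,1,1,1,2,2,2,2,3,4) by the ideal generated by the 63 explicit homogeneous relations listed in the paper (including x₁² = x₁x₂ = x₁x₃ = x₂² = x₂x₃ = x₃² = 0, x₄x₅ = x₄x₆ = ... = 0, x₁₃² = 0, and the mixed relations involving x₁₄). -/

import Mathlib

/-!
The Hochschild cohomology algebra `HH^•(FK(3)) = ⊕ₙ Extⁿ_{A^e}(A,A)` (with the cup product,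
which coincides with the Yoneda composition product) is a finitely generated `k`-algebra;
it admits a minimal generating set of exactly `14` homogeneous elements, of cohomological
degrees `0,0,0,1,1,1,1,1,2,2,2,2,3,4`.
-/

open FreeAlgebra CategoryTheory CategoryTheory.Abelian
open scoped TensorProduct

/-- The defining relations of the Fomin–Kirillov algebra `FK(3)`. -/
inductive FKRel (k : Type) [Field k] : FreeAlgebra k (Fin 3) → FreeAlgebra k (Fin 3) → Prop
  | sq_a : FKRel k (ι k (0 : Fin 3) * ι k (0 : Fin 3)) 0
  | sq_b : FKRel k (ι k (1 : Fin 3) * ι k (1 : Fin 3)) 0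
  | sq_c : FKRel k (ι k (2 : Fin 3) * ι k (2 : Fin 3)) 0
  | rel1 : FKRel k (ι k (0 : Fin 3) * ι k (1 : Fin 3) + ι k (1 : Fin 3) * ι k (2 : Fin 3) +
      ι k (2 : Fin 3) * ι k (0 : Fin 3)) 0
  | rel2 : FKRel k (ι k (1 : Fin 3) * ι k (0 : Fin 3) + ι k (0 : Fin 3) * ι k (2 : Fin 3) +
      ι k (2 : Fin 3) * ι k (1 : Fin 3)) 0

/-- The Fomin–Kirillov algebra on three generators. -/
abbrev FK3 (k : Type) [Field k] := RingQuot (FKRel k)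

variable (k : Type) [Field k]

/-- The enveloping algebra `A^e = A ⊗ₖ Aᵒᵖ` of `A = FK(3)`. -/
abbrev FKAe := FK3 k ⊗[k] (FK3 k)ᵐᵒᵖ

noncomputable instance : Module (FKAe k) (FK3 k) := TensorProduct.Algebra.module

/-- `A = FK(3)` as a bimodule over itself, i.e. as an `A^e`-module. -/
noncomputable abbrev AAmod : ModuleCat.{0} (FKAe k) := ModuleCat.of (FKAe k) (FK3 k)

noncomputable instance : HasDerivedCategory.{1} (ModuleCat.{0} (FKAe k)) :=
  HasDerivedCategory.standard _

instance : HasExt.{1} (ModuleCat.{0} (FKAe k)) :=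
  hasExt_of_hasDerivedCategory.{1} (ModuleCat.{0} (FKAe k))

/-- The Hochschild cohomology `HHⁿ(FK(3)) = Extⁿ_{A^e}(A,A)`. -/
abbrev HHExt (n : ℕ) : Type 1 := Ext (AAmod k) (AAmod k) n

/-- The cohomological degrees `0,0,0,1,1,1,1,1,2,2,2,2,3,4` of the 14 generators
`x₁, …, x₁₄`. -/
def hhDegs : Fin 14 → ℕ := ![0, 0, 0, 1, 1, 1, 1, 1, 2, 2, 2, 2, 3, 4]

/-- The generators `x₁, …, x₁₄` (0-indexed) of the free algebra on 14 variables. -/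
noncomputable def xv (i : Fin 14) : FreeAlgebra k (Fin 14) := FreeAlgebra.ι k i

/-- The 63 relations `𝓡₂` of the presentation of `HH^•(FK(3))` (with `xᵢ = xv (i−1)`). -/
noncomputable def R2list : List (FreeAlgebra k (Fin 14)) :=
  [xv k 0 * xv k 0, xv k 0 * xv k 1, xv k 0 * xv k 2, xv k 1 * xv k 1, xv k 1 * xv k 2,
   xv k 2 * xv k 2, xv k 0 * xv k 3, xv k 0 * xv k 4, xv k 0 * xv k 5, xv k 0 * xv k 6,
   xv k 1 * xv k 3, xv k 1 * xv k 4, xv k 1 * xv k 5, xv k 1 * xv k 6,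
   xv k 2 * xv k 3, xv k 2 * xv k 4, xv k 2 * xv k 5, xv k 2 * xv k 6, xv k 2 * xv k 7,
   xv k 3 * xv k 4, xv k 3 * xv k 5, xv k 3 * xv k 6, xv k 4 * xv k 5, xv k 4 * xv k 6,
   xv k 5 * xv k 6,
   xv k 0 * xv k 10 - (2 : k) • (xv k 0 * xv k 8) - (2 : k) • (xv k 0 * xv k 9),
   xv k 0 * xv k 11 - xv k 0 * xv k 8 - xv k 0 * xv k 9,
   xv k 1 * xv k 8 + xv k 0 * xv k 8,
   xv k 1 * xv k 9 - (2 : k) • (xv k 0 * xv k 9),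
   xv k 1 * xv k 10 - xv k 0 * xv k 8 - xv k 0 * xv k 9,
   xv k 1 * xv k 11 - xv k 0 * xv k 9,
   xv k 2 * xv k 8 + xv k 7 * xv k 3,
   xv k 2 * xv k 9 + xv k 7 * xv k 4,
   xv k 2 * xv k 10 - xv k 7 * xv k 5,
   xv k 2 * xv k 11 - xv k 7 * xv k 6,
   xv k 8 * xv k 4 + xv k 8 * xv k 5,
   xv k 8 * xv k 4 - xv k 9 * xv k 3,
   xv k 8 * xv k 4 + xv k 9 * xv k 5,
   xv k 8 * xv k 4 - xv k 10 * xv k 3,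
   xv k 8 * xv k 4 - xv k 10 * xv k 4,
   xv k 11 * xv k 3 - ((1 : k)/3) • (xv k 8 * xv k 6) + ((4 : k)/3) • (xv k 9 * xv k 6),
   xv k 11 * xv k 4 + ((1 : k)/3) • (xv k 8 * xv k 6) - xv k 11 * xv k 5 +
     ((5 : k)/3) • (xv k 9 * xv k 6),
   xv k 9 * xv k 6 - xv k 10 * xv k 6,
   xv k 11 * xv k 6 + (2 : k) • (xv k 8 * xv k 4) - ((1 : k)/3) • (xv k 8 * xv k 6) -
     ((2 : k)/3) • (xv k 9 * xv k 6),
   xv k 8 * xv k 9 - xv k 8 * xv k 10,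
   xv k 8 * xv k 9 - xv k 9 * xv k 10,
   xv k 8 * xv k 11 - xv k 11 * xv k 11 + (2 : k) • (xv k 8 * xv k 9) -
     (3 : k) • (xv k 13 * xv k 0) + (3 : k) • (xv k 13 * xv k 1),
   xv k 9 * xv k 11 - xv k 11 * xv k 11 + (2 : k) • (xv k 8 * xv k 9) -
     (3 : k) • (xv k 13 * xv k 1),
   xv k 10 * xv k 11 - xv k 11 * xv k 11 + (2 : k) • (xv k 8 * xv k 9) +
     (3 : k) • (xv k 13 * xv k 0),
   xv k 0 * xv k 12 - (4 : k) • (xv k 11 * xv k 5) + (4 : k) • (xv k 9 * xv k 6),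
   xv k 1 * xv k 12 + ((4 : k)/3) • (xv k 8 * xv k 6) - (4 : k) • (xv k 11 * xv k 5) +
     ((8 : k)/3) • (xv k 9 * xv k 6),
   xv k 2 * xv k 12,
   xv k 7 * xv k 12 - (6 : k) • (xv k 13 * xv k 2),
   xv k 12 * xv k 3 + xv k 8 * xv k 8 * xv k 2,
   xv k 12 * xv k 4 + xv k 9 * xv k 9 * xv k 2,
   xv k 12 * xv k 5 - xv k 10 * xv k 10 * xv k 2,
   xv k 12 * xv k 6 - xv k 11 * xv k 11 * xv k 2 + (2 : k) • (xv k 8 * xv k 9 * xv k 2),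
   xv k 0 * xv k 7 * xv k 11 - (2 : k) • (xv k 11 * xv k 5) + (2 : k) • (xv k 9 * xv k 6),
   xv k 1 * xv k 7 * xv k 11 + ((2 : k)/3) • (xv k 8 * xv k 6) - (2 : k) • (xv k 11 * xv k 5) +
     ((4 : k)/3) • (xv k 9 * xv k 6),
   xv k 8 * xv k 12 - xv k 8 * xv k 8 * xv k 7 + (6 : k) • (xv k 13 * xv k 3),
   xv k 9 * xv k 12 - xv k 9 * xv k 9 * xv k 7 + (6 : k) • (xv k 13 * xv k 4),
   xv k 10 * xv k 12 - xv k 10 * xv k 10 * xv k 7 - (6 : k) • (xv k 13 * xv k 5),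
   xv k 11 * xv k 12 - xv k 10 * xv k 11 * xv k 7 - (6 : k) • (xv k 13 * xv k 6) -
     (3 : k) • (xv k 13 * xv k 1 * xv k 7)]

/-- The relations presenting `HH^•(FK(3))`: the graded-commutativity relations `𝓡₁` (for the
homological degrees `hhDegs`) together with the 63 relations `𝓡₂`. -/
inductive PresRel : FreeAlgebra k (Fin 14) → FreeAlgebra k (Fin 14) → Prop
  | comm (i j : Fin 14) :
      PresRel (xv k i * xv k j) (((-1 : k) ^ (hhDegs i * hhDegs j)) • (xv k j * xv k i))
  | sq (i : Fin 14) (h : Odd (hhDegs i)) : PresRel (xv k i * xv k i) 0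
  | rel (p : FreeAlgebra k (Fin 14)) (hp : p ∈ R2list k) : PresRel p 0

/-- The presented algebra: the free graded-commutative algebra on `x₁, …, x₁₄` modulo the
63 relations `𝓡₂`. -/
abbrev HHPres := RingQuot (PresRel k)

/-- The image of the word `l` in the presented algebra. -/
noncomputable def presWord (l : List (Fin 14)) : HHPres k :=
  (l.map (fun i => RingQuot.mkAlgHom k (PresRel k) (xv k i))).prod

/-- The homological-degree-`n` homogeneous component of the presented algebra. -/
noncomputable def presComp (n : ℕ) : Submodule k (HHPres k) :=
  Submodule.span k {z : HHPres k | ∃ l : List (Fin 14), (l.map hhDegs).sum = n ∧ z = presWord k l}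

/-! ### Formal integral combinations -/

namespace FKH

/-- Formal integral combinations of atoms indexed by natural numbers. -/
abbrev Comb := List (ℤ × ℕ)

/-- Evaluation of a formal combination. -/
def ev {M : Type*} [AddCommGroup M] (e : ℕ → M) : Comb → M
  | [] => 0
  | p :: l => p.1 • e p.2 + ev e l

/-- Scaling of a formal combination. -/
def sc (c : ℤ) (l : Comb) : Comb := l.map fun p => (c * p.1, p.2)

/-- Linear extension of a function on atoms. -/
def bnd (T : ℕ → Comb) (l : Comb) : Comb := l.flatMap fun p => sc p.1 (T p.2)

/-- Strict application of a function to a natural number. -/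
noncomputable def frc {α : Type} (n : ℕ) (f : ℕ → α) : α :=
  Nat.rec (f 0) (fun m _ => f m) (n + 1)

lemma frc_eq {α : Type} (n : ℕ) (f : ℕ → α) : frc n f = f n := rfl

/-- Accumulating linear extension of a function on atoms. -/
noncomputable def fm (l : Comb) (f : ℤ → ℕ → Comb → Comb) : Comb → Comb :=
  List.rec (motive := fun _ => Comb → Comb) (fun r => r) (fun p _ ih r => f p.1 p.2 (ih r)) l

/-- Entry of a table, empty outside its range. -/
noncomputable def gD {α : Type} (l : List (List α)) : ℕ → List α :=
  List.rec (motive := fun _ => ℕ → List α) (fun _ => [])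
    (fun x _ ih i => Nat.rec x (fun j _ => ih j) i) l

lemma gD_eq {α : Type} (l : List (List α)) (i : ℕ) : gD l i = l.getD i [] := by
  induction l generalizing i with
  | nil => rfl
  | cons x l ih => cases i with
    | zero => rfl
    | succ i => exact ih i

lemma gD_of_le {α : Type} {t : List (List α)} {i : ℕ} (h : t.length ≤ i) : gD t i = [] := by
  rw [gD_eq, List.getD_eq_getElem?_getD, List.getElem?_eq_none h]; rfl

/-- Vanishing test by substitution of a large power of two: the positive and negative parts of the
value are accumulated, together with a bound for the coefficients. -/
noncomputable def packZ (l : Comb) : ℕ → ℕ → ℕ → Bool :=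
  List.rec (motive := fun _ => ℕ → ℕ → ℕ → Bool)
    (fun p n t => bif Nat.beq p n then Nat.ble t 65535 else false)
    (fun x _ ih p n t => Int.rec (motive := fun _ => Bool)
      (fun m => frc (Nat.add p (Nat.shiftLeft m (Nat.mul 16 x.2))) fun p =>
        frc (Nat.add t m) fun t => ih p n t)
      (fun m => frc (Nat.add n (Nat.shiftLeft (Nat.succ m) (Nat.mul 16 x.2))) fun n =>
        frc (Nat.add t (Nat.succ m)) fun t => ih p n t) x.1) l

/-- Whether a formal combination vanishes. -/
noncomputable def isZ (l : Comb) : Bool := packZ l 0 0 0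

/-- Whether two formal combinations agree. -/
noncomputable def eqv (l l' : Comb) : Bool := isZ (fm l' (fun c i r => (Int.neg c, i) :: r) l)

section ev
variable {M N : Type*} [AddCommGroup M] [AddCommGroup N] (e : ℕ → M)

@[simp] lemma ev_nil : ev e [] = 0 := rfl

@[simp] lemma ev_cons (p : ℤ × ℕ) (l : Comb) : ev e (p :: l) = p.1 • e p.2 + ev e l := rfl

@[simp] lemma ev_append (l l' : Comb) : ev e (l ++ l') = ev e l + ev e l' := by
  induction l with
  | nil => simp
  | cons p l ih => simp [ih, add_assoc]

@[simp] lemma ev_sc (c : ℤ) (l : Comb) : ev e (sc c l) = c • ev e l := by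
  induction l with
  | nil => simp [sc]
  | cons p l ih =>
    have : sc c (p :: l) = (c * p.1, p.2) :: sc c l := rfl
    simp [this, ih, mul_smul]

lemma map_ev {φ : M →+ N} {e' : ℕ → N} {F : ℤ × ℕ → Comb} (l : Comb)
    (h : ∀ p ∈ l, p.1 • φ (e p.2) = ev e' (F p)) : φ (ev e l) = ev e' (l.flatMap F) := by
  induction l with
  | nil => simp
  | cons p l ih =>
    simp only [List.mem_cons, forall_eq_or_imp] at h
    simp [ih h.2, h.1]

lemma map_ev_bnd {φ : M →+ N} {e' : ℕ → N} {T : ℕ → Comb} (l : Comb)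
    (h : ∀ i, φ (e i) = ev e' (T i)) : φ (ev e l) = ev e' (bnd T l) :=
  map_ev e l fun p _ => by rw [h, ev_sc]

lemma ev_fm {φ : M →+ N} {e' : ℕ → N} {f : ℤ → ℕ → Comb → Comb} (l : Comb)
    (h : ∀ p ∈ l, ∀ r, ev e' (f p.1 p.2 r) = p.1 • φ (e p.2) + ev e' r) (r : Comb) :
    ev e' (fm l f r) = φ (ev e l) + ev e' r := by
  induction l with
  | nil => simp [fm]
  | cons p l ih =>
    simp only [List.mem_cons, forall_eq_or_imp] at h
    change ev e' (f p.1 p.2 (fm l f r)) = _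
    rw [h.1, ih h.2, ev_cons, map_add, map_zsmul, add_assoc]

open Polynomial in
lemma polynomial_eq_zero_of_eval {B : ℤ} (p : ℤ[X]) (h : ∀ i, |p.coeff i| < B)
    (h0 : p.eval B = 0) : p = 0 := by
  induction hn : p.natDegree using Nat.strong_induction_on generalizing p with
  | _ n ih =>
  have hB : (0 : ℤ) < B := (abs_nonneg _).trans_lt (h 0)
  have e : p.divX.eval B * B + p.coeff 0 = 0 := by
    conv_rhs => rw [← h0, ← divX_mul_X_add p]
    simp
  have c0 : p.coeff 0 = 0 :=
    Int.eq_zero_of_abs_lt_dvd ⟨-p.divX.eval B, by linarith⟩ (h 0)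
  have hd : p.divX = 0 := by
    rcases Nat.eq_zero_or_pos n with rfl | hpos
    · rw [eq_C_of_natDegree_eq_zero hn, divX_C]
    · refine ih _ ?_ p.divX (fun i => by rw [coeff_divX]; exact h _) ?_ rfl
      · rw [natDegree_divX_eq_natDegree_tsub_one]; omega
      · rw [c0, add_zero] at e
        exact (mul_eq_zero.1 e).resolve_right hB.ne'
  rw [← divX_mul_X_add p, hd, c0]; simp

lemma packZ_spec (l : Comb) (p n t : ℕ) (h : packZ l p n t = true) :
    (p : ℤ) - n + (l.map fun x => x.1 * (65536 : ℤ) ^ x.2).sum = 0 ∧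
      (t : ℤ) + (l.map fun x => |x.1|).sum < 65536 := by
  induction l generalizing p n t with
  | nil =>
    change (bif Nat.beq p n then Nat.ble t 65535 else false) = true at h
    cases hb : Nat.beq p n with
    | false => rw [hb] at h; exact absurd h (by simp)
    | true =>
      rw [hb, cond_true] at h
      have := Nat.le_of_ble_eq_true h
      rw [Nat.eq_of_beq_eq_true hb]
      simp; omega
  | cons x l ih =>
    obtain ⟨c, i⟩ := x
    have hs (m : ℕ) : Nat.shiftLeft m (Nat.mul 16 i) = m * 65536 ^ i := by
      change m <<< (16 * i) = _
      rw [Nat.shiftLeft_eq, pow_mul]; norm_num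
    cases c with
    | ofNat m =>
      obtain ⟨h1, h2⟩ := ih _ _ _ h
      rw [hs] at h1
      simp only [Nat.add_eq] at h1 h2
      push_cast at h1 h2
      simp only [List.map_cons, List.sum_cons, Int.ofNat_eq_natCast, Nat.abs_cast]
      constructor <;> linarith
    | negSucc m =>
      obtain ⟨h1, h2⟩ := ih _ _ _ h
      rw [hs] at h1
      simp only [Nat.add_eq] at h1 h2
      push_cast at h1 h2
      simp only [List.map_cons, List.sum_cons, Int.negSucc_eq, abs_neg]
      rw [abs_of_nonneg (by positivity : (0 : ℤ) ≤ m + 1)]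
      constructor <;> linarith

open Polynomial in
lemma ev_eq_zero {l : Comb} (h : isZ l = true) : ev e l = 0 := by
  obtain ⟨h1, h2⟩ := packZ_spec l 0 0 0 h
  let p : ℤ[X] := (l.map fun x => monomial x.2 x.1).sum
  have hp : p = 0 := by
    refine polynomial_eq_zero_of_eval (B := 65536) p (fun i => ?_) ?_
    · refine lt_of_le_of_lt ?_ (by simpa using h2)
      clear h h1 h2
      change |((l.map fun x => monomial x.2 x.1).sum : ℤ[X]).coeff i| ≤ _
      induction l with
      | nil => simp
      | cons x l ih =>
        simp only [List.map_cons, List.sum_cons, coeff_add]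
        refine (abs_add_le _ _).trans (add_le_add ?_ (ih))
        rw [coeff_monomial]; split_ifs <;> simp
    · rw [← h1]
      simp only [p, CharP.cast_eq_zero, sub_zero, zero_add]
      clear h h1 h2
      induction l with
      | nil => simp
      | cons x l ih => simp_all
  have key : ev e l = p.sum fun i c => c • e i := by
    clear h h1 h2 hp
    change _ = ((l.map fun x => monomial x.2 x.1).sum : ℤ[X]).sum _
    induction l with
    | nil => simp
    | cons x l ih =>
      rw [List.map_cons, List.sum_cons, sum_add_index _ _ _ (by simp) (by simp [add_smul]),
        ← ih, sum_monomial_index _ _ (by simp)]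
      rfl
  rw [key, hp, sum_zero_index]

lemma ev_congr {l l' : Comb} (h : eqv l l' = true) : ev e l = ev e l' := by
  have := ev_eq_zero e h
  rw [ev_fm (e := e) (φ := -AddMonoidHom.id M)] at this
  · exact (neg_add_eq_zero.1 this).symm
  · intro p _ r
    rw [ev_cons]
    congr 1
    exact (neg_smul p.1 (e p.2)).trans (smul_neg _ _).symm

end ev

/-! ### The multiplication table of `FK(3)` -/

/-- The multiplication table of `FK(3)` in the basis
`1, a, b, c, ab, ac, ba, bc, aba, abc, bac, abac`. -/
def mulTab : List (List Comb) :=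
  [[[(1, 0)], [(1, 1)], [(1, 2)], [(1, 3)], [(1, 4)], [(1, 5)], [(1, 6)], [(1, 7)], [(1, 8)], [(1, 9)], [(1, 10)], [(1, 11)]],
   [[(1, 1)], [], [(1, 4)], [(1, 5)], [], [], [(1, 8)], [(1, 9)], [], [], [(1, 11)], []],
   [[(1, 2)], [(1, 6)], [], [(1, 7)], [(1, 8)], [(1, 10)], [], [], [], [(1, 11)], [], []],
   [[(1, 3)], [(-1, 4), (-1, 7)], [(-1, 5), (-1, 6)], [], [(1, 10)], [(-1, 9)], [(1, 9)], [(-1, 10)], [(-1, 11)], [], [], []],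
   [[(1, 4)], [(1, 8)], [], [(1, 9)], [], [(1, 11)], [], [], [], [], [], []],
   [[(1, 5)], [(-1, 9)], [(-1, 8)], [], [(1, 11)], [], [], [(-1, 11)], [], [], [], []],
   [[(1, 6)], [], [(1, 8)], [(1, 10)], [], [], [], [(1, 11)], [], [], [], []],
   [[(1, 7)], [(-1, 8)], [(-1, 10)], [], [], [(-1, 11)], [(1, 11)], [], [], [], [], []],
   [[(1, 8)], [], [], [(1, 11)], [], [], [], [], [], [], [], []],
   [[(1, 9)], [], [(-1, 11)], [], [], [], [], [], [], [], [], []],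
   [[(1, 10)], [(-1, 11)], [], [], [], [], [], [], [], [], [], []],
   [[(1, 11)], [], [], [], [], [], [], [], [], [], [], []]]

/-- Structure constants of `FK(3)`. -/
noncomputable def mulT (i j : ℕ) : Comb := gD (gD mulTab i) j

lemma mulT_of_le {i : ℕ} (h : 12 ≤ i) (j : ℕ) : mulT i j = [] := by
  rw [mulT, gD_of_le (t := mulTab) (by simpa [mulTab] using h)]
  rfl

lemma mulT_of_le' (i : ℕ) {j : ℕ} (h : 12 ≤ j) : mulT i j = [] := by
  rcases lt_or_ge i 12 with hi | hi
  · have : ∀ i < 12, (gD mulTab i).length = 12 := by decide +kernel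
    exact gD_of_le ((this i hi).trans_le h)
  · exact mulT_of_le hi j

/-- The words of the monomial basis of `FK(3)`. -/
def wordTab : List (List (Fin 3)) :=
  [[], [0], [1], [2], [0, 1], [0, 2], [1, 0], [1, 2], [0, 1, 0], [0, 1, 2], [1, 0, 2],
   [0, 1, 0, 2]]

section words

variable {R : Type*} [Ring R] (x : Fin 3 → R)

/-- The monomials of the standard basis of `FK(3)`, extended by zero. -/
def wd (i : ℕ) : R := ((wordTab[i]?).map fun l => (l.map x).prod).getD 0

lemma wd_zero : wd x 0 = 1 := by simp [wd, wordTab]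

lemma wd_of_le {i : ℕ} (h : 12 ≤ i) : wd x i = 0 := by
  have : wordTab[i]? = none := List.getElem?_eq_none (by simpa [wordTab] using h)
  simp [wd, this]

lemma wd_mul_letter (hsq : ∀ i, x i * x i = 0) (h1 : x 0 * x 1 + x 1 * x 2 + x 2 * x 0 = 0)
    (h2 : x 1 * x 0 + x 0 * x 2 + x 2 * x 1 = 0)
    (i : ℕ) (j : Fin 3) : wd x i * x j = ev (wd x) (mulT i (j + 1)) := by
  rcases lt_or_ge i 12 with hi | hi
  · have ca : x 2 * x 0 = -(x 0 * x 1) - x 1 * x 2 := by rw [← sub_eq_zero, ← h1]; abel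
    have cb : x 2 * x 1 = -(x 1 * x 0) - x 0 * x 2 := by rw [← sub_eq_zero, ← h2]; abel
    have h0 (i : Fin 3) (y : R) : x i * (x i * y) = 0 := by rw [← mul_assoc, hsq, zero_mul]
    have bab : x 1 * (x 0 * x 1) = x 0 * (x 1 * x 0) := by
      have h : x 2 * x 1 * x 1 = 0 := by rw [mul_assoc, hsq, mul_zero]
      rw [cb, sub_mul, neg_mul, mul_assoc (x 0), cb, mul_sub, mul_neg, h0] at h
      rw [← mul_assoc, ← sub_eq_zero, ← neg_eq_zero, ← h]
      abel
    have h3 (y : R) : x 1 * (x 0 * (x 1 * y)) = x 0 * (x 1 * (x 0 * y)) := by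
      simpa [mul_assoc] using congrArg (· * y) bab
    interval_cases i <;> fin_cases j <;>
    simp [wd, wordTab, mulT, gD_eq, mulTab, mul_assoc, hsq, ca, cb, bab, h0, h3, mul_add,
      sub_eq_add_neg, add_comm]
  · rw [wd_of_le x hi, mulT_of_le hi]; simp

lemma wd_letter (j : Fin 3) : wd x (j + 1) = x j := by
  fin_cases j <;> simp [wd, wordTab]

lemma wd_mul_wd (hsq : ∀ i, x i * x i = 0) (h1 : x 0 * x 1 + x 1 * x 2 + x 2 * x 0 = 0)
    (h2 : x 1 * x 0 + x 0 * x 2 + x 2 * x 1 = 0)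
    (i j : ℕ) : wd x i * wd x j = ev (wd x) (mulT i j) := by
  rcases lt_or_ge i 12 with hi | hi
  swap
  · rw [wd_of_le x hi, mulT_of_le hi]; simp
  rcases lt_or_ge j 12 with hj | hj
  swap
  · rw [wd_of_le x hj, mulT_of_le' i hj]; simp
  have key : ∀ (l : Fin 3) (j' j : ℕ), (∀ i < 12, eqv (bnd (fun x => mulT x (l + 1)) (mulT i j'))
      (mulT i j) = true) → wd x j = wd x j' * x l → wd x i * wd x j' = ev (wd x) (mulT i j') →
      wd x i * wd x j = ev (wd x) (mulT i j) := by
    intro l j' j h1' h2' h3'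
    rw [h2', ← mul_assoc, h3', ← ev_congr _ (h1' i hi)]
    exact map_ev_bnd (φ := AddMonoidHom.mulRight (x l)) (wd x) _
      fun i => wd_mul_letter x hsq h1 h2 i l
  have h0 : wd x i * wd x 0 = ev (wd x) (mulT i 0) := by
    have : ∀ i < 12, mulT i 0 = [(1, i)] := by decide +kernel
    rw [this i hi]; simp [wd, wordTab]
  have hk : ∀ j : Fin 3, wd x i * wd x (j + 1) = ev (wd x) (mulT i (j + 1)) := fun j => by
    rw [wd_letter, wd_mul_letter x hsq h1 h2]
  have h4 := key 1 1 4 (by decide +kernel) (by simp [wd, wordTab]) (hk 0)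
  have h5 := key 2 1 5 (by decide +kernel) (by simp [wd, wordTab]) (hk 0)
  have h6 := key 0 2 6 (by decide +kernel) (by simp [wd, wordTab]) (hk 1)
  have h7 := key 2 2 7 (by decide +kernel) (by simp [wd, wordTab]) (hk 1)
  have h8 := key 0 4 8 (by decide +kernel) (by simp [wd, wordTab, mul_assoc]) h4
  have h9 := key 2 4 9 (by decide +kernel) (by simp [wd, wordTab, mul_assoc]) h4
  have h10 := key 2 6 10 (by decide +kernel) (by simp [wd, wordTab, mul_assoc]) h6
  have h11 := key 2 8 11 (by decide +kernel) (by simp [wd, wordTab, mul_assoc]) h8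
  interval_cases j
  exacts [h0, hk 0, hk 1, hk 2, h4, h5, h6, h7, h8, h9, h10, h11]

end words

/-! ### The monomial basis of `FK(3)` -/

/-- A `k`-algebra `A` with a basis multiplying like the monomial basis of `FK(3)`. -/
structure IsFK (k : Type) [Field k] {A : Type} [Ring A] [Algebra k A] (w : ℕ → A) : Prop where
  one : w 0 = 1
  mul (i j : ℕ) : w i * w j = ev w (mulT i j)
  zero {i : ℕ} : 12 ≤ i → w i = 0
  indep : LinearIndependent k (fun i : Fin 12 => w i)
  span : ⊤ ≤ Submodule.span k (Set.range fun i : Fin 12 => w i)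

section FK3

variable (k : Type) [Field k]

/-- The generators of `FK(3)`. -/
noncomputable def xg (i : Fin 3) : FK3 k := RingQuot.mkAlgHom k (FKRel k) (ι k i)

lemma mk_eq_zero {p : FreeAlgebra k (Fin 3)} (h : FKRel k p 0) :
    RingQuot.mkAlgHom k (FKRel k) p = 0 := by
  simpa using RingQuot.mkAlgHom_rel k h

lemma xg_sq (i : Fin 3) : xg k i * xg k i = 0 := by
  have : FKRel k (ι k i * ι k i) 0 := by
    fin_cases i
    exacts [.sq_a, .sq_b, .sq_c]
  simpa [xg] using mk_eq_zero k this

lemma xg_rel₁ : xg k 0 * xg k 1 + xg k 1 * xg k 2 + xg k 2 * xg k 0 = 0 := by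
  simpa [xg] using mk_eq_zero k .rel1

lemma xg_rel₂ : xg k 1 * xg k 0 + xg k 0 * xg k 2 + xg k 2 * xg k 1 = 0 := by
  simpa [xg] using mk_eq_zero k .rel2

/-- Left multiplication by the generators of `FK(3)` on formal combinations. -/
noncomputable def lop (i : Fin 3) : Module.End k (ℕ →₀ k) :=
  Finsupp.lsum k fun j => LinearMap.toSpanSingleton k (ℕ →₀ k)
    (ev (fun l => Finsupp.single l 1) (mulT (i + 1) j))

lemma lop_single (i : Fin 3) (j : ℕ) :
    lop k i (Finsupp.single j 1) = ev (fun l => Finsupp.single l 1) (mulT (i + 1) j) := by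
  simp [lop]

lemma lop_ev (i : Fin 3) (l : Comb) : lop k i (ev (fun l => Finsupp.single l 1) l) =
    ev (fun l => Finsupp.single l 1) (bnd (mulT (i + 1)) l) :=
  map_ev_bnd (φ := (lop k i).toAddMonoidHom) _ l (lop_single k i)

lemma end_ext {f : Module.End k (ℕ →₀ k)} (h : ∀ j, f (Finsupp.single j 1) = 0) : f = 0 :=
  Finsupp.lhom_ext' fun j => LinearMap.ext_ring (by simpa using h j)

lemma lop_sq (i : Fin 3) : lop k i * lop k i = 0 := by
  refine end_ext k fun j => ?_
  rw [Module.End.mul_apply, lop_single, lop_ev]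
  refine ev_eq_zero _ ?_
  rcases lt_or_ge j 12 with hj | hj
  · revert i j; decide +kernel
  · rw [mulT_of_le' _ hj]; rfl

lemma lop_rel (a b c : Fin 3) (h : ∀ j < 12, isZ (bnd (mulT (a + 1)) (mulT (b + 1) j) ++
      bnd (mulT (b + 1)) (mulT (c + 1) j) ++ bnd (mulT (c + 1)) (mulT (a + 1) j)) = true) :
    lop k a * lop k b + lop k b * lop k c + lop k c * lop k a = 0 := by
  refine end_ext k fun j => ?_
  simp only [LinearMap.add_apply, Module.End.mul_apply, lop_single, lop_ev, ← ev_append]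
  refine ev_eq_zero _ ?_
  rcases lt_or_ge j 12 with hj | hj
  · exact h j hj
  · simp only [mulT_of_le' _ hj]; rfl

/-- The left regular representation of `FK(3)` on formal combinations. -/
noncomputable def lrep : FK3 k →ₐ[k] Module.End k (ℕ →₀ k) :=
  RingQuot.liftAlgHom k ⟨FreeAlgebra.lift k (lop k), fun x y h => by
    cases h with
    | sq_a => simpa using lop_sq k 0
    | sq_b => simpa using lop_sq k 1
    | sq_c => simpa using lop_sq k 2
    | rel1 => simpa using lop_rel k 0 1 2 (by decide +kernel)
    | rel2 =>
      have := lop_rel k 1 0 2 (by decide +kernel)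
      simpa using this⟩

lemma lrep_xg (i : Fin 3) : lrep k (xg k i) = lop k i := by
  simp [lrep, xg]

/-- The monomial basis of `FK(3)`, extended by zero. -/
noncomputable def wb : ℕ → FK3 k := wd (xg k)

lemma lrep_wb (i : Fin 12) : lrep k (wb k i) (Finsupp.single 0 1) = Finsupp.single (i : ℕ) 1 := by
  fin_cases i <;> simp [wb, wd, wordTab, lrep_xg, lop_single, mulT, gD_eq, mulTab]

lemma isFK : IsFK k (wb k) where
  one := wd_zero _
  mul := wd_mul_wd _ (xg_sq k) (xg_rel₁ k) (xg_rel₂ k)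
  zero := wd_of_le _
  indep := by
    let φ : FK3 k →ₗ[k] (ℕ →₀ k) := (LinearMap.applyₗ (Finsupp.single 0 1)) ∘ₗ
      (lrep k).toLinearMap
    refine LinearIndependent.of_comp φ ?_
    have : (φ ∘ fun i : Fin 12 => wb k i) = (fun i : ℕ => Finsupp.single i (1 : k)) ∘
        (Fin.val : Fin 12 → ℕ) := funext (lrep_wb k)
    rw [this]
    exact (Finsupp.linearIndependent_single_one k ℕ).comp _ Fin.val_injective
  span := by
    set W := Submodule.span k (Set.range fun i : Fin 12 => wb k i)
    have hw : ∀ i, wb k i ∈ W := fun i => by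
      rcases lt_or_ge i 12 with hi | hi
      · exact Submodule.subset_span ⟨⟨i, hi⟩, rfl⟩
      · rw [wb, wd_of_le _ hi]; exact zero_mem _
    have hev : ∀ l : Comb, ev (wb k) l ∈ W := fun l => by
      induction l with
      | nil => exact zero_mem _
      | cons p l ih => exact add_mem (zsmul_mem (hw _) _) ih
    have hx : ∀ (j : Fin 3) (y : FK3 k), y ∈ W → y * xg k j ∈ W := fun j y hy => by
      induction hy using Submodule.span_induction with
      | mem y hy =>
        obtain ⟨i, rfl⟩ := hy
        exact (wd_mul_letter _ (xg_sq k) (xg_rel₁ k) (xg_rel₂ k) i j) ▸ hev _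
      | zero => rw [zero_mul]; exact zero_mem _
      | add y z _ _ h h' => rw [add_mul]; exact add_mem h h'
      | smul c y _ h => rw [smul_mul_assoc]; exact Submodule.smul_mem _ _ h
    rintro y -
    obtain ⟨p, rfl⟩ := RingQuot.mkAlgHom_surjective k (FKRel k) y
    suffices ∀ y ∈ W, y * RingQuot.mkAlgHom k (FKRel k) p ∈ W by
      simpa [wb, wd_zero] using this _ (hw 0)
    induction p using FreeAlgebra.induction with
    | grade0 c =>
      intro y hy
      rw [AlgHom.commutes, ← Algebra.commutes, ← Algebra.smul_def]
      exact Submodule.smul_mem _ _ hy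
    | grade1 j => exact hx j
    | mul p q hp hq => intro y hy; rw [map_mul, ← mul_assoc]; exact hq _ (hp _ hy)
    | add p q hp hq => intro y hy; rw [map_add, mul_add]; exact add_mem (hp _ hy) (hq _ hy)

end FK3

end FKH

/-! ### Free bimodules and tables -/

namespace FKH

open MulOpposite

lemma mulT_lt {i j : ℕ} : ∀ p ∈ mulT i j, p.2 < 12 := by
  rcases lt_or_ge i 12 with hi | hi
  · rcases lt_or_ge j 12 with hj | hj
    · have : ∀ i < 12, ∀ j < 12, ∀ p ∈ mulT i j, p.2 < 12 := by decide +kernel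
      exact this i hi j hj
    · simp [mulT_of_le' i hj]
  · simp [mulT_of_le hi]

section free

variable {k : Type} [Field k] {A : Type} [Ring A] [Algebra k A] (w : ℕ → A)

/-- The enveloping algebra. -/
abbrev Env (k : Type) [Field k] (A : Type) [Ring A] [Algebra k A] := A ⊗[k] Aᵐᵒᵖ

/-- The elements `w a ⊗ w b` of the enveloping algebra. -/
def sb (k : Type) [Field k] {A : Type} [Ring A] [Algebra k A] (w : ℕ → A) (a b : ℕ) :
    Env k A := w a ⊗ₜ op (w b)

/-- The free bimodule of rank `r`. -/
abbrev Fr (k : Type) [Field k] (A : Type) [Ring A] [Algebra k A] (r : ℕ) := Fin r → Env k A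

/-- The standard generators of the free bimodule, extended by zero. -/
def gen (k : Type) [Field k] (A : Type) [Ring A] [Algebra k A] (r G : ℕ) : Fr k A r :=
  if h : G < r then Pi.single ⟨G, h⟩ 1 else 0

lemma gen_of_le {r G : ℕ} (h : r ≤ G) : gen k A r G = 0 := dif_neg h.not_gt

/-- The elements `w a • gen G • w b` of a free bimodule, coded by `144 * G + 12 * a + b`. -/
def atm (k : Type) [Field k] {A : Type} [Ring A] [Algebra k A] (w : ℕ → A) (r c : ℕ) : Fr k A r :=
  sb k w (c / 12 % 12) (c % 12) • gen k A r (c / 144)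

lemma atm_code (r G : ℕ) {a b : ℕ} (ha : a < 12) (hb : b < 12) :
    atm k w r (144 * G + 12 * a + b) = sb k w a b • gen k A r G := by
  unfold atm
  congr 2 <;> omega

/-- Scaled bimodule action on the coded elements of a free bimodule, prepended to a combination. -/
noncomputable def acF (a b : ℕ) (c : ℤ) (i : ℕ) (r : Comb) : Comb :=
  frc (Nat.mul 144 (Nat.div i 144)) fun G => frc (Nat.mod (Nat.div i 12) 12) fun d =>
    frc (Nat.mod i 12) fun e => fm (mulT a d) (fun c₁ i₁ r => fm (mulT e b)
      (fun c₂ i₂ r => (Int.mul c (Int.mul c₁ c₂), Nat.add (Nat.add G (Nat.mul 12 i₁)) i₂) :: r) r) r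

/-- Scaled bimodule action on the monomials, prepended to a combination. -/
noncomputable def acA (a b : ℕ) (c : ℤ) (i : ℕ) (r : Comb) : Comb :=
  fm (mulT a i) (fun c₁ i₁ r => fm (mulT i₁ b)
    (fun c₂ i₂ r => (Int.mul c (Int.mul c₁ c₂), i₂) :: r) r) r

/-- The formal linear extension of a bimodule map. -/
noncomputable def app (ac : ℕ → ℕ → ℤ → ℕ → Comb → Comb) (T : ℕ → Comb) (l : Comb) : Comb :=
  fm l (fun c i r => frc (Nat.mod (Nat.div i 12) 12) fun a => frc (Nat.mod i 12) fun b =>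
    fm (T (Nat.div i 144)) (fun c' i' r => ac a b (Int.mul c c') i' r) r) []

/-- The map from a free bimodule with prescribed values on generators. -/
noncomputable def mapOf {M : Type*} [AddCommGroup M] [Module (Env k A) M] (r : ℕ) (v : ℕ → M) :
    Fr k A r →ₗ[Env k A] M :=
  (Pi.basisFun (Env k A) (Fin r)).constr ℕ fun i => v i

lemma mapOf_gen {M : Type*} [AddCommGroup M] [Module (Env k A) M] {r : ℕ} (v : ℕ → M) {G : ℕ}
    (h : G < r) : mapOf r v (gen k A r G) = v G := by
  simp [mapOf, gen, h]

lemma hom_ext {M : Type*} [AddCommGroup M] [Module (Env k A) M] {r : ℕ}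
    {f g : Fr k A r →ₗ[Env k A] M} (h : ∀ G < r, f (gen k A r G) = g (gen k A r G)) : f = g := by
  refine (Pi.basisFun (Env k A) (Fin r)).ext fun i => ?_
  simpa [gen] using h i i.2

section action

variable {M : Type*} [AddCommGroup M] [Module (Env k A) M] (e : ℕ → M)
  (ac : ℕ → ℕ → ℤ → ℕ → Comb → Comb)

/-- The table `ac` describes the bimodule action on the elements `e i`. -/
def IsAct (k : Type) [Field k] {A : Type} [Ring A] [Algebra k A] (w : ℕ → A)
    {M : Type*} [AddCommGroup M] [Module (Env k A) M] (e : ℕ → M)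
    (ac : ℕ → ℕ → ℤ → ℕ → Comb → Comb) : Prop :=
  ∀ a b c i r, ev e (ac a b c i r) = c • sb k w a b • e i + ev e r

/-- The table `T` describes the values of a bimodule map on generators. -/
def IsTab {r : ℕ} (f : Fr k A r →ₗ[Env k A] M) (e : ℕ → M) (T : ℕ → Comb) : Prop :=
  ∀ G, f (gen k A r G) = ev e (T G)

variable {w e ac}

lemma IsAct.ev_fm (hac : IsAct k w e ac) (a b : ℕ) (c : ℤ) (l r : Comb) :
    ev e (fm l (fun c' i' r => ac a b (Int.mul c c') i' r) r) = c • sb k w a b • ev e l + ev e r :=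
  FKH.ev_fm (φ := c • DistribSMul.toAddMonoidHom M (sb k w a b)) _ _ (fun p _ r => by
    rw [hac, show Int.mul c p.1 = p.1 * c from mul_comm _ _, mul_smul]; rfl) _

lemma IsTab.map_ev {r : ℕ} {f : Fr k A r →ₗ[Env k A] M} {T : ℕ → Comb} (h : IsTab f e T)
    (hac : IsAct k w e ac) (l : Comb) : f (ev (atm k w r) l) = ev e (app ac T l) := by
  refine (add_zero _).symm.trans
    (FKH.ev_fm (φ := f.toAddMonoidHom) (atm k w r) l (fun p _ r => ?_) []).symm
  rw [frc_eq, frc_eq, hac.ev_fm, ← h]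
  congr 2
  exact (map_smul f _ _).symm

lemma IsTab.comp {r r' : ℕ} {f : Fr k A r →ₗ[Env k A] Fr k A r'} {g : Fr k A r' →ₗ[Env k A] M}
    {T T' : ℕ → Comb} (hf : IsTab f (atm k w r') T) (hg : IsTab g e T')
    (hac : IsAct k w e ac) : IsTab (g ∘ₗ f) e (fun G => app ac T' (T G)) := fun G => by
  rw [LinearMap.comp_apply, hf, hg.map_ev hac]

lemma IsTab.add {r : ℕ} {f g : Fr k A r →ₗ[Env k A] M} {T T' : ℕ → Comb} (hf : IsTab f e T)
    (hg : IsTab g e T') : IsTab (f + g) e (fun G => T G ++ T' G) := fun G => by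
  rw [LinearMap.add_apply, hf, hg, ev_append]

lemma IsTab.zsmul {r : ℕ} {f : Fr k A r →ₗ[Env k A] M} {T : ℕ → Comb} (c : ℤ) (hf : IsTab f e T) :
    IsTab (c • f) e (fun G => sc c (T G)) := fun G => by
  rw [LinearMap.smul_apply, hf, ev_sc]

lemma IsTab.zero {r : ℕ} : IsTab (0 : Fr k A r →ₗ[Env k A] M) e (fun _ => []) := fun _ => rfl

lemma IsTab.ext {r : ℕ} {f g : Fr k A r →ₗ[Env k A] M} {T T' : ℕ → Comb} (hf : IsTab f e T)
    (hg : IsTab g e T') (h : ((List.range r).all fun G => eqv (T G) (T' G)) = true) : f = g :=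
  hom_ext fun G hG => by
    rw [hf, hg]
    exact ev_congr e (List.all_eq_true.1 h G (List.mem_range.2 hG))

lemma isTab_mapOf {r : ℕ} {T : ℕ → Comb} (h : ∀ G, r ≤ G → T G = []) :
    IsTab (mapOf (k := k) (A := A) r fun G => ev e (T G)) e T := fun G => by
  rcases lt_or_ge G r with hG | hG
  · exact mapOf_gen _ hG
  · rw [gen_of_le hG, h G hG, map_zero, ev_nil]

end action

lemma sb_mul (a b a' b' : ℕ) : sb k w a b * sb k w a' b' =
    (w a * w a') ⊗ₜ op (w b' * w b) := by
  simp [sb]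

variable {w} (hw : IsFK k w)
include hw

lemma sb_one : sb k w 0 0 = 1 := by simp [sb, hw.one, Algebra.TensorProduct.one_def]

lemma isAct_atm (r : ℕ) : IsAct k w (atm k w r) acF := fun a b c i l => by
  rw [atm, smul_smul (sb k w a b), sb_mul, hw.mul, hw.mul, acF, frc_eq, frc_eq, frc_eq]
  let φ : A →+ Fr k A r := AddMonoidHom.mk' (fun x => c • (x ⊗ₜ[k] op (ev w (mulT (i % 12) b)) :
    Env k A) • gen k A r (i / 144)) fun x y => by rw [TensorProduct.add_tmul, add_smul, smul_add]
  refine ev_fm (φ := φ) w (mulT a (i / 12 % 12)) (fun p hp l => ?_) l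
  let ψ : A →+ Fr k A r := AddMonoidHom.mk' (fun y => p.1 • c • (w p.2 ⊗ₜ[k] op y : Env k A) •
    gen k A r (i / 144)) fun x y => by
      rw [MulOpposite.op_add, TensorProduct.tmul_add, add_smul, smul_add, smul_add]
  refine ev_fm (φ := ψ) w (mulT (i % 12) b) (fun q hq l => ?_) l
  rw [ev_cons]
  congr 1
  change (c * (p.1 * q.1)) • atm k w r (144 * (i / 144) + 12 * p.2 + q.2) = _
  rw [atm_code w r _ (mulT_lt p hp) (mulT_lt q hq)]
  change _ = q.1 • p.1 • c • sb k w p.2 q.2 • gen k A r (i / 144)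
  rw [smul_smul q.1, smul_smul]
  congr 1
  ring

lemma isAct_self [Module (Env k A) A] (hA : ∀ x y m : A, (x ⊗ₜ[k] op y : Env k A) • m = x * m * y) :
    IsAct k w w acA := fun a b c i l => by
  rw [sb, hA, hw.mul]
  refine ev_fm (φ := c • AddMonoidHom.mulRight (w b)) w _ (fun p _ l => ?_) l
  change _ = p.1 • c • (w p.2 * w b) + _
  rw [hw.mul]
  refine ev_fm (φ := (p.1 • c • AddMonoidHom.id A : A →+ A)) w _ (fun q _ l => ?_) l
  rw [ev_cons]
  congr 1
  change (c * (p.1 * q.1)) • w q.2 = q.1 • p.1 • c • w q.2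
  rw [smul_smul q.1, smul_smul]
  congr 1
  ring

lemma gen_eq (r G : ℕ) : gen k A r G = atm k w r (144 * G) := by
  have := atm_code (k := k) w r G (a := 0) (b := 0) (by norm_num) (by norm_num)
  rw [sb_one hw, one_smul] at this
  exact this.symm

/-- The monomial basis. -/
noncomputable def bas : Module.Basis (Fin 12) k A := .mk hw.indep hw.span

lemma bas_apply (i : Fin 12) : bas hw i = w i := by simp [bas]

/-- The `k`-basis of a free bimodule given by the coded elements. -/
noncomputable def basFr (r : ℕ) : Module.Basis (Σ _ : Fin r, Fin 12 × Fin 12) k (Fr k A r) :=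
  Pi.basis fun _ => (bas hw).tensorProduct ((bas hw).map (opLinearEquiv k))

lemma basFr_apply (r : ℕ) (i : Fin r) (a b : Fin 12) :
    basFr hw r ⟨i, a, b⟩ = atm k w r (144 * i + 12 * a + b) := by
  rw [atm_code w r i a.2 b.2, gen, dif_pos i.2, basFr, Pi.basis_apply]
  ext j
  by_cases hj : j = i
  · subst hj; simp [bas_apply, sb]
  · simp [hj]

lemma exists_linearMap {N : Type*} [AddCommGroup N] [Module k N] (r : ℕ) (v : ℕ → N) :
    ∃ h : Fr k A r →ₗ[k] N, ∀ G < r, ∀ a < 12, ∀ b < 12,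
      h (atm k w r (144 * G + 12 * a + b)) = v (144 * G + 12 * a + b) := by
  refine ⟨(basFr hw r).constr k fun i => v (144 * i.1 + 12 * i.2.1 + i.2.2),
    fun G hG a ha b hb => ?_⟩
  have := basFr_apply hw r ⟨G, hG⟩ ⟨a, ha⟩ ⟨b, hb⟩
  rw [← this, Module.Basis.constr_basis]

lemma linearMap_ext {N : Type*} [AddCommGroup N] [Module k N] {r : ℕ} {f g : Fr k A r →ₗ[k] N}
    (h : ∀ G < r, ∀ a < 12, ∀ b < 12, f (atm k w r (144 * G + 12 * a + b)) =
      g (atm k w r (144 * G + 12 * a + b))) : f = g :=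
  (basFr hw r).ext fun ⟨i, a, b⟩ => by rw [basFr_apply]; exact h i i.2 a a.2 b b.2

end free

end FKH

/-! ### The Koszul complex -/

namespace FKH

/-- The differential of the Koszul complex in degree `1`. -/
def dTab1 : List Comb :=
  [[(-1, 1), (1, 12)], [(-1, 2), (1, 24)], [(-1, 3), (1, 36)]]

/-- The differential of the Koszul complex in degree `2`. -/
def dTab2 : List Comb :=
  [[(1, 1), (1, 12)], [(1, 146), (1, 168)], [(1, 291), (1, 324)],
   [(1, 2), (1, 36), (1, 147), (1, 156), (1, 289), (1, 312)],
   [(1, 3), (1, 24), (1, 145), (1, 180), (1, 290), (1, 300)]]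

/-- The differential of the Koszul complex in degree `3`. -/
def dTab3 : List Comb :=
  [[(-1, 1), (1, 12)], [(-1, 146), (1, 168)], [(-1, 291), (1, 324)],
   [(-1, 145), (1, 156), (-1, 289), (1, 300), (-1, 434), (1, 468), (-1, 579), (1, 600)],
   [(-1, 2), (1, 24), (-1, 290), (1, 312), (-1, 435), (1, 444), (-1, 577), (1, 612)],
   [(-1, 3), (1, 36), (-1, 147), (1, 180), (-1, 433), (1, 456), (-1, 578), (1, 588)]]

/-- The differential of the Koszul complex in degree `4`. -/
def dTab4 : List Comb :=
  [[(1, 1), (1, 12)], [(1, 146), (1, 168)], [(1, 291), (1, 324)],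
   [(1, 433), (1, 444), (1, 578), (1, 600), (1, 723), (1, 756)],
   [(1, 2), (1, 36), (1, 147), (1, 156), (1, 289), (1, 312), (1, 434), (1, 468), (1, 579),
    (1, 588), (1, 721), (1, 744)],
   [(1, 3), (1, 24), (1, 145), (1, 180), (1, 290), (1, 300), (1, 435), (1, 456), (1, 577),
    (1, 612), (1, 722), (1, 732)]]

/-- The differential of the Koszul complex in degree `5`. -/
def dTab5 : List Comb :=
  [[(-1, 1), (1, 12)], [(-1, 146), (1, 168)], [(1, 291), (-1, 324)],
   [(-1, 145), (1, 156), (-1, 289), (1, 300), (-1, 433), (1, 444), (-1, 578), (1, 612),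
    (-1, 723), (1, 744)],
   [(-1, 2), (1, 24), (-1, 290), (1, 312), (-1, 434), (1, 456), (-1, 579), (1, 588), (-1, 721),
    (1, 756)],
   [(-1, 3), (1, 36), (-1, 147), (1, 180), (-2, 291), (2, 324), (-1, 435), (1, 468), (-1, 577),
    (1, 600), (-1, 722), (1, 732)]]

/-- The connecting map of the Koszul complex in degree `0`. -/
def fTab0 : List Comb :=
  [[(2, 296), (2, 304), (2, 318), (2, 338), (2, 361), (2, 384), (1, 442), (-1, 463), (1, 474),
    (1, 483), (1, 494), (1, 506), (1, 552), (1, 585), (-1, 593), (1, 616), (1, 625), (1, 651),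
    (1, 661), (1, 684), (1, 728), (1, 736), (1, 750), (1, 770), (1, 793), (1, 816)]]

/-- The connecting map of the Koszul complex in degree `1`. -/
def fTab1 : List Comb :=
  [[(-2, 298), (2, 317), (2, 318), (2, 328), (-2, 363), (2, 374), (2, 408), (-1, 442),
    (1, 461), (1, 462), (1, 472), (-1, 507), (1, 518), (1, 552)],
   [(-2, 297), (2, 304), (2, 307), (2, 330), (-2, 339), (2, 349), (2, 396), (-1, 441),
    (1, 448), (1, 451), (1, 474), (-1, 483), (1, 493), (1, 540)],
   [(-2, 296), (2, 306), (2, 316), (-2, 337), (-2, 362), (2, 384), (-1, 440), (1, 450),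
    (1, 460), (-1, 481), (-1, 506), (1, 528)]]

/-- The periodicity map of the Koszul complex to degree `0`. -/
def thTab0 : List Comb :=
  [[(1, 0)], [(1, 0)], [(-1, 0)], [], []]

/-- The periodicity map of the Koszul complex to degree `1`. -/
def thTab1 : List Comb :=
  [[(1, 0)], [(1, 144)], [(-1, 288)], [], [], [(2, 288)]]

/-- The periodicity map of the Koszul complex to degree `2`. -/
def thTab2 : List Comb :=
  [[(1, 0)], [(1, 144)], [(-1, 288)], [(2, 288)], [(1, 432)], [(1, 576)]]

/-- The contraction of the Koszul complex in degree `0`. -/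
def hTab0 : List Comb :=
  [[], [(-1, 0)], [(-1, 144)], [(-1, 288)], [(-1, 2), (-1, 156)], [(-1, 3), (-1, 300)],
   [(1, 3), (1, 180), (1, 290), (1, 300)], [(-1, 147), (-1, 312)], [(-1, 6), (-1, 48), (-1, 157)],
   [(1, 39), (1, 293), (1, 315), (-1, 336)], [(-1, 38), (1, 192), (1, 228), (-1, 292)],
   [(-1, 10), (-1, 62), (1, 252), (-1, 304)]]

/-- The contraction of the Koszul complex in degree `1`. -/
def hTab1 : List Comb :=
  [[], [(1, 0)], [], [], [(1, 2)], [(1, 3)], [(-1, 588)], [(1, 435)], [(1, 6)],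
   [(1, 7), (-1, 447)], [], [(1, 10)], [], [(1, 576)], [(1, 144)], [],
   [(1, 3), (-1, 180), (1, 578), (-1, 588)], [(1, 289), (-1, 300), (-1, 468), (1, 579)],
   [(1, 156), (-1, 289), (1, 300), (-1, 434), (1, 468), (-1, 579)], [(1, 147)],
   [(-1, 7), (-1, 181), (1, 302), (-1, 336), (1, 447), (1, 582), (-1, 636)],
   [(1, 39), (-1, 157), (-1, 437), (-1, 446), (1, 624)],
   [(1, 149), (1, 169), (-1, 216), (1, 458)],
   [(1, 41), (1, 42), (1, 252), (-1, 304), (-1, 440), (1, 494), (1, 593), (1, 594), (1, 604),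
    (-1, 662)],
   [], [(1, 432)], [], [(1, 288)], [], [(-1, 312)], [(-1, 290), (1, 312)], [(-1, 289), (1, 468)],
   [(-1, 26), (1, 183), (1, 469), (1, 492), (1, 504), (1, 580)],
   [(1, 149), (-1, 159), (1, 360), (1, 439), (-1, 471), (-1, 603)], [(1, 292)],
   [(-1, 161), (1, 218), (1, 229), (-1, 316), (1, 337), (1, 373), (1, 442), (-1, 473),
    (-1, 495), (-1, 507), (1, 518), (-1, 540), (-1, 619), (1, 696)]]

/-- The contraction of the Koszul complex in degree `2`. -/
def hTab2 : List Comb :=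
  [[], [(-1, 0)], [], [], [(-1, 2)], [(-1, 3)], [], [], [(-1, 6)], [(-1, 7)], [], [(-1, 10)], [],
   [(-1, 432)], [(-1, 144)], [], [(1, 2), (1, 36), (1, 147), (1, 588), (1, 721), (1, 744)],
   [(1, 456)], [(-1, 145), (-1, 456)], [(-1, 147)],
   [(-1, 6), (1, 26), (-1, 48), (-1, 157), (-1, 313), (-1, 438), (-1, 469), (1, 580), (1, 583),
    (-1, 589), (1, 648)],
   [(1, 7), (-1, 14), (1, 39), (-1, 60), (-1, 159), (-1, 181), (-1, 436), (-2, 446), (1, 725),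
    (-1, 733), (-1, 758), (-1, 768)],
   [(-1, 149)],
   [(1, 10), (1, 41), (1, 42), (1, 184), (1, 252), (-1, 304), (-1, 338), (-1, 494), (-1, 506),
    (1, 593), (1, 594), (1, 728)],
   [], [], [], [(-1, 288)], [], [(-1, 300), (-1, 435)], [(1, 290), (1, 300), (1, 435)],
   [(1, 289)],
   [(1, 6), (-1, 26), (1, 48), (-1, 216), (1, 302), (1, 447), (-1, 516), (-1, 580), (1, 589),
    (1, 636), (1, 759)],
   [(1, 293), (1, 315), (-1, 336), (1, 471)], [(1, 295), (-1, 325)],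
   [(-1, 10), (-1, 41), (-1, 42), (-1, 161), (-1, 184), (-1, 229), (1, 338), (-1, 442),
    (1, 494), (1, 506), (-1, 593), (-1, 594), (-1, 728), (-1, 749), (-1, 750)],
   [], [(-1, 720)], [], [], [(-1, 3), (-1, 145), (-1, 180), (-1, 722)], [(1, 444)],
   [(-1, 444), (1, 578), (1, 756)], [(-1, 456)],
   [(1, 7), (1, 14), (1, 60), (2, 159), (1, 293), (1, 315), (1, 439), (1, 446), (-1, 457),
    (1, 471), (-1, 504), (1, 591), (-1, 602), (1, 725), (1, 733), (1, 768)],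
   [(1, 27), (1, 295), (1, 303), (1, 459), (1, 581), (1, 615)],
   [(1, 216), (1, 480), (1, 516), (-1, 759)],
   [(-1, 185), (-1, 205), (-1, 448), (1, 528), (-1, 730), (-1, 782), (-1, 807)], [], [(-1, 576)],
   [], [], [(1, 756)],
   [(1, 2), (1, 36), (1, 147), (1, 156), (1, 434), (1, 468), (1, 588), (1, 721), (1, 744)],
   [(-1, 468)], [(-1, 444), (-1, 723)],
   [(-2, 27), (-1, 169), (-1, 228), (-1, 295), (-1, 303), (-1, 459), (-1, 581), (-1, 582),
    (1, 590), (-1, 601), (-1, 615), (-1, 660), (-1, 746), (1, 780), (-1, 792)],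
   [(1, 216), (1, 313), (1, 480), (2, 516), (-1, 583), (-2, 759)],
   [(-1, 181), (-1, 436), (-1, 446), (-1, 758)],
   [(-1, 218), (-1, 316), (1, 493), (-1, 586), (-1, 650), (-1, 672), (-1, 761), (-1, 762)]]

/-- The contraction of the Koszul complex in degree `3`. -/
def hTab3 : List Comb :=
  [[], [(1, 0)], [], [], [(1, 2)], [(1, 3)], [], [], [(1, 6)], [(1, 7)], [], [(1, 10)], [], [],
   [(1, 144)], [], [(1, 36), (-1, 147), (-1, 577)], [], [(1, 145)], [(1, 147)],
   [(-1, 7), (-1, 181), (1, 302), (-1, 336), (-1, 436), (-1, 439), (1, 446), (-1, 469),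
    (-1, 480), (1, 591), (1, 726), (-1, 780)],
   [(1, 39), (-1, 157), (1, 458), (1, 582), (1, 648), (1, 724), (1, 745), (1, 768)], [(1, 149)],
   [(-1, 87), (1, 153), (1, 217), (-2, 606), (-1, 650), (1, 661), (1, 696), (1, 751), (-1, 795)],
   [], [], [], [(1, 288)], [(-1, 289)], [(-1, 312)], [(-1, 290), (1, 312)], [],
   [(-1, 26), (1, 39), (-1, 157), (-1, 458), (-1, 590), (1, 724), (1, 768), (1, 804)],
   [(1, 149), (-1, 159), (1, 169), (-1, 216), (1, 313), (1, 437), (-1, 447), (1, 457),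
    (-1, 504), (1, 583), (1, 602), (-1, 615), (-1, 660)],
   [(-1, 295)], [(1, 162), (1, 229), (-1, 296), (-1, 350), (-1, 362), (1, 617), (1, 618)], [],
   [(1, 432)], [], [], [(-1, 456), (1, 579)], [(1, 435), (-1, 600)], [(-1, 468)],
   [(1, 579), (-1, 588)],
   [(1, 169), (1, 437), (1, 438), (-1, 447), (1, 457), (-1, 492), (-2, 504), (1, 602),
    (-1, 615), (1, 624), (1, 747)],
   [(1, 439), (-1, 591), (-1, 759)], [(1, 301), (1, 458)],
   [(1, 442), (-1, 482), (-1, 518), (-1, 552)], [], [(1, 720)], [], [(1, 576)], [(1, 732)],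
   [(-1, 145), (1, 156), (-1, 289), (-1, 433), (1, 444), (-1, 578), (-1, 723), (1, 744)],
   [(-1, 744)], [], [(1, 436), (1, 469), (2, 480), (1, 516), (-1, 591), (1, 759), (-1, 792)],
   [(1, 157), (1, 301), (1, 471), (-1, 581), (-1, 582), (-1, 724), (-1, 745), (-1, 768)],
   [(-1, 6), (-1, 38), (-1, 60), (-1, 149), (1, 159), (-1, 169), (1, 313), (-1, 437),
    (-1, 438), (1, 447), (1, 580), (1, 589), (-1, 602), (-1, 624)],
   [(1, 186), (1, 441), (-1, 451), (1, 473), (1, 483), (-1, 493), (2, 605), (2, 606),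
    (-1, 638), (1, 650), (1, 806)],
   [], [], [], [], [(-1, 433), (1, 444), (-1, 723)], [], [(-1, 434), (-1, 456), (1, 579)],
   [(1, 723)], [(-2, 39), (-1, 301), (-1, 471), (-1, 603), (-1, 648), (-1, 758), (-1, 804)],
   [(-1, 169), (-1, 437), (1, 447), (-1, 457), (1, 470), (1, 492), (1, 504), (-1, 602),
    (-1, 624), (-1, 747)],
   [],
   [(-1, 162), (1, 172), (-1, 229), (1, 296), (-1, 306), (1, 449), (1, 460), (-1, 618),
    (-1, 662), (1, 729), (-1, 750)]]

/-- The contraction of the Koszul complex in degree `4`. -/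
def hTab4 : List Comb :=
  [[], [(-1, 0)], [], [], [(-1, 2)], [(-1, 3)], [], [], [(-1, 6)], [(-1, 7)], [], [(-1, 10)], [],
   [], [(-1, 144)], [], [(1, 2), (1, 36), (1, 147), (2, 289), (1, 588), (1, 721)], [],
   [(-1, 145)], [(-1, 147)],
   [(-1, 6), (1, 26), (-1, 48), (-1, 157), (1, 313), (-1, 438), (-1, 469), (1, 580), (1, 583),
    (-1, 589), (1, 648)],
   [(-1, 457), (-1, 504)], [(-1, 149)], [(-1, 153)], [], [], [], [(1, 288)], [(-1, 289)],
   [(1, 300), (-1, 435), (-1, 456)], [(-1, 290), (-1, 300), (1, 435), (1, 456)], [],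
   [(-1, 157), (1, 614)], [(-1, 293), (-1, 315), (1, 336), (1, 471), (-1, 492), (-1, 504)],
   [(-1, 295)],
   [(1, 10), (1, 41), (1, 42), (1, 161), (2, 162), (-1, 229), (1, 374), (1, 442), (1, 473),
    (1, 474), (1, 593), (1, 594), (1, 728), (1, 749), (1, 750)],
   [], [], [], [], [], [(1, 3), (1, 145), (1, 180), (2, 290), (2, 300), (1, 722), (1, 732)], [],
   [],
   [(1, 6), (-1, 26), (1, 48), (1, 157), (-1, 216), (1, 437), (1, 447), (-1, 458), (1, 469),
    (1, 480), (-1, 580), (1, 589), (-1, 648), (1, 759)],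
   [(1, 181), (1, 504), (-1, 602)],
   [(-1, 27), (-1, 169), (-1, 228), (-2, 459), (-2, 601), (-2, 660), (-1, 746), (-1, 792)],
   [(1, 28), (-1, 42), (-1, 87), (-1, 161), (-2, 162), (1, 229), (1, 252), (1, 304), (1, 338),
    (-1, 374), (1, 384), (-1, 442), (1, 463), (-1, 473), (-1, 474), (-1, 494), (-2, 506),
    (-1, 552), (-1, 585), (-1, 594), (-1, 651), (-1, 661), (-1, 728), (-1, 750), (-1, 793),
    (-1, 806)],
   [], [], [], [], [], [(-1, 444)], [(1, 578)],
   [(-1, 3), (-1, 145), (-1, 180), (-2, 290), (-2, 300), (-1, 722), (-1, 732)],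
   [(1, 7), (-2, 181), (-2, 294), (-1, 436), (-1, 446), (1, 457), (1, 602), (1, 725), (-1, 758)],
   [(1, 27), (-1, 295), (-1, 303), (1, 459), (1, 581), (1, 615)],
   [(-1, 48), (1, 216), (-1, 313), (-1, 437), (-1, 447), (1, 458), (-1, 480), (-1, 589),
    (-1, 636)],
   [(1, 29), (-1, 63), (1, 205), (-1, 305), (1, 328), (-1, 362), (-1, 441), (-1, 481),
    (-1, 528), (1, 617), (-1, 626)],
   [], [(-1, 576)], [(-2, 288), (-1, 720)], [(-1, 432)], [(2, 291), (-1, 444), (-1, 756)],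
   [(1, 2), (1, 36), (1, 147), (1, 156), (1, 289), (2, 312), (1, 434), (1, 588), (1, 721),
    (1, 744)],
   [], [(-2, 291), (-1, 723)],
   [(1, 169), (1, 228), (1, 295), (1, 303), (1, 459), (-1, 581), (-1, 582), (1, 590), (1, 601),
    (-1, 615), (1, 660), (1, 746), (1, 792)],
   [(1, 216), (-1, 302), (-1, 313), (-1, 437), (1, 458), (-1, 583), (-1, 759)],
   [(1, 39), (1, 159), (2, 181), (1, 293), (2, 294), (3, 315), (-1, 336), (1, 439), (1, 471),
    (-1, 492), (2, 747), (1, 758), (-1, 768)],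
   [(-1, 40), (-2, 43), (-1, 61), (1, 154), (-1, 218), (-1, 231), (-3, 297), (-1, 316),
    (-3, 319), (-2, 337), (-2, 363), (-1, 475), (-1, 518), (1, 627), (-1, 729), (-1, 751),
    (-1, 761), (-1, 769), (-1, 795), (-1, 805)]]

/-- The contraction of the Koszul complex in degree `5`. -/
def hTab5 : List Comb :=
  [[], [(1, 0)], [], [], [(1, 2)], [(1, 3)], [], [], [(1, 6)], [(1, 7)], [], [(1, 10)], [], [],
   [(1, 144)], [], [(1, 36), (-1, 147), (-1, 577)], [], [(1, 145)], [(1, 147)],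
   [(-1, 7), (-1, 181), (1, 302), (-1, 336), (-1, 436), (-1, 439), (1, 446), (-1, 469),
    (-1, 480), (1, 591), (1, 726), (-1, 780)],
   [], [(1, 149)], [(1, 153)], [], [], [], [(1, 288)], [(-1, 289)], [(-1, 312)],
   [(-1, 290), (1, 312)], [], [(-1, 26), (1, 157), (-1, 458), (-1, 590), (1, 724), (-1, 758)],
   [(1, 149), (-1, 159), (1, 169), (-1, 216), (1, 313), (1, 437), (-1, 447), (1, 457),
    (-1, 504), (1, 583), (1, 602), (-1, 615), (-1, 660)],
   [(-1, 295)], [(-1, 162), (-1, 229), (-1, 296), (-1, 350), (-1, 362), (1, 617), (1, 618)], [],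
   [(1, 432)], [], [], [(1, 456), (1, 579), (-1, 588)],
   [(-1, 3), (1, 36), (-1, 147), (1, 180), (1, 468), (-1, 577), (-1, 722)], [],
   [(2, 290), (-2, 312), (-1, 456)],
   [(-1, 6), (-1, 159), (1, 216), (1, 293), (2, 294), (-1, 303), (1, 437), (-2, 447), (1, 457),
    (1, 580), (2, 583), (1, 589), (-1, 615)],
   [(1, 7), (1, 295), (-2, 315), (-1, 325), (1, 439), (-1, 591), (1, 725), (-1, 759)],
   [(1, 26), (-1, 301), (2, 314), (1, 581), (-1, 648), (1, 768), (-2, 804)],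
   [(-1, 10), (2, 29), (1, 40), (1, 86), (1, 187), (1, 318), (-1, 328), (1, 461), (1, 475),
    (-1, 518), (1, 585), (1, 607), (-1, 637), (1, 761), (-1, 782), (-1, 805)],
   [], [(1, 720)], [(2, 288)], [(1, 576)], [(-2, 291), (1, 468)],
   [(1, 300), (-1, 612), (-2, 744)], [(1, 744)], [(2, 291), (1, 732)],
   [(-1, 7), (-1, 295), (-2, 302), (2, 315), (1, 325), (2, 336), (1, 436), (1, 469), (1, 480),
    (-1, 725), (1, 759), (2, 780), (1, 792)],
   [(1, 26), (1, 39), (-1, 301), (1, 471), (1, 581), (1, 582), (1, 590), (-1, 724), (-1, 745),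
    (1, 758)],
   [(-1, 38), (-1, 60), (1, 159), (-1, 216), (-2, 294), (2, 303), (1, 313), (1, 447),
    (-1, 583), (-1, 615), (-1, 624), (-1, 660)],
   [(1, 41), (1, 61), (2, 186), (1, 195), (1, 231), (-1, 252), (2, 330), (1, 441), (1, 473),
    (1, 483), (-2, 493), (-2, 505), (1, 519), (-2, 540), (1, 619), (-2, 638), (-2, 650),
    (2, 696), (-2, 783), (-2, 795)],
   [], [], [], [(-2, 288)], [(-1, 433), (1, 444), (-1, 723)],
   [(-2, 290), (4, 312), (1, 456), (1, 579), (-1, 588)], [(2, 290), (-2, 312), (-1, 434)],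
   [(1, 723), (2, 744)],
   [(1, 26), (-1, 39), (-2, 157), (1, 301), (3, 458), (-1, 471), (1, 582), (1, 590), (-1, 724),
    (1, 745), (1, 758), (-1, 768)],
   [(-1, 38), (-1, 60), (-2, 149), (3, 159), (-1, 169), (-2, 360), (-3, 437), (4, 447),
    (-1, 457), (-1, 492), (-3, 583), (-1, 602), (2, 615), (-1, 624), (1, 747)],
   [(1, 7), (1, 295), (2, 302), (-1, 325), (-2, 336), (-1, 480), (-1, 591), (1, 725),
    (-2, 780), (-1, 792)],
   [(-2, 28), (-1, 31), (1, 49), (-1, 161), (4, 162), (-3, 172), (1, 218), (1, 229), (-1, 305),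
    (2, 306), (-2, 316), (1, 384), (-1, 440), (1, 450), (-2, 460), (2, 481), (-2, 494),
    (-1, 506), (1, 617), (2, 618), (2, 639), (2, 749), (3, 750), (-2, 760), (3, 771), (-1, 793)]]

/-- The projection of the Koszul complex in degree `3` to its homology. -/
def gTab : List Comb :=
  [[], [], [], [], [], [], [], [], [], [], [], [], [], [], [], [], [], [], [], [], [], [(-1, 0)],
   [], [(1, 2)], [], [], [], [], [], [], [], [], [], [], [], [], [], [], [], [], [], [], [], [],
   [], [], [], [], [], [], [], [], [], [], [], [], [], [(1, 0)], [], [(-1, 2)], [], [], [], [],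
   [], [], [], [], [], [], [], []]

/-- The ranks of the Koszul complex. -/
def rk : ℕ → ℕ
  | 0 => 1
  | 1 => 3
  | 2 => 5
  | _ + 3 => 6

/-- The differential of the Koszul complex on generators. -/
noncomputable def dT : ℕ → ℕ → Comb
  | 0, _ => []
  | 1, G => gD dTab1 G
  | 2, G => gD dTab2 G
  | 3, G => gD dTab3 G
  | n + 4, G => bif Nat.beq (n % 2) 0 then gD dTab4 G else gD dTab5 G

/-- The periodicity map of the Koszul complex on generators. -/
noncomputable def thT : ℕ → ℕ → Comb
  | 0, G => gD thTab0 G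
  | 1, G => gD thTab1 G
  | 2, G => gD thTab2 G
  | _ + 3, G => bif Nat.ble 6 G then [] else [(1, 144 * G)]

/-- The connecting map of the Koszul complex on generators. -/
noncomputable def fT : ℕ → ℕ → Comb
  | 0, G => gD fTab0 G
  | 1, G => gD fTab1 G
  | 2, G => app acF (fun G => gD fTab0 G) (gD thTab0 G)
  | n + 3, G => bif Nat.beq (n % 2) 0 then app acF (fun G => gD fTab1 G) (gD thTab1 G)
      else app acF (fun G => app acF (fun G => gD fTab0 G) (gD thTab0 G))
        (gD thTab2 G)

lemma dT_add_two (n : ℕ) : dT (n + 4 + 2) = dT (n + 4) := by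
  funext G
  change (bif Nat.beq ((n + 2) % 2) 0 then _ else _) = (bif Nat.beq (n % 2) 0 then _ else _)
  rw [Nat.add_mod_right]

lemma fT_add_two (n : ℕ) : fT (n + 3 + 2) = fT (n + 3) := by
  funext G
  change (bif Nat.beq ((n + 2) % 2) 0 then _ else _) = (bif Nat.beq (n % 2) 0 then _ else _)
  rw [Nat.add_mod_right]

lemma dT_of_le {n G : ℕ} (h : rk n ≤ G) : dT n G = [] := by
  match n with
  | 0 => rfl
  | 1 => exact gD_of_le (t := dTab1) h
  | 2 => exact gD_of_le (t := dTab2) h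
  | 3 => exact gD_of_le (t := dTab3) h
  | n + 4 =>
    change (bif Nat.beq (n % 2) 0 then gD dTab4 G else gD dTab5 G) = _
    rw [gD_of_le (t := dTab4) h, gD_of_le (t := dTab5) h, Bool.cond_self]

lemma thT_of_le {n G : ℕ} (h : rk (n + 2) ≤ G) : thT n G = [] := by
  match n with
  | 0 => exact gD_of_le (t := thTab0) h
  | 1 => exact gD_of_le (t := thTab1) h
  | 2 => exact gD_of_le (t := thTab2) h
  | n + 3 => simp only [thT, Nat.ble_eq_true_of_le (show 6 ≤ G from h), cond_true]

lemma fT_of_le {n G : ℕ} (h : rk n ≤ G) : fT n G = [] := by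
  match n with
  | 0 => exact gD_of_le (t := fTab0) h
  | 1 => exact gD_of_le (t := fTab1) h
  | 2 => rw [fT, gD_of_le (t := thTab0) h]; rfl
  | n + 3 =>
    change (bif Nat.beq (n % 2) 0 then _ else _) = _
    rw [gD_of_le (t := thTab1) h, gD_of_le (t := thTab2) h]
    cases Nat.beq (n % 2) 0 <;> rfl

/-- An eventually periodic sequence of checks is determined by its initial values. -/
lemma check_periodic {c : ℕ → Bool} (m : ℕ) (h : ∀ n, m ≤ n → c (n + 2) = c n)
    (h0 : (List.range (m + 2)).all c = true) (n : ℕ) : c n = true := by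
  induction n using Nat.strong_induction_on with
  | _ n ih =>
    rcases lt_or_ge n (m + 2) with hn | hn
    · exact List.all_eq_true.1 h0 n (List.mem_range.2 hn)
    · obtain ⟨n, rfl⟩ := Nat.exists_eq_add_of_le' (le_of_add_le_right hn)
      rw [h n (by omega)]
      exact ih n (by omega)

section

variable {k : Type} [Field k] {A : Type} [Ring A] [Algebra k A] (w : ℕ → A)

/-- The differential of the Koszul complex. -/
noncomputable def dK (k : Type) [Field k] {A : Type} [Ring A] [Algebra k A] (w : ℕ → A) (n : ℕ) :
    Fr k A (rk (n + 1)) →ₗ[Env k A] Fr k A (rk n) :=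
  mapOf _ fun G => ev (atm k w (rk n)) (dT (n + 1) G)

/-- The connecting map of the Koszul complex. -/
noncomputable def fK (k : Type) [Field k] {A : Type} [Ring A] [Algebra k A] (w : ℕ → A) (n : ℕ) :
    Fr k A (rk n) →ₗ[Env k A] Fr k A (rk (n + 3)) :=
  mapOf _ fun G => ev (atm k w (rk (n + 3))) (fT n G)

/-- The periodicity map of the Koszul complex. -/
noncomputable def thK (k : Type) [Field k] {A : Type} [Ring A] [Algebra k A] (w : ℕ → A) (n : ℕ) :
    Fr k A (rk (n + 2)) →ₗ[Env k A] Fr k A (rk n) :=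
  mapOf _ fun G => ev (atm k w (rk n)) (thT n G)

/-- The augmentation. -/
noncomputable def eps (k : Type) [Field k] {A : Type} [Ring A] [Algebra k A] (w : ℕ → A)
    [Module (Env k A) A] : Fr k A 1 →ₗ[Env k A] A :=
  mapOf _ fun G => ev w (bif Nat.beq G 0 then [(1, 0)] else [])

lemma isTab_dK (n : ℕ) : IsTab (dK k w n) (atm k w (rk n)) (dT (n + 1)) :=
  isTab_mapOf fun _ => dT_of_le

lemma isTab_fK (n : ℕ) : IsTab (fK k w n) (atm k w (rk (n + 3))) (fT n) :=
  isTab_mapOf fun _ => fT_of_le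

lemma isTab_thK (n : ℕ) : IsTab (thK k w n) (atm k w (rk n)) (thT n) :=
  isTab_mapOf fun _ => thT_of_le

lemma isTab_eps [Module (Env k A) A] :
    IsTab (eps k w) w (fun G => bif Nat.beq G 0 then [(1, 0)] else []) :=
  isTab_mapOf fun G hG => by cases G; · omega
                             rfl

lemma dK_add_two (n : ℕ) : dK k w (n + 3 + 2) = dK k w (n + 3) := by
  unfold dK
  simp only [show n + 3 + 2 + 1 = n + 4 + 2 from rfl, dT_add_two]
  rfl

variable {w} (hw : IsFK k w)
include hw

lemma dK_dK (n : ℕ) : dK k w n ∘ₗ dK k w (n + 1) = 0 := by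
  refine ((isTab_dK w (n + 1)).comp (isTab_dK w n) (isAct_atm hw _)).ext .zero ?_
  refine check_periodic (c := fun n => (List.range (rk (n + 1 + 1))).all fun G =>
    eqv (app acF (dT (n + 1)) (dT (n + 1 + 1) G)) []) 3 (fun n hn => ?_) (by decide +kernel) n
  obtain ⟨n, rfl⟩ := Nat.exists_eq_add_of_le' hn
  simp only [show n + 3 + 2 + 1 = n + 4 + 2 from rfl, show n + 3 + 2 + 1 + 1 = n + 1 + 4 + 2 from rfl,
    dT_add_two]
  rfl

lemma dK_fK_zero : dK k w 2 ∘ₗ fK k w 0 = 0 := by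
  refine ((isTab_fK w 0).comp (isTab_dK w 2) (isAct_atm hw _)).ext .zero ?_
  decide +kernel

lemma dK_fK (n : ℕ) : dK k w (n + 3) ∘ₗ fK k w (n + 1) + fK k w n ∘ₗ dK k w n = 0 := by
  refine (((isTab_fK w (n + 1)).comp (isTab_dK w (n + 3)) (isAct_atm hw _)).add
    ((isTab_dK w n).comp (isTab_fK w n) (isAct_atm hw _))).ext .zero ?_
  refine check_periodic (c := fun n => (List.range (rk (n + 1))).all fun G =>
    eqv (app acF (dT (n + 4)) (fT (n + 1) G) ++ app acF (fT n) (dT (n + 1) G)) []) 3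
    (fun n hn => ?_) (by decide +kernel) n
  obtain ⟨n, rfl⟩ := Nat.exists_eq_add_of_le' hn
  have h1 : dT (n + 3 + 2 + 4) = dT (n + 3 + 4) := dT_add_two (n + 3)
  have h2 : dT (n + 3 + 2 + 1) = dT (n + 3 + 1) := dT_add_two n
  have h3 : fT (n + 3 + 2 + 1) = fT (n + 3 + 1) := fT_add_two (n + 1)
  simp only [h1, h2, h3, fT_add_two]
  rfl

lemma fK_fK (n : ℕ) : fK k w (n + 3) ∘ₗ fK k w n = 0 := by
  refine ((isTab_fK w n).comp (isTab_fK w (n + 3)) (isAct_atm hw _)).ext .zero ?_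
  refine check_periodic (c := fun n => (List.range (rk n)).all fun G =>
    eqv (app acF (fT (n + 3)) (fT n G)) []) 3
    (fun n hn => ?_) (by decide +kernel) n
  obtain ⟨n, rfl⟩ := Nat.exists_eq_add_of_le' hn
  simp only [show n + 3 + 2 + 3 = n + 3 + 3 + 2 from rfl, fT_add_two]
  rfl

lemma dK_thK (n : ℕ) : dK k w n ∘ₗ thK k w (n + 1) = thK k w n ∘ₗ dK k w (n + 2) := by
  refine ((isTab_thK w (n + 1)).comp (isTab_dK w n) (isAct_atm hw _)).ext
    ((isTab_dK w (n + 2)).comp (isTab_thK w n) (isAct_atm hw _)) ?_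
  refine check_periodic (c := fun n => (List.range (rk (n + 1 + 2))).all fun G =>
    eqv (app acF (dT (n + 1)) (thT (n + 1) G)) (app acF (thT n) (dT (n + 3) G))) 3
    (fun n hn => ?_) (by decide +kernel) n
  obtain ⟨n, rfl⟩ := Nat.exists_eq_add_of_le' hn
  simp only [show n + 3 + 2 + 1 = n + 4 + 2 from rfl, show n + 3 + 2 + 3 = n + 2 + 4 + 2 from rfl,
    dT_add_two]
  rfl

lemma fK_thK (n : ℕ) : fK k w n ∘ₗ thK k w n = thK k w (n + 3) ∘ₗ fK k w (n + 2) := by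
  refine ((isTab_thK w n).comp (isTab_fK w n) (isAct_atm hw _)).ext
    ((isTab_fK w (n + 2)).comp (isTab_thK w (n + 3)) (isAct_atm hw _)) ?_
  refine check_periodic (c := fun n => (List.range (rk (n + 2))).all fun G =>
    eqv (app acF (fT n) (thT n G)) (app acF (thT (n + 3)) (fT (n + 2) G))) 3
    (fun n hn => ?_) (by decide +kernel) n
  obtain ⟨n, rfl⟩ := Nat.exists_eq_add_of_le' hn
  simp only [show n + 3 + 2 + 2 = n + 2 + 3 + 2 from rfl, fT_add_two]
  rfl

lemma thK_add_three (n : ℕ) : thK k w (n + 3) = LinearMap.id := by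
  refine hom_ext fun G hG => ?_
  rw [isTab_thK w (n + 3) G]
  have : Nat.ble 6 G = false := by
    rw [← Bool.not_eq_true, Nat.ble_eq]
    exact not_le.2 hG
  simp only [thT, this, cond_false, ev_cons, ev_nil, one_smul, add_zero]
  exact (gen_eq hw _ _).symm

end

end FKH

/-! ### Exactness of the Koszul complex -/

namespace FKH

open MulOpposite

section exact

variable {k : Type} [Field k] {A : Type} [Ring A] [Algebra k A] {w : ℕ → A}
  {M N : Type*} [AddCommGroup M] [Module k M] [Module (Env k A) M] [IsScalarTower k (Env k A) M]
  [AddCommGroup N] [Module k N] [Module (Env k A) N]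

/-- The table `H` describes a map commuting with left multiplications. -/
def IsLTab {r : ℕ} (w : ℕ → A) (h : Fr k A r →ₗ[k] M) (e : ℕ → M) (H : ℕ → Comb) : Prop :=
  ∀ (x : A) (G b : ℕ), b < 12 → h ((x ⊗ₜ[k] op (w b) : Env k A) • gen k A r G) =
    (x ⊗ₜ[k] (1 : Aᵐᵒᵖ) : Env k A) • ev e (H (12 * G + b))

/-- The formal linear extension of a map commuting with left multiplications. -/
noncomputable def appL (ac : ℕ → ℕ → ℤ → ℕ → Comb → Comb) (H : ℕ → Comb) (l : Comb) : Comb :=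
  fm l (fun c i r => frc (Nat.mod (Nat.div i 12) 12) fun a =>
    frc (Nat.add (Nat.mul 12 (Nat.div i 144)) (Nat.mod i 12)) fun j =>
      fm (H j) (fun c' i' r => ac a 0 (Int.mul c c') i' r) r) []

variable (hw : IsFK k w)
include hw

omit [IsScalarTower k (Env k A) M] [Module k M] in
lemma sb_zero_right (a : ℕ) : sb k w a 0 = w a ⊗ₜ[k] (1 : Aᵐᵒᵖ) := by
  rw [sb, hw.one, op_one]

omit [IsScalarTower k (Env k A) M] in
lemma IsLTab.map_ev {r : ℕ} {h : Fr k A r →ₗ[k] M} {e : ℕ → M} {H : ℕ → Comb}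
    {ac : ℕ → ℕ → ℤ → ℕ → Comb → Comb} (hh : IsLTab w h e H)
    (hac : IsAct k w e ac) (l : Comb) : h (ev (atm k w r) l) = ev e (appL ac H l) := by
  refine (add_zero _).symm.trans
    (FKH.ev_fm (φ := h.toAddMonoidHom) (atm k w r) l (fun p _ r => ?_) []).symm
  rw [frc_eq, frc_eq, hac.ev_fm, sb_zero_right hw]
  congr 2
  exact (hh _ _ _ (Nat.mod_lt _ (by norm_num))).symm

lemma exists_isLTab {r : ℕ} (e : ℕ → M) {H : ℕ → Comb} (h0 : ∀ j, 12 * r ≤ j → H j = []) :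
    ∃ h : Fr k A r →ₗ[k] M, IsLTab w h e H := by
  obtain ⟨h, hh⟩ := exists_linearMap hw r fun c =>
    sb k w (c / 12 % 12) 0 • ev e (H (12 * (c / 144) + c % 12))
  refine ⟨h, fun x G b hb => ?_⟩
  rcases lt_or_ge G r with hG | hG
  swap
  · rw [gen_of_le hG, h0 _ (by omega), ev_nil]; simp
  have hx : x ∈ Submodule.span k (Set.range fun i : Fin 12 => w i) := hw.span Submodule.mem_top
  induction hx using Submodule.span_induction with
  | mem x hx =>
    obtain ⟨a, rfl⟩ := hx
    have := hh G hG a a.2 b hb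
    rw [atm_code w r G a.2 hb, sb_zero_right hw] at this
    rw [← sb, this]
    have h1 : (144 * G + 12 * a + b) / 12 % 12 = a := by omega
    have h2 : 12 * ((144 * G + 12 * a + b) / 144) + (144 * G + 12 * a + b) % 12 = 12 * G + b := by
      omega
    rw [h1, h2]
  | zero =>
    have z (y : Aᵐᵒᵖ) : ((0 : A) ⊗ₜ[k] y : Env k A) = 0 := TensorProduct.zero_tmul _ _
    rw [z, z]
    exact (congrArg h (zero_smul (Env k A) _)).trans
      ((map_zero h).trans (zero_smul (Env k A) (ev e (H (12 * G + b)) : M)).symm)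
  | add x y _ _ hx hy => rw [TensorProduct.add_tmul, add_smul, map_add, hx, hy,
      TensorProduct.add_tmul, add_smul]
  | smul c x _ hx => rw [← TensorProduct.smul_tmul', smul_assoc, map_smul, hx,
      ← TensorProduct.smul_tmul', smul_assoc]

lemma IsLTab.map_smul {r : ℕ} {h : Fr k A r →ₗ[k] M} {e : ℕ → M} {H : ℕ → Comb}
    (hh : IsLTab w h e H) (x : A) (y : Fr k A r) :
    h ((x ⊗ₜ[k] (1 : Aᵐᵒᵖ) : Env k A) • y) = (x ⊗ₜ[k] (1 : Aᵐᵒᵖ) : Env k A) • h y := by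
  suffices h ∘ₗ Algebra.lsmul k k _ (x ⊗ₜ[k] (1 : Aᵐᵒᵖ) : Env k A) =
    Algebra.lsmul k k M (x ⊗ₜ[k] (1 : Aᵐᵒᵖ) : Env k A) ∘ₗ h from LinearMap.congr_fun this y
  refine linearMap_ext hw fun G _ a ha b hb => ?_
  rw [atm_code w r G ha hb, LinearMap.comp_apply, LinearMap.comp_apply, Algebra.lsmul_coe,
    Algebra.lsmul_coe]
  beta_reduce
  rw [smul_smul, sb, hh _ _ _ hb, Algebra.TensorProduct.tmul_mul_tmul, one_mul,
    hh _ _ _ hb, smul_smul, Algebra.TensorProduct.tmul_mul_tmul, one_mul]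

lemma IsLTab.comp {r r' : ℕ} {h : Fr k A r →ₗ[k] Fr k A r'} {h' : Fr k A r' →ₗ[k] M} {e : ℕ → M}
    {H H' : ℕ → Comb} {ac : ℕ → ℕ → ℤ → ℕ → Comb → Comb} (hh : IsLTab w h (atm k w r') H)
    (hh' : IsLTab w h' e H') (hac : IsAct k w e ac) :
    IsLTab w (h' ∘ₗ h) e (fun j => appL ac H' (H j)) := fun x G b hb => by
  rw [LinearMap.comp_apply, hh x G b hb, hh'.map_smul hw, hh'.map_ev hw hac]

omit [IsScalarTower k (Env k A) M] [Module k M] in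
lemma tmul_smul_gen (r : ℕ) (x : A) (G : ℕ) {b : ℕ} (hb : b < 12) :
    (x ⊗ₜ[k] op (w b) : Env k A) • gen k A r G = (x ⊗ₜ[k] (1 : Aᵐᵒᵖ) : Env k A) •
      ev (atm k w r) [(1, 144 * ((12 * G + b) / 12) + (12 * G + b) % 12)] := by
  rw [show (12 * G + b) / 12 = G by omega,
    show (12 * G + b) % 12 = b by omega, ev_cons, ev_nil, one_smul, add_zero,
    show 144 * G + b = 144 * G + 12 * 0 + b by omega, atm_code w r G (by norm_num) hb, smul_smul, sb,
    Algebra.TensorProduct.tmul_mul_tmul, hw.one, one_mul, mul_one]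

omit [IsScalarTower k (Env k A) M] in
lemma IsTab.isLTab [IsScalarTower k (Env k A) M] {r : ℕ} {f : Fr k A r →ₗ[Env k A] M} {e : ℕ → M}
    {T : ℕ → Comb} {ac : ℕ → ℕ → ℤ → ℕ → Comb → Comb} (hf : IsTab f e T) (hac : IsAct k w e ac) :
    IsLTab w (f.restrictScalars k) e (fun j => app ac T [(1, 144 * (j / 12) + j % 12)]) :=
  fun x G b hb => by
    rw [tmul_smul_gen hw r x G hb, LinearMap.coe_restrictScalars, map_smul, hf.map_ev hac]

omit hw [IsScalarTower k (Env k A) M] in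
lemma IsLTab.add {r : ℕ} {h h' : Fr k A r →ₗ[k] M} {e : ℕ → M} {H H' : ℕ → Comb}
    (hh : IsLTab w h e H) (hh' : IsLTab w h' e H') : IsLTab w (h + h') e (fun j => H j ++ H' j) :=
  fun x G b hb => by rw [LinearMap.add_apply, hh x G b hb, hh' x G b hb, ev_append, smul_add]

omit [IsScalarTower k (Env k A) M] in
lemma IsLTab.ext {r : ℕ} {h h' : Fr k A r →ₗ[k] M} {e : ℕ → M} {H H' : ℕ → Comb}
    (hh : IsLTab w h e H) (hh' : IsLTab w h' e H')
    (hc : ((List.range (12 * r)).all fun j => eqv (H j) (H' j)) = true) : h = h' := by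
  refine linearMap_ext hw fun G hG a ha b hb => ?_
  rw [atm_code w r G ha hb, sb, hh _ _ _ hb, hh' _ _ _ hb,
    ev_congr e (List.all_eq_true.1 hc (12 * G + b) (List.mem_range.2 (by omega)))]

omit [IsScalarTower k (Env k A) M] [Module k M] in
lemma isLTab_id (r : ℕ) : IsLTab w (LinearMap.id : Fr k A r →ₗ[k] Fr k A r) (atm k w r)
    (fun j => [(1, 144 * (j / 12) + j % 12)]) := fun x G b hb => by
  rw [← tmul_smul_gen hw r x G hb]; rfl

end exact

section koszul

variable {k : Type} [Field k] {A : Type} [Ring A] [Algebra k A] {w : ℕ → A} (hw : IsFK k w)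

/-- Checking a homotopy identity for table maps. -/
lemma homotopy_check {r₀ r₁ r₂ : ℕ} {d : Fr k A r₂ →ₗ[Env k A] Fr k A r₁}
    {d' : Fr k A r₁ →ₗ[Env k A] Fr k A r₀} {T T' H H' : ℕ → Comb} (hw : IsFK k w)
    (hd : IsTab d (atm k w r₁) T) (hd' : IsTab d' (atm k w r₀) T')
    (hH : ∀ j, 12 * r₁ ≤ j → H j = []) (hH' : ∀ j, 12 * r₀ ≤ j → H' j = [])
    (hc : ((List.range (12 * r₁)).all fun j => eqv
      (appL acF (fun j => app acF T [(1, 144 * (j / 12) + j % 12)]) (H j) ++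
        appL acF H' (app acF T' [(1, 144 * (j / 12) + j % 12)]))
      [(1, 144 * (j / 12) + j % 12)]) = true) (x : Fr k A r₁) (hx : d' x = 0) : ∃ y, d y = x := by
  obtain ⟨h, hh⟩ := exists_isLTab hw (atm k w r₂) hH
  obtain ⟨h', hh'⟩ := exists_isLTab hw (atm k w r₁) hH'
  have := ((hh.comp hw (hd.isLTab hw (isAct_atm hw _)) (isAct_atm hw _)).add
    ((hd'.isLTab hw (isAct_atm hw _)).comp hw hh' (isAct_atm hw _))).ext hw (isLTab_id hw _) hc
  refine ⟨h x, ?_⟩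
  simpa [hx] using LinearMap.congr_fun this x

include hw

lemma dK_exact_one (x : Fr k A (rk 1)) (hx : dK k w 0 x = 0) : ∃ y, dK k w 1 y = x :=
  homotopy_check hw (isTab_dK w 1) (isTab_dK w 0) (fun _ => gD_of_le (t := hTab1)) (fun _ => gD_of_le (t := hTab0))
     (by decide +kernel) x hx

lemma dK_exact_two (x : Fr k A (rk 2)) (hx : dK k w 1 x = 0) : ∃ y, dK k w 2 y = x :=
  homotopy_check hw (isTab_dK w 2) (isTab_dK w 1) (fun _ => gD_of_le (t := hTab2)) (fun _ => gD_of_le (t := hTab1))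
     (by decide +kernel) x hx

lemma dK_exact (n : ℕ) (x : Fr k A (rk (n + 4))) (hx : dK k w (n + 3) x = 0) :
    ∃ y, dK k w (n + 4) y = x := by
  induction n using Nat.twoStepInduction with
  | zero =>
    exact homotopy_check hw (isTab_dK w 4) (isTab_dK w 3) (fun _ => gD_of_le (t := hTab4)) (fun _ => gD_of_le (t := hTab3))
       (by decide +kernel) x hx
  | one =>
    exact homotopy_check hw (isTab_dK w 5) (isTab_dK w 4) (fun _ => gD_of_le (t := hTab5)) (fun _ => gD_of_le (t := hTab4))
       (by decide +kernel) x hx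
  | more n ih _ =>
    have h1 : dK k w (n + 2 + 3) = dK k w (n + 3) := dK_add_two w n
    have h2 : dK k w (n + 2 + 4) = dK k w (n + 4) := dK_add_two w (n + 1)
    rw [h2]
    exact ih x (by rw [← h1]; exact hx)

variable [Module (Env k A) A] [IsScalarTower k (Env k A) A]
  (hA : ∀ x y m : A, (x ⊗ₜ[k] op y : Env k A) • m = x * m * y)
include hA

/-- The left linear section of the augmentation. -/
lemma exists_section : ∃ s : A →ₗ[k] Fr k A 1, ∀ {r : ℕ} {g : Fr k A r →ₗ[k] A} {H : ℕ → Comb},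
    IsLTab w g w H →
      IsLTab w (s ∘ₗ g) (atm k w 1) (fun j => fm (H j) (fun c i r => (c, Nat.mul 12 i) :: r) []) := by
  let s : A →ₗ[k] Fr k A 1 :=
    { toFun := fun x => (x ⊗ₜ[k] (1 : Aᵐᵒᵖ) : Env k A) • gen k A 1 0
      map_add' := fun x y => by rw [TensorProduct.add_tmul, add_smul]
      map_smul' := fun c x => by rw [← TensorProduct.smul_tmul', smul_assoc]; rfl }
  have hs (x : A) : s x = (x ⊗ₜ[k] (1 : Aᵐᵒᵖ) : Env k A) • gen k A 1 0 := rfl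
  refine ⟨s, fun {r g H} hg x G b hb => ?_⟩
  have key (l : Comb) :
      ev (atm k w 1) (fm l (fun c i r => (c, Nat.mul 12 i) :: r) []) = s (ev w l) + 0 := by
    refine ev_fm (φ := s.toAddMonoidHom) w l (fun p _ r => ?_) []
    rw [ev_cons]
    congr 2
    change atm k w 1 (12 * p.2) = s (w p.2)
    rcases lt_or_ge p.2 12 with hp | hp
    · rw [show 12 * p.2 = 144 * 0 + 12 * p.2 + 0 by omega, atm_code w 1 0 hp (by norm_num), hs,
        sb_zero_right hw]
    · rw [hw.zero hp, map_zero, atm, gen_of_le (by omega)]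
      exact smul_zero (M := Env k A) (A := Fr k A 1) _
  rw [LinearMap.comp_apply, hg x G b hb, key, add_zero, hs, hs, smul_smul,
    Algebra.TensorProduct.tmul_mul_tmul, one_mul, ← op_one, hA, mul_one]

lemma eps_exact (x : Fr k A (rk 0)) (hx : eps k w x = 0) : ∃ y, dK k w 0 y = x := by
  obtain ⟨s, hs⟩ := exists_section hw hA
  obtain ⟨h, hh⟩ := exists_isLTab hw (r := rk 0) (atm k w (rk 1)) (fun _ => gD_of_le (t := hTab0))
  have := ((hh.comp hw ((isTab_dK w 0).isLTab hw (isAct_atm hw _)) (isAct_atm hw _)).add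
    (hs ((isTab_eps w).isLTab hw (isAct_self hw hA)))).ext hw (isLTab_id hw _) (by decide +kernel)
  have e : @HAdd.hAdd (Fr k A 1) (Fr k A 1) _ _ (dK k w 0 (h x)) (s (eps k w x)) = x :=
    LinearMap.congr_fun this x
  rw [hx, map_zero] at e
  exact ⟨h x, (add_zero (M := Fr k A 1) (dK k w 0 (h x))).symm.trans e⟩

lemma exists_retraction : ∃ (g : Fr k A (rk 3) →ₗ[k] A) (s : A →ₗ[k] Fr k A (rk 0)),
    (∀ y, g (dK k w 3 y) = 0) ∧ (∀ u, g (fK k w 0 u) = eps k w u) ∧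
    ∀ x, dK k w 2 x = 0 → ∃ y, dK k w 3 y + fK k w 0 (s (g x)) = x := by
  obtain ⟨s, hs⟩ := exists_section hw hA
  obtain ⟨g, hg⟩ := exists_isLTab hw (r := rk 3) w (fun _ => gD_of_le (t := gTab))
  obtain ⟨h, hh⟩ := exists_isLTab hw (r := rk 3) (atm k w (rk 4)) (fun _ => gD_of_le (t := hTab3))
  obtain ⟨h', hh'⟩ := exists_isLTab hw (r := rk 2) (atm k w (rk 3)) (fun _ => gD_of_le (t := hTab2))
  refine ⟨g, s, fun y => ?_, fun u => ?_, fun x hx => ⟨h x, ?_⟩⟩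
  · have h0 : IsLTab w (0 : Fr k A (rk 4) →ₗ[k] A) w (fun _ => []) := fun _ _ _ _ => by simp
    have := (((isTab_dK w 3).isLTab hw (isAct_atm hw _)).comp hw hg (isAct_self hw hA)).ext hw h0
      (by decide +kernel)
    exact LinearMap.congr_fun this y
  · have := (((isTab_fK w 0).isLTab hw (isAct_atm hw _)).comp hw hg (isAct_self hw hA)).ext hw
      ((isTab_eps w).isLTab hw (isAct_self hw hA)) (by decide +kernel)
    exact LinearMap.congr_fun this u
  · have := (((hh.comp hw ((isTab_dK w 3).isLTab hw (isAct_atm hw _)) (isAct_atm hw _)).add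
      (((isTab_dK w 2).isLTab hw (isAct_atm hw _)).comp hw hh' (isAct_atm hw _))).add
      ((hs hg).comp hw ((isTab_fK w 0).isLTab hw (isAct_atm hw _)) (isAct_atm hw _))).ext hw
      (isLTab_id hw _) (by decide +kernel)
    have e : dK k w 3 (h x) + h' (dK k w 2 x) + fK k w 0 (s (g x)) = x := LinearMap.congr_fun this x
    rwa [hx, map_zero, add_zero] at e

end koszul

end FKH

/-! ### The bimodule resolution -/

namespace FKH

/-- The ranks of the resolution. -/
def R : ℕ → ℕ
  | 0 => 1
  | 1 => 3
  | 2 => 5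
  | 3 => 6
  | n + 4 => R n + 6

lemma rk_le (n : ℕ) : rk n ≤ R n := by
  match n with
  | 0 | 1 | 2 | 3 => exact le_rfl
  | n + 4 => exact Nat.le_add_left 6 (R n)

section resolution

variable (k : Type) [Field k] {A : Type} [Ring A] [Algebra k A] (w : ℕ → A)

variable (A) in
/-- The inclusion of the Koszul complex in the resolution. -/
noncomputable def inl (n : ℕ) : Fr k A (rk n) →ₗ[Env k A] Fr k A (R n) :=
  mapOf _ fun G => gen k A _ G

variable (A) in
/-- The projection of the resolution to the graded pieces of the Koszul complex. -/
noncomputable def ka (n : ℕ) : Fr k A (R n) →ₗ[Env k A] Fr k A (rk n) :=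
  mapOf _ fun G => gen k A _ G

variable (A) in
/-- The inclusion of the shifted resolution as graded modules. -/
noncomputable def sh (n : ℕ) : Fr k A (R n) →ₗ[Env k A] Fr k A (R (n + 4)) :=
  mapOf _ fun G => gen k A _ (G + 6)

variable (A) in
/-- The periodicity of the resolution. -/
noncomputable def pr (n : ℕ) : Fr k A (R (n + 4)) →ₗ[Env k A] Fr k A (R n) :=
  mapOf _ fun G => if G < 6 then 0 else gen k A _ (G - 6)

variable {k}

lemma inl_gen {n G : ℕ} (h : G < rk n) : inl k A n (gen k A _ G) = gen k A _ G := mapOf_gen _ h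

lemma ka_gen (n G : ℕ) : ka k A n (gen k A _ G) = gen k A _ G := by
  rcases lt_or_ge G (R n) with h | h
  · exact mapOf_gen _ h
  · rw [gen_of_le h, gen_of_le ((rk_le n).trans h), map_zero]

lemma sh_gen (n G : ℕ) : sh k A n (gen k A _ G) = gen k A _ (G + 6) := by
  rcases lt_or_ge G (R n) with h | h
  · exact mapOf_gen _ h
  · rw [gen_of_le h, map_zero]
    exact (gen_of_le (Nat.add_le_add_right h 6)).symm

lemma pr_gen_of_lt {n G : ℕ} (h : G < 6) : pr k A n (gen k A _ G) = 0 := by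
  rw [pr, mapOf_gen _ (show G < R (n + 4) from h.trans_le (Nat.le_add_left 6 (R n))), if_pos h]

lemma pr_gen_add (n G : ℕ) : pr k A n (gen k A _ (G + 6)) = gen k A _ G := by
  rcases lt_or_ge G (R n) with h | h
  · rw [pr, mapOf_gen _ (show G + 6 < R (n + 4) from Nat.add_lt_add_right h 6), if_neg (by omega), Nat.add_sub_cancel]
  · rw [gen_of_le h, gen_of_le (show R (n + 4) ≤ G + 6 from Nat.add_le_add_right h 6), map_zero]

lemma ka_inl (n : ℕ) : ka k A n ∘ₗ inl k A n = LinearMap.id :=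
  hom_ext fun G hG => by rw [LinearMap.comp_apply, inl_gen hG, ka_gen]; rfl

lemma pr_inl (n : ℕ) : pr k A n ∘ₗ inl k A (n + 4) = 0 :=
  hom_ext fun G hG => by rw [LinearMap.comp_apply, inl_gen hG, pr_gen_of_lt hG]; rfl

lemma ka_sh (n : ℕ) : ka k A (n + 4) ∘ₗ sh k A n = 0 :=
  hom_ext fun G _ => by
    rw [LinearMap.comp_apply, sh_gen, ka_gen, gen_of_le (r := rk (n + 4)) (Nat.le_add_left 6 G)]; rfl

lemma pr_sh (n : ℕ) : pr k A n ∘ₗ sh k A n = LinearMap.id :=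
  hom_ext fun G _ => by rw [LinearMap.comp_apply, sh_gen, pr_gen_add]; rfl

lemma inl_ka_add (n : ℕ) :
    inl k A (n + 4) ∘ₗ ka k A (n + 4) + sh k A n ∘ₗ pr k A n = LinearMap.id :=
  hom_ext fun G hG => by
    rw [LinearMap.add_apply, LinearMap.comp_apply, LinearMap.comp_apply, ka_gen]
    rcases lt_or_ge G 6 with h | h
    · rw [inl_gen (n := n + 4) h, pr_gen_of_lt h, map_zero, add_zero]; rfl
    · obtain ⟨G, rfl⟩ := Nat.exists_eq_add_of_le' h
      rw [gen_of_le (r := rk (n + 4)) h, map_zero, pr_gen_add, sh_gen, zero_add]; rfl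

lemma inl_ka_of_lt {n : ℕ} (hn : n < 4) : inl k A n ∘ₗ ka k A n = LinearMap.id :=
  hom_ext fun G hG => by
    rw [LinearMap.comp_apply, ka_gen, inl_gen]; · rfl
    interval_cases n <;> exact hG

/-- Maps out of the resolution agree if they agree on the Koszul part and the shifted part. -/
lemma res_ext {M : Type*} [AddCommGroup M] [Module (Env k A) M] {n : ℕ}
    {f g : Fr k A (R (n + 4)) →ₗ[Env k A] M}
    (h₁ : f ∘ₗ inl k A (n + 4) = g ∘ₗ inl k A (n + 4)) (h₂ : f ∘ₗ sh k A n = g ∘ₗ sh k A n) :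
    f = g := by
  rw [← LinearMap.comp_id f, ← LinearMap.comp_id g, ← inl_ka_add, LinearMap.comp_add,
    LinearMap.comp_add, ← LinearMap.comp_assoc, ← LinearMap.comp_assoc, h₁, h₂]
  rfl

lemma res_ext_of_lt {M : Type*} [AddCommGroup M] [Module (Env k A) M] {n : ℕ} (hn : n < 4)
    {f g : Fr k A (R n) →ₗ[Env k A] M} (h : f ∘ₗ inl k A n = g ∘ₗ inl k A n) : f = g := by
  rw [← LinearMap.comp_id f, ← LinearMap.comp_id g, ← inl_ka_of_lt hn, ← LinearMap.comp_assoc, h]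
  rfl

variable (k) in
/-- The differential of the resolution. -/
noncomputable def dl : ∀ n : ℕ, Fr k A (R (n + 1)) →ₗ[Env k A] Fr k A (R n)
  | 0 => inl k A 0 ∘ₗ dK k w 0 ∘ₗ ka k A 1
  | 1 => inl k A 1 ∘ₗ dK k w 1 ∘ₗ ka k A 2
  | 2 => inl k A 2 ∘ₗ dK k w 2 ∘ₗ ka k A 3
  | 3 => inl k A 3 ∘ₗ (dK k w 3 ∘ₗ ka k A 4 + fK k w 0 ∘ₗ ka k A 0 ∘ₗ pr k A 0)
  | n + 4 => inl k A (n + 4) ∘ₗ (dK k w (n + 4) ∘ₗ ka k A (n + 5) +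
      fK k w (n + 1) ∘ₗ ka k A (n + 1) ∘ₗ pr k A (n + 1)) + sh k A n ∘ₗ dl n ∘ₗ pr k A (n + 1)

variable (k) in
/-- The lift of the central element of degree two. -/
noncomputable def yK : ∀ n : ℕ, Fr k A (R (n + 2)) →ₗ[Env k A] Fr k A (R n)
  | 0 => inl k A 0 ∘ₗ thK k w 0 ∘ₗ ka k A 2
  | 1 => inl k A 1 ∘ₗ thK k w 1 ∘ₗ ka k A 3
  | 2 => inl k A 2 ∘ₗ thK k w 2 ∘ₗ ka k A 4
  | 3 => inl k A 3 ∘ₗ thK k w 3 ∘ₗ ka k A 5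
  | n + 4 => inl k A (n + 4) ∘ₗ thK k w (n + 4) ∘ₗ ka k A (n + 6) +
      sh k A n ∘ₗ yK n ∘ₗ pr k A (n + 2)

lemma ka_inl_apply (n : ℕ) (x : Fr k A (rk n)) : ka k A n (inl k A n x) = x :=
  LinearMap.congr_fun (ka_inl n) x

lemma pr_inl_apply (n : ℕ) (x : Fr k A (rk (n + 4))) : pr k A n (inl k A (n + 4) x) = 0 :=
  LinearMap.congr_fun (pr_inl n) x

lemma ka_sh_apply (n : ℕ) (x : Fr k A (R n)) : ka k A (n + 4) (sh k A n x) = 0 :=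
  LinearMap.congr_fun (ka_sh n) x

lemma pr_sh_apply (n : ℕ) (x : Fr k A (R n)) : pr k A n (sh k A n x) = x :=
  LinearMap.congr_fun (pr_sh n) x

lemma inl_ka_add_apply (n : ℕ) (x : Fr k A (R (n + 4))) :
    inl k A (n + 4) (ka k A (n + 4) x) + sh k A n (pr k A n x) = x :=
  LinearMap.congr_fun (inl_ka_add n) x

lemma inl_ka_apply {n : ℕ} (hn : n < 4) (x : Fr k A (R n)) : inl k A n (ka k A n x) = x :=
  LinearMap.congr_fun (inl_ka_of_lt hn) x

/-- The differential restricts to the Koszul complex. -/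
lemma dl_inl (n : ℕ) (x : Fr k A (rk (n + 1))) :
    dl k w n (inl k A (n + 1) x) = inl k A n (dK k w n x) := by
  match n with
  | 0 => exact congrArg (fun y => inl k A 0 (dK k w 0 y)) (ka_inl_apply 1 x)
  | 1 => exact congrArg (fun y => inl k A 1 (dK k w 1 y)) (ka_inl_apply 2 x)
  | 2 => exact congrArg (fun y => inl k A 2 (dK k w 2 y)) (ka_inl_apply 3 x)
  | 3 =>
    change inl k A 3 (dK k w 3 (ka k A 4 (inl k A 4 x)) +
      fK k w 0 (ka k A 0 (pr k A 0 (inl k A (0 + 4) x)))) = _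
    rw [ka_inl_apply, pr_inl_apply, map_zero, map_zero, add_zero]
  | n + 4 =>
    change inl k A (n + 4) (dK k w (n + 4) (ka k A (n + 5) (inl k A (n + 5) x)) +
      fK k w (n + 1) (ka k A (n + 1) (pr k A (n + 1) (inl k A (n + 1 + 4) x)))) +
      sh k A n (dl k w n (pr k A (n + 1) (inl k A (n + 1 + 4) x))) = _
    rw [ka_inl_apply, pr_inl_apply]
    simp only [map_zero, add_zero]

lemma dl_sh_zero (x : Fr k A (R 0)) :
    dl k w 3 (sh k A 0 x) = inl k A 3 (fK k w 0 (ka k A 0 x)) := by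
  change inl k A 3 (dK k w 3 (ka k A (0 + 4) (sh k A 0 x)) +
      fK k w 0 (ka k A 0 (pr k A 0 (sh k A 0 x)))) = _
  rw [ka_sh_apply, pr_sh_apply, map_zero, zero_add]

lemma dl_sh (n : ℕ) (x : Fr k A (R (n + 1))) : dl k w (n + 4) (sh k A (n + 1) x) =
    inl k A (n + 4) (fK k w (n + 1) (ka k A (n + 1) x)) + sh k A n (dl k w n x) := by
  change inl k A (n + 4) (dK k w (n + 4) (ka k A (n + 1 + 4) (sh k A (n + 1) x)) +
      fK k w (n + 1) (ka k A (n + 1) (pr k A (n + 1) (sh k A (n + 1) x)))) +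
      sh k A n (dl k w n (pr k A (n + 1) (sh k A (n + 1) x))) = _
  rw [ka_sh_apply, pr_sh_apply, map_zero, zero_add]

lemma yK_inl (n : ℕ) (x : Fr k A (rk (n + 2))) :
    yK k w n (inl k A (n + 2) x) = inl k A n (thK k w n x) := by
  match n with
  | 0 => exact congrArg (fun y => inl k A 0 (thK k w 0 y)) (ka_inl_apply 2 x)
  | 1 => exact congrArg (fun y => inl k A 1 (thK k w 1 y)) (ka_inl_apply 3 x)
  | 2 => exact congrArg (fun y => inl k A 2 (thK k w 2 y)) (ka_inl_apply 4 x)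
  | 3 => exact congrArg (fun y => inl k A 3 (thK k w 3 y)) (ka_inl_apply 5 x)
  | n + 4 =>
    change inl k A (n + 4) (thK k w (n + 4) (ka k A (n + 6) (inl k A (n + 6) x))) +
      sh k A n (yK k w n (pr k A (n + 2) (inl k A (n + 2 + 4) x))) = _
    rw [ka_inl_apply, pr_inl_apply]
    simp only [map_zero, add_zero]

lemma yK_sh_zero (x : Fr k A (R 0)) : yK k w 2 (sh k A 0 x) = 0 := by
  change inl k A 2 (thK k w 2 (ka k A (0 + 4) (sh k A 0 x))) = _
  rw [ka_sh_apply, map_zero, map_zero]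

lemma yK_sh_one (x : Fr k A (R 1)) : yK k w 3 (sh k A 1 x) = 0 := by
  change inl k A 3 (thK k w 3 (ka k A (1 + 4) (sh k A 1 x))) = _
  rw [ka_sh_apply, map_zero, map_zero]

lemma yK_sh (n : ℕ) (x : Fr k A (R (n + 2))) :
    yK k w (n + 4) (sh k A (n + 2) x) = sh k A n (yK k w n x) := by
  change inl k A (n + 4) (thK k w (n + 4) (ka k A (n + 2 + 4) (sh k A (n + 2) x))) +
      sh k A n (yK k w n (pr k A (n + 2) (sh k A (n + 2) x))) = _
  rw [ka_sh_apply, pr_sh_apply, map_zero, map_zero, zero_add]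

/-- The periodicity is a map of complexes. -/
lemma pr_dl (n : ℕ) (x : Fr k A (R (n + 5))) :
    pr k A n (dl k w (n + 4) x) = dl k w n (pr k A (n + 1) x) := by
  conv_lhs => rw [← inl_ka_add_apply (n + 1) x]
  rw [map_add, dl_inl w (n + 4), dl_sh, map_add, pr_inl_apply, map_add, pr_inl_apply, pr_sh_apply,
    zero_add, zero_add]

/-- The Koszul part of the differential of the resolution. -/
lemma ka_dl (n : ℕ) (x : Fr k A (R n)) : ka k A (n + 3) (dl k w (n + 3) (sh k A n x)) =
    fK k w n (ka k A n x) := by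
  cases n with
  | zero => rw [dl_sh_zero, ka_inl_apply]
  | succ n => rw [dl_sh, map_add, ka_inl_apply, ka_sh_apply, add_zero]

variable {w} (hw : IsFK k w)
include hw

lemma thK_fK_zero : thK k w 1 ∘ₗ fK k w 0 = 0 := by
  refine ((isTab_fK w 0).comp (isTab_thK w 1) (isAct_atm hw _)).ext .zero ?_
  decide +kernel

lemma thK_fK_one : thK k w 2 ∘ₗ fK k w 1 = 0 := by
  refine ((isTab_fK w 1).comp (isTab_thK w 2) (isAct_atm hw _)).ext .zero ?_
  decide +kernel

lemma dl_dl_inl (n : ℕ) (x : Fr k A (rk (n + 2))) : dl k w n (dl k w (n + 1) (inl k A (n + 2) x)) = 0 := by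
  rw [dl_inl w (n + 1), dl_inl]
  exact (congrArg (inl k A n) (LinearMap.congr_fun (dK_dK hw n) x)).trans (map_zero _)

lemma dl_dl (n : ℕ) : dl k w n ∘ₗ dl k w (n + 1) = 0 := by
  induction n using Nat.strong_induction_on with
  | _ n ih =>
  match n with
  | 0 => exact res_ext_of_lt (n := 2) (by norm_num) (LinearMap.ext fun x => dl_dl_inl hw 0 x)
  | 1 => exact res_ext_of_lt (n := 3) (by norm_num) (LinearMap.ext fun x => dl_dl_inl hw 1 x)
  | 2 =>
    refine res_ext (n := 0) (LinearMap.ext fun x => dl_dl_inl hw 2 x) (LinearMap.ext fun x => ?_)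
    change dl k w 2 (dl k w 3 (sh k A 0 x)) = 0
    rw [dl_sh_zero, dl_inl w 2]
    exact (congrArg (inl k A 2) (LinearMap.congr_fun (dK_fK_zero hw) _)).trans (map_zero _)
  | 3 =>
    refine res_ext (n := 1) (LinearMap.ext fun x => dl_dl_inl hw 3 x) (LinearMap.ext fun x => ?_)
    change dl k w 3 (dl k w 4 (sh k A 1 x)) = 0
    rw [dl_sh, map_add, dl_inl w 3, dl_sh_zero, ← map_add]
    have := LinearMap.congr_fun (dK_fK hw 0) (ka k A 1 x)
    have h : ka k A 0 (dl k w 0 x) = dK k w 0 (ka k A 1 x) := ka_inl_apply 0 _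
    rw [h]
    exact (congrArg (inl k A 3) this).trans (map_zero _)
  | n + 4 =>
    refine res_ext (n := n + 2) (LinearMap.ext fun x => dl_dl_inl hw _ x)
      (LinearMap.ext fun x => ?_)
    change dl k w (n + 4) (dl k w (n + 1 + 4) (sh k A (n + 1 + 1) x)) = 0
    rw [dl_sh, map_add, dl_inl w (n + 4), dl_sh]
    have h1 : dl k w n (dl k w (n + 1) x) = 0 := LinearMap.congr_fun (ih n (by omega)) x
    rw [h1, map_zero, add_zero, ← map_add]
    refine (congrArg (inl k A (n + 4)) ?_).trans (map_zero _)
    have h2 := LinearMap.congr_fun (dK_fK hw (n + 1)) (ka k A (n + 2) x)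
    have h3 : fK k w (n + 1) (ka k A (n + 1) (dl k w (n + 1) x)) =
        fK k w (n + 1) (dK k w (n + 1) (ka k A (n + 2) x)) := by
      rcases lt_or_ge (n + 2) 4 with hn | hn
      · conv_lhs => rw [← inl_ka_apply hn x]
        rw [dl_inl, ka_inl_apply]
      · obtain ⟨m, rfl⟩ : ∃ m, n = m + 2 := ⟨n - 2, by omega⟩
        conv_lhs => rw [← inl_ka_add_apply m x]
        rw [map_add, map_add, dl_inl w (m + 3), ka_inl_apply, ka_dl, map_add]
        have : fK k w (m + 3) (fK k w m (ka k A m (pr k A m x))) = 0 :=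
          LinearMap.congr_fun (fK_fK hw m) (ka k A m (pr k A m x))
        rw [this, add_zero]
    rw [h3]
    exact h2

lemma yK_dl_inl (n : ℕ) (x : Fr k A (rk (n + 3))) :
    yK k w n (dl k w (n + 2) (inl k A (n + 3) x)) = dl k w n (yK k w (n + 1) (inl k A (n + 3) x)) := by
  rw [dl_inl w (n + 2), yK_inl w n, yK_inl w (n + 1), dl_inl]
  exact (congrArg (inl k A n) (LinearMap.congr_fun (dK_thK hw n) x)).symm

lemma yK_dl (n : ℕ) : yK k w n ∘ₗ dl k w (n + 2) = dl k w n ∘ₗ yK k w (n + 1) := by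
  induction n using Nat.strong_induction_on with
  | _ n ih =>
  match n with
  | 0 => exact res_ext_of_lt (n := 3) (by norm_num) (LinearMap.ext fun x => yK_dl_inl hw 0 x)
  | 1 =>
    refine res_ext (n := 0) (LinearMap.ext fun x => yK_dl_inl hw 1 x) (LinearMap.ext fun x => ?_)
    change yK k w 1 (dl k w 3 (sh k A 0 x)) = dl k w 1 (yK k w 2 (sh k A 0 x))
    rw [dl_sh_zero, yK_sh_zero, yK_inl w 1, map_zero]
    exact (congrArg (inl k A 1) (LinearMap.congr_fun (thK_fK_zero hw) _)).trans (map_zero _)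
  | 2 =>
    refine res_ext (n := 1) (LinearMap.ext fun x => yK_dl_inl hw 2 x) (LinearMap.ext fun x => ?_)
    change yK k w 2 (dl k w 4 (sh k A 1 x)) = dl k w 2 (yK k w 3 (sh k A 1 x))
    rw [dl_sh, yK_sh_one, map_add, yK_inl w 2, yK_sh_zero, map_zero, add_zero]
    exact (congrArg (inl k A 2) (LinearMap.congr_fun (thK_fK_one hw) _)).trans (map_zero _)
  | 3 =>
    refine res_ext (n := 2) (LinearMap.ext fun x => yK_dl_inl hw 3 x) (LinearMap.ext fun x => ?_)
    change yK k w 3 (dl k w (1 + 4) (sh k A (1 + 1) x)) = dl k w 3 (yK k w (0 + 4) (sh k A (0 + 2) x))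
    rw [dl_sh, yK_sh, map_add, yK_inl w 3, yK_sh_one, add_zero, dl_sh_zero]
    have h : ka k A 0 (yK k w 0 x) = thK k w 0 (ka k A 2 x) := ka_inl_apply 0 _
    rw [h]
    exact (congrArg (inl k A 3) (LinearMap.congr_fun (fK_thK hw 0) _)).symm
  | n + 4 =>
    refine res_ext (n := n + 3) (LinearMap.ext fun x => yK_dl_inl hw _ x)
      (LinearMap.ext fun x => ?_)
    change yK k w (n + 4) (dl k w (n + 2 + 4) (sh k A (n + 2 + 1) x)) =
      dl k w (n + 4) (yK k w (n + 1 + 4) (sh k A (n + 1 + 2) x))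
    rw [dl_sh, yK_sh, map_add, yK_inl w (n + 4), yK_sh, dl_sh]
    have h1 : yK k w n (dl k w (n + 2) x) = dl k w n (yK k w (n + 1) x) :=
      LinearMap.congr_fun (ih n (by omega)) x
    rw [h1]
    congr 2
    have h2 : ka k A (n + 1) (yK k w (n + 1) x) = thK k w (n + 1) (ka k A (n + 3) x) := by
      rcases lt_or_ge (n + 3) 4 with hn | hn
      · conv_lhs => rw [← inl_ka_apply hn x]
        rw [yK_inl w (n + 1), ka_inl_apply]
      · obtain ⟨m, rfl⟩ : ∃ m, n = m + 1 := ⟨n - 1, by omega⟩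
        conv_lhs => rw [← inl_ka_add_apply m x]
        rw [map_add, map_add, yK_inl w (m + 2), ka_inl_apply]
        have : ka k A (m + 2) (yK k w (m + 2) (sh k A m (pr k A m x))) = 0 := by
          match m with
          | 0 => rw [yK_sh_zero, map_zero]
          | 1 => rw [yK_sh_one, map_zero]
          | m + 2 => rw [yK_sh, ka_sh_apply]
        rw [this, add_zero]
    rw [h2]
    exact (LinearMap.congr_fun (fK_thK hw (n + 1)) (ka k A (n + 3) x)).symm

variable [Module (Env k A) A] [IsScalarTower k (Env k A) A]
  (hA : ∀ x y m : A, (x ⊗ₜ[k] MulOpposite.op y : Env k A) • m = x * m * y)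
include hA

lemma dl_exact_zero (x : Fr k A (R 0)) (hx : eps k w x = 0) : ∃ y, dl k w 0 y = x := by
  obtain ⟨y, hy⟩ := eps_exact hw hA x hx
  refine ⟨inl k A 1 y, ?_⟩
  rw [dl_inl w 0, hy]
  refine (congrArg (inl k A 0) (show x = ka k A 0 x from ?_)).trans (inl_ka_apply (by norm_num) x)
  exact (LinearMap.congr_fun (show LinearMap.id = ka k A 0 from
    hom_ext fun G hG => (ka_gen 0 G).symm) x)

lemma dl_exact (n : ℕ) (x : Fr k A (R (n + 1))) (hx : dl k w n x = 0) :
    ∃ y, dl k w (n + 1) y = x := by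
  have key (n : ℕ) (x : Fr k A (rk (n + 1))) (hx : dl k w n (inl k A (n + 1) x) = 0) :
      dK k w n x = 0 := by
    rw [dl_inl w n] at hx
    rw [← ka_inl_apply n (dK k w n x), hx, map_zero]
  obtain ⟨g, s, hg1, hg2, hg3⟩ := exists_retraction hw hA
  induction n using Nat.strong_induction_on with
  | _ n ih =>
  match n with
  | 0 =>
    rw [← inl_ka_apply (n := 1) (by norm_num) x] at hx ⊢
    obtain ⟨y, hy⟩ := dK_exact_one hw _ (key 0 _ hx)
    exact ⟨inl k A 2 y, by rw [dl_inl w 1, hy]⟩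
  | 1 =>
    rw [← inl_ka_apply (n := 2) (by norm_num) x] at hx ⊢
    obtain ⟨y, hy⟩ := dK_exact_two hw _ (key 1 _ hx)
    exact ⟨inl k A 3 y, by rw [dl_inl w 2, hy]⟩
  | 2 =>
    rw [← inl_ka_apply (n := 3) (by norm_num) x] at hx ⊢
    obtain ⟨y, hy⟩ := hg3 _ (key 2 _ hx)
    refine ⟨inl k A 4 y + sh k A 0 (inl k A 0 (s (g (ka k A 3 x)))), ?_⟩
    rw [map_add, dl_inl w 3, dl_sh_zero, ka_inl_apply, ← map_add, hy]
  | 3 =>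
    have hx' : inl k A 3 (dK k w 3 (ka k A 4 x) + fK k w 0 (ka k A 0 (pr k A 0 x))) = 0 := hx
    have h0 : dK k w 3 (ka k A 4 x) + fK k w 0 (ka k A 0 (pr k A 0 x)) = 0 := by
      rw [← ka_inl_apply 3 (dK k w 3 (ka k A 4 x) + _), hx', map_zero]
    have h1 := congrArg g h0
    rw [map_add, hg1, hg2, map_zero, zero_add] at h1
    obtain ⟨v, hv⟩ := dl_exact_zero hw hA (inl k A 0 (ka k A 0 (pr k A 0 x))) (by
      rw [← h1]
      exact congrArg (eps k w) (LinearMap.congr_fun (show inl k A 0 = LinearMap.id from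
        hom_ext fun G hG => inl_gen hG) _))
    rw [inl_ka_apply (by norm_num)] at hv
    have hb : dl k w 3 (x - dl k w 4 (sh k A 1 v)) = 0 := by
      rw [map_sub, hx, zero_sub, neg_eq_zero]
      exact LinearMap.congr_fun (dl_dl hw 3) _
    have hc : inl k A 4 (ka k A 4 x - fK k w 1 (ka k A 1 v)) = x - dl k w 4 (sh k A 1 v) := by
      rw [dl_sh, hv, map_sub]
      rw [sub_add_eq_sub_sub, sub_right_comm, ← eq_sub_of_add_eq (inl_ka_add_apply 0 x)]
    rw [← hc] at hb
    obtain ⟨b, hb⟩ := dK_exact hw 0 _ (key 3 _ hb)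
    refine ⟨sh k A 1 v + inl k A 5 b, ?_⟩
    rw [map_add, dl_inl w 4, hb, hc, add_sub_cancel]
  | n + 4 =>
    obtain ⟨v, hv⟩ := ih n (by omega) (pr k A (n + 1) x) (by rw [← pr_dl, hx, map_zero])
    have hb : dl k w (n + 4) (x - dl k w (n + 5) (sh k A (n + 2) v)) = 0 := by
      rw [map_sub, hx, zero_sub, neg_eq_zero]
      exact LinearMap.congr_fun (dl_dl hw (n + 4)) _
    have hc : inl k A (n + 5) (ka k A (n + 5) x - fK k w (n + 2) (ka k A (n + 2) v)) =
        x - dl k w (n + 5) (sh k A (n + 2) v) := by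
      rw [dl_sh w (n + 1), hv, map_sub]
      rw [sub_add_eq_sub_sub, sub_right_comm, ← eq_sub_of_add_eq (inl_ka_add_apply (n + 1) x)]
    rw [← hc] at hb
    obtain ⟨b, hb⟩ := dK_exact hw (n + 1) _ (key (n + 4) _ hb)
    refine ⟨sh k A (n + 2) v + inl k A (n + 6) b, ?_⟩
    rw [map_add, dl_inl w (n + 5), hb, hc, add_sub_cancel]

lemma eps_dl : eps k w ∘ₗ dl k w 0 = 0 := by
  refine res_ext_of_lt (n := 1) (by norm_num) (LinearMap.ext fun x => ?_)
  change eps k w (dl k w 0 (inl k A 1 x)) = 0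
  rw [dl_inl w 0]
  have h : eps k w ∘ₗ inl k A 0 ∘ₗ dK k w 0 = 0 := by
    have h0 : inl k A 0 = LinearMap.id := hom_ext fun G hG => inl_gen hG
    rw [h0]
    exact ((isTab_dK w 0).comp (isTab_eps w) (isAct_self hw hA)).ext .zero (by decide +kernel)
  exact LinearMap.congr_fun h x

end resolution

section Resolution

variable {E : Type} [Ring E] {M : Type} [AddCommGroup M] [Module E M] {P : ℕ → Type}
  [∀ n, AddCommGroup (P n)] [∀ n, Module E (P n)]

/-- The augmented complex `(P, δ) → M` is exact. -/
structure IsRes (δ : ∀ n, P (n + 1) →ₗ[E] P n) (ε : P 0 →ₗ[E] M) : Prop where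
  surj : Function.Surjective ε
  comp_zero : ∀ x, ε (δ 0 x) = 0
  comp : ∀ n x, δ n (δ (n + 1) x) = 0
  exact_zero : ∀ x, ε x = 0 → ∃ y, δ 0 y = x
  exact : ∀ n x, δ n x = 0 → ∃ y, δ (n + 1) y = x

/-- The syzygies of the resolution. -/
noncomputable def Zy (M : Type) [AddCommGroup M] [Module E M] (δ : ∀ n, P (n + 1) →ₗ[E] P n) :
    ℕ → ModuleCat.{0} E
  | 0 => ModuleCat.of E M
  | n + 1 => ModuleCat.of E (LinearMap.range (δ n))

variable (δ : ∀ n, P (n + 1) →ₗ[E] P n) (ε : P 0 →ₗ[E] M)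

/-- The projection of `P n` onto the `n`-th syzygy. -/
noncomputable def Zp : ∀ n, ModuleCat.of E (P n) ⟶ Zy M δ n
  | 0 => ModuleCat.ofHom ε
  | n + 1 => ModuleCat.ofHom (δ n).rangeRestrict

/-- The inclusion of the `n + 1`-st syzygy in `P n`. -/
noncomputable def Zi (M : Type) [AddCommGroup M] [Module E M] (δ : ∀ n, P (n + 1) →ₗ[E] P n)
    (n : ℕ) : Zy M δ (n + 1) ⟶ ModuleCat.of E (P n) :=
  ModuleCat.ofHom (LinearMap.range (δ n)).subtype

variable {δ ε} (h : IsRes δ ε)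
include h

theorem Zi_Zp (n : ℕ) : Zi M δ n ≫ Zp δ ε n = 0 := by
  ext ⟨_, x, rfl⟩
  cases n with
  | zero => exact h.comp_zero x
  | succ n => exact Subtype.ext (h.comp n x)

/-- The short exact sequence `0 → Z (n + 1) → P n → Z n → 0`. -/
noncomputable def Zs (n : ℕ) : ShortComplex (ModuleCat.{0} E) :=
  ShortComplex.mk (Zi M δ n) (Zp δ ε n) (Zi_Zp h n)

theorem Zp_surj (n : ℕ) : Function.Surjective (Zp δ ε n) := by
  cases n with
  | zero => exact h.surj
  | succ n => exact LinearMap.surjective_rangeRestrict _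

theorem Zs_shortExact (n : ℕ) : (Zs h n).ShortExact where
  exact := by
    rw [ShortComplex.moduleCat_exact_iff]
    intro x hx
    cases n with
    | zero => obtain ⟨y, hy⟩ := h.exact_zero x hx
              exact ⟨⟨_, y, rfl⟩, hy⟩
    | succ n => obtain ⟨y, hy⟩ := h.exact n x (congrArg Subtype.val hx)
                exact ⟨⟨_, y, rfl⟩, hy⟩
  mono_f := (ModuleCat.mono_iff_injective _).2 Subtype.val_injective
  epi_g := (ModuleCat.epi_iff_surjective _).2 (Zp_surj h n)

variable [HasExt.{1} (ModuleCat.{0} E)]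

/-- The connecting class in `Ext¹(Z n, Z (n + 1))`. -/
noncomputable def Ze (n : ℕ) : Ext (Zy M δ n) (Zy M δ (n + 1)) 1 := (Zs_shortExact h n).extClass

theorem Ze_Zi (n : ℕ) : (Ze h n).comp (Ext.mk₀ (Zi M δ n)) (add_zero 1) = 0 :=
  (Zs_shortExact h n).extClass_comp

theorem exists_of_Ze_comp {n i : ℕ} {Y : ModuleCat.{0} E} (x : Ext (Zy M δ (n + 1)) Y i)
    (hx : (Ze h n).comp x (add_comm 1 i) = 0) :
    ∃ y : Ext (ModuleCat.of E (P n)) Y i, (Ext.mk₀ (Zi M δ n)).comp y (zero_add i) = x :=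
  Ext.contravariant_sequence_exact₁ (Zs_shortExact h n) Y x (add_comm 1 i) hx

theorem exists_Ze_comp [∀ n, Module.Projective E (P n)] {n i : ℕ} {Y : ModuleCat.{0} E}
    (x : Ext (Zy M δ n) Y (i + 1)) :
    ∃ y : Ext (Zy M δ (n + 1)) Y i, (Ze h n).comp y (add_comm 1 i) = x := by
  have : Projective (ModuleCat.of E (P n)) :=
    (IsProjective.iff_projective (P n)).1 inferInstance
  have : Projective (Zs h n).X₂ := this
  exact Ext.contravariant_sequence_exact₃ (Zs_shortExact h n) Y x (Ext.eq_zero_of_projective _)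
    (add_comm 1 i)

/-- The iterated connecting class in `Extⁿ(M, Z n)`. -/
noncomputable def En : ∀ n, Ext (ModuleCat.of E M) (Zy M δ n) n
  | 0 => Ext.mk₀ (𝟙 _)
  | n + 1 => (En n).comp (Ze h n) rfl

/-- The cochain `c` represents the class `e`. -/
def Rep (n : ℕ) (c : P n →ₗ[E] M) (e : Ext (ModuleCat.of E M) (ModuleCat.of E M) n) : Prop :=
  ∃ f : Zy M δ n ⟶ ModuleCat.of E M,
    Zp δ ε n ≫ f = ModuleCat.ofHom c ∧ e = (En h n).comp (Ext.mk₀ f) (add_zero n)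

variable {n : ℕ} {c c' : P n →ₗ[E] M} {e e' : Ext (ModuleCat.of E M) (ModuleCat.of E M) n}

omit [HasExt.{1} (ModuleCat.{0} E)] in
theorem Zp_cancel {X : ModuleCat.{0} E} {f g : Zy M δ n ⟶ X} (hf : Zp δ ε n ≫ f = Zp δ ε n ≫ g) : f = g :=
  haveI := (Zs_shortExact h n).epi_g
  (cancel_epi (Zs h n).g).1 hf

theorem Rep.unique (h1 : Rep h n c e) (h2 : Rep h n c e') : e = e' := by
  obtain ⟨f, hf, rfl⟩ := h1
  obtain ⟨g, hg, rfl⟩ := h2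
  rw [Zp_cancel h (hf.trans hg.symm)]

theorem Rep.add (h1 : Rep h n c e) (h2 : Rep h n c' e') : Rep h n (c + c') (e + e') := by
  obtain ⟨f, hf, rfl⟩ := h1
  obtain ⟨g, hg, rfl⟩ := h2
  exact ⟨f + g, by rw [Preadditive.comp_add, hf, hg]; rfl, by rw [Ext.mk₀_add, Ext.comp_add]⟩

theorem Rep.neg (h1 : Rep h n c e) : Rep h n (-c) (-e) := by
  obtain ⟨f, hf, rfl⟩ := h1
  exact ⟨-f, by rw [Preadditive.comp_neg, hf]; rfl, by rw [Ext.mk₀_neg, Ext.comp_neg]⟩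

theorem Rep.zero (n : ℕ) : Rep h n 0 0 := by
  exact ⟨0, by rw [Limits.comp_zero]; rfl, by rw [Ext.mk₀_zero, Ext.comp_zero]⟩

theorem Rep.exists_class (hc : c ∘ₗ δ n = 0) : ∃ e, Rep h n c e := by
  have := (Zs_shortExact h n).epi_g
  have hz : (Zs h n).f ≫ ModuleCat.ofHom c = 0 := by
    ext ⟨_, x, rfl⟩
    exact LinearMap.congr_fun hc x
  obtain ⟨f, hf⟩ := (Zs_shortExact h n).exact.desc' (ModuleCat.ofHom c) hz
  exact ⟨_, f, hf, rfl⟩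

theorem Rep.cocycle (hc : Rep h n c e) : c ∘ₗ δ n = 0 := by
  obtain ⟨f, hf, rfl⟩ := hc
  ext x
  have := congrArg (fun g => g (δ n x)) hf
  refine this.symm.trans ?_
  have h0 : Zp δ ε n (δ n x) = 0 := congrArg (fun g => g ⟨_, x, rfl⟩) (Zi_Zp h n)
  show f (Zp δ ε n (δ n x)) = 0
  rw [h0, map_zero]

theorem Rep.coboundary {b : P n →ₗ[E] M} {e} (hc : Rep h (n + 1) (b ∘ₗ δ n) e) : e = 0 := by
  refine hc.unique h ⟨Zi M δ n ≫ ModuleCat.ofHom b, rfl, ?_⟩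
  rw [← Ext.mk₀_comp_mk₀, ← Ext.comp_assoc _ _ _ (add_zero _) (add_zero _) (by lia)]
  have : (En h (n+1)).comp (Ext.mk₀ (Zi M δ n)) (add_zero _) = 0 := by
    rw [En, Ext.comp_assoc _ _ _ rfl (add_zero _) (by lia), Ze_Zi, Ext.comp_zero]
  rw [this, Ext.zero_comp]

theorem exists_En_comp [∀ n, Module.Projective E (P n)] {n : ℕ} {Y : ModuleCat.{0} E}
    (e : Ext (ModuleCat.of E M) Y n) : ∀ j i (hji : j + i = n),
    ∃ x : Ext (Zy M δ j) Y i, (En h j).comp x hji = e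
  | 0, i, hji => by
    obtain rfl : i = n := by lia
    exact ⟨e, Ext.mk₀_id_comp e⟩
  | j + 1, i, hji => by
    obtain ⟨x, rfl⟩ := exists_En_comp e j (i + 1) (by lia)
    obtain ⟨y, rfl⟩ := exists_Ze_comp h x
    exact ⟨y, Ext.comp_assoc _ _ _ _ _ (by lia)⟩

theorem Rep.exists_cochain [∀ n, Module.Projective E (P n)]
    (e : Ext (ModuleCat.of E M) (ModuleCat.of E M) n) : ∃ c, Rep h n c e := by
  obtain ⟨x, rfl⟩ := exists_En_comp h e n 0 rfl
  obtain ⟨f, rfl⟩ := (Ext.mk₀_bijective _ _).2 x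
  exact ⟨(Zp δ ε n ≫ f).hom, f, rfl, rfl⟩

theorem eq_zero_of_En_comp [∀ n, Module.Projective E (P n)] {Y : ModuleCat.{0} E} : ∀ (j i m : ℕ)
    (x : Ext (Zy M δ j) Y (i + 1)) (hm : j + (i + 1) = m) (_ : (En h j).comp x hm = 0), x = 0
  | 0, i, m, x, hm, hx => by
    obtain rfl : i + 1 = m := by lia
    exact (Ext.mk₀_id_comp x).symm.trans hx
  | j + 1, i, m, x, hm, hx => by
    have hx' : (En h j).comp ((Ze h j).comp x (add_comm 1 (i + 1)))
        (show j + (i + 1 + 1) = m by lia) = 0 := by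
      rw [← Ext.comp_assoc _ _ _ rfl _ (by lia)]
      exact hx
    obtain ⟨y, rfl⟩ := exists_of_Ze_comp h x (eq_zero_of_En_comp j (i + 1) m _ _ hx')
    have : Projective (ModuleCat.of E (P j)) :=
      (IsProjective.iff_projective (P j)).1 inferInstance
    rw [Ext.eq_zero_of_projective y, Ext.comp_zero]

theorem Rep.exists_coboundary [∀ n, Module.Projective E (P n)] {c : P (n + 1) →ₗ[E] M}
    (hc : Rep h (n + 1) c 0) : ∃ b, c = b ∘ₗ δ n := by
  obtain ⟨f, hf, he⟩ := hc
  rw [En, Ext.comp_assoc _ _ _ rfl (add_zero _) (by lia)] at he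
  obtain ⟨y, hy⟩ := exists_of_Ze_comp h _ (eq_zero_of_En_comp h n 0 _ _ _ he.symm)
  obtain ⟨b, rfl⟩ := (Ext.mk₀_bijective _ _).2 y
  rw [Ext.mk₀_comp_mk₀] at hy
  obtain rfl := (Ext.mk₀_bijective _ _).1 hy
  exact ⟨b.hom, ModuleCat.hom_ext_iff.1 hf.symm⟩

theorem Rep.eq_zero {c : P 0 →ₗ[E] M} (hc : Rep h 0 c 0) : c = 0 := by
  obtain ⟨f, hf, he⟩ := hc
  have he' : Ext.mk₀ f = Ext.mk₀ 0 :=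
    ((Ext.mk₀_id_comp _).symm.trans he.symm).trans (Ext.mk₀_zero _ _).symm
  obtain rfl := (Ext.mk₀_bijective _ _).1 he'
  exact ModuleCat.hom_ext_iff.1 (hf.symm.trans Limits.comp_zero)

theorem Rep.one : Rep h 0 ε (Ext.mk₀ (𝟙 (ModuleCat.of E M))) :=
  ⟨𝟙 _, Category.comp_id _, (Ext.mk₀_id_comp _).symm⟩

theorem Rep.comp {a b : ℕ} {c : P a →ₗ[E] M} {c' : P b →ₗ[E] M}
    {e : Ext (ModuleCat.of E M) (ModuleCat.of E M) a}
    {e' : Ext (ModuleCat.of E M) (ModuleCat.of E M) b} (h1 : Rep h a c e) (h2 : Rep h b c' e')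
    (ψ : ∀ j, P (a + j) →ₗ[E] P j) (h0 : ε ∘ₗ ψ 0 = c)
    (hψ : ∀ j < b, δ j ∘ₗ ψ (j + 1) = ψ j ∘ₗ δ (a + j)) :
    Rep h (a + b) (c' ∘ₗ ψ b) (e.comp e' rfl) := by
  have key : ∀ j ≤ b, ∃ φ : Zy M δ (a + j) ⟶ Zy M δ j,
      Zp δ ε (a + j) ≫ φ = ModuleCat.ofHom (ψ j) ≫ Zp δ ε j ∧
      (En h (a + j)).comp (Ext.mk₀ φ) (add_zero _) = e.comp (En h j) rfl := by
    intro j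
    induction j with
    | zero =>
      intro _
      obtain ⟨f, hf, rfl⟩ := h1
      refine ⟨f, hf.trans (ModuleCat.hom_ext h0.symm), ?_⟩
      exact (Ext.comp_mk₀_id _).symm
    | succ j ih =>
      intro hj
      obtain ⟨φ, hφ, he⟩ := ih (by lia)
      have hr : ∀ x ∈ LinearMap.range (δ (a + j)), ψ j x ∈ LinearMap.range (δ j) := by
        rintro _ ⟨x, rfl⟩
        exact ⟨ψ (j + 1) x, LinearMap.congr_fun (hψ j hj) x⟩
      let φ' : Zy M δ (a + (j + 1)) ⟶ Zy M δ (j + 1) := ModuleCat.ofHom ((ψ j).restrict hr)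
      have nat : (Ze h (a + j)).comp (Ext.mk₀ φ') (add_zero 1) =
          (Ext.mk₀ φ).comp (Ze h j) (zero_add 1) :=
        ShortComplex.ShortExact.extClass_naturality (Zs_shortExact h (a + j)) (Zs_shortExact h j)
          { τ₁ := φ', τ₂ := ModuleCat.ofHom (ψ j), τ₃ := φ, comm₁₂ := rfl, comm₂₃ := hφ.symm }
      refine ⟨φ', ?_, ?_⟩
      · apply ModuleCat.hom_ext
        ext x
        exact Subtype.ext (LinearMap.congr_fun (hψ j hj) x).symm
      · show ((En h (a + j)).comp (Ze h (a + j)) rfl).comp (Ext.mk₀ φ') _ = _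
        rw [Ext.comp_assoc _ _ _ rfl (add_zero _) (by lia), nat,
          ← Ext.comp_assoc _ _ _ (add_zero _) (zero_add _) (by lia), he, En,
          Ext.comp_assoc _ _ _ rfl rfl (by lia)]
  obtain ⟨φ, hφ, he⟩ := key b le_rfl
  obtain ⟨f, hf, rfl⟩ := h2
  refine ⟨φ ≫ f, ?_, ?_⟩
  · rw [← Category.assoc, hφ, Category.assoc, hf]
    rfl
  · rw [← Ext.mk₀_comp_mk₀, ← Ext.comp_assoc _ _ _ (add_zero _) (add_zero _) (by lia), he,
      Ext.comp_assoc _ _ _ rfl (add_zero _) (by lia)]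

end Resolution

section ExtRing

variable {C : Type*} [Category C] [Abelian C] [HasExt.{1} C] (X : C)

noncomputable scoped instance : GradedMonoid.GMul (fun n => Ext X X n) where
  mul a b := a.comp b rfl

noncomputable scoped instance : GradedMonoid.GOne (fun n => Ext X X n) where
  one := Ext.mk₀ (𝟙 X)

variable {X} in
theorem mk_comp {i j n : ℕ} (a : Ext X X i) (b : Ext X X j) (h : i + j = n) :
    GradedMonoid.mk (A := fun n => Ext X X n) n (a.comp b h) =
      GradedMonoid.mk i a * GradedMonoid.mk j b := by
  subst h
  rfl

noncomputable scoped instance : DirectSum.GRing (fun n => Ext X X n) where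
  mul_zero a := Ext.comp_zero ..
  zero_mul a := Ext.zero_comp ..
  mul_add a b c := Ext.comp_add ..
  add_mul a b c := Ext.add_comp ..
  one_mul := fun ⟨n, a⟩ => by
    refine (mk_comp (Ext.mk₀ (𝟙 X)) a (zero_add n)).symm.trans ?_
    rw [Ext.mk₀_id_comp]
    rfl
  mul_one := fun ⟨n, a⟩ => by
    refine (mk_comp a (Ext.mk₀ (𝟙 X)) (add_zero n)).symm.trans ?_
    rw [Ext.comp_mk₀_id]
    rfl
  mul_assoc := fun ⟨i, a⟩ ⟨j, b⟩ ⟨m, c⟩ => by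
    show GradedMonoid.mk i a * GradedMonoid.mk j b * GradedMonoid.mk m c =
      GradedMonoid.mk i a * (GradedMonoid.mk j b * GradedMonoid.mk m c)
    rw [← mk_comp a b rfl, ← mk_comp b c rfl, ← mk_comp _ c rfl, ← mk_comp a _ (add_assoc i j m).symm,
      Ext.comp_assoc _ _ _ rfl rfl rfl]
  natCast n := n • Ext.mk₀ (𝟙 X)
  natCast_zero := zero_smul ℕ _
  natCast_succ n := succ_nsmul _ _
  intCast n := n • Ext.mk₀ (𝟙 X)
  intCast_ofNat n := natCast_zsmul _ _
  intCast_negSucc_ofNat n := negSucc_zsmul _ _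

variable (k : Type) [Field k] [Linear k C]

noncomputable scoped instance : DirectSum.GAlgebra k (fun n => Ext X X n) where
  toFun := { toFun := fun c => c • Ext.mk₀ (𝟙 X)
             map_zero' := zero_smul _ _
             map_add' := fun c d => add_smul c d _ }
  map_one := one_smul k (Ext.mk₀ (𝟙 X))
  map_mul r s := by
    refine Eq.trans ?_ (mk_comp (r • Ext.mk₀ (𝟙 X)) (s • Ext.mk₀ (𝟙 X)) (add_zero 0))
    rw [Ext.smul_comp, Ext.mk₀_id_comp, ← mul_smul]
    rfl
  commutes := fun r ⟨n, a⟩ => by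
    refine (mk_comp (r • Ext.mk₀ (𝟙 X)) a (zero_add n)).symm.trans
      (Eq.trans ?_ (mk_comp a (r • Ext.mk₀ (𝟙 X)) (add_zero n)))
    rw [Ext.smul_comp, Ext.comp_smul, Ext.mk₀_id_comp, Ext.comp_mk₀_id]
  smul_def := fun r ⟨n, a⟩ => by
    refine Eq.trans ?_ (mk_comp (r • Ext.mk₀ (𝟙 X)) a (zero_add n))
    rw [Ext.smul_comp, Ext.mk₀_id_comp]
    rfl

end ExtRing

section Coh

variable {k : Type} [Field k] {E : Type} [Ring E] [Algebra k E] {M : Type} [AddCommGroup M] [Module E M]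
  [Module k M] [IsScalarTower k E M] {P : ℕ → Type} [∀ n, AddCommGroup (P n)] [∀ n, Module E (P n)]

/-- The transport between the terms of a complex. -/
def cst {m n : ℕ} (h : m = n) : P m →ₗ[E] P n := h ▸ LinearMap.id

/-- The relation `rp n c x` expresses that the cocycle `c` of degree `n` represents the element `x`
of the cohomology ring `H`. -/
structure IsCoh (k : Type) [Field k] {E : Type} [Ring E] [Algebra k E] {M : Type} [AddCommGroup M]
    [Module E M] [Module k M] [IsScalarTower k E M] {P : ℕ → Type} [∀ n, AddCommGroup (P n)]
    [∀ n, Module E (P n)] (δ : ∀ n, P (n + 1) →ₗ[E] P n) (ε : P 0 →ₗ[E] M) {H : Type*} [Ring H]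
    [Algebra k H] (rp : ∀ n, (P n →ₗ[E] M) → H → Prop) : Prop where
  zero : ∀ n, rp n 0 0
  add : ∀ {n c c' x x'}, rp n c x → rp n c' x' → rp n (c + c') (x + x')
  smul : ∀ {n c x} (r : k), rp n c x → rp n (r • c) (r • x)
  unique : ∀ {n c x x'}, rp n c x → rp n c x' → x = x'
  cocycle : ∀ {n c x}, rp n c x → c ∘ₗ δ n = 0
  exists_class : ∀ {n c}, c ∘ₗ δ n = 0 → ∃ x, rp n c x
  coboundary : ∀ {n} (b : P n →ₗ[E] M), rp (n + 1) (b ∘ₗ δ n) 0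
  exists_coboundary : ∀ {n c}, rp (n + 1) c 0 → ∃ b, c = b ∘ₗ δ n
  eq_zero : ∀ {c}, rp 0 c 0 → c = 0
  one : rp 0 ε 1
  mul : ∀ {a b c c' x y}, rp a c x → rp b c' y → ∀ ψ : ∀ j, P (a + j) →ₗ[E] P j,
    ε ∘ₗ ψ 0 = c → (∀ j < b, δ j ∘ₗ ψ (j + 1) = ψ j ∘ₗ δ (a + j)) → rp (a + b) (c' ∘ₗ ψ b) (x * y)

variable {δ : ∀ n, P (n + 1) →ₗ[E] P n} {ε : P 0 →ₗ[E] M} {H : Type*} [Ring H]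
    [Algebra k H] {rp : ∀ n, (P n →ₗ[E] M) → H → Prop}

theorem cst_comp {m n : ℕ} (h : m = n) : δ n ∘ₗ cst (congrArg (· + 1) h) = cst h ∘ₗ δ m := by
  subst h
  rfl

theorem cst_cst {l m n : ℕ} (h : l = m) (h' : m = n) :
    (cst h' : P m →ₗ[E] P n) ∘ₗ cst h = cst (h.trans h') := by
  subst h h'
  rfl

theorem rp_cst {m n : ℕ} (h : m = n) {c : P n →ₗ[E] M} {x : H} (hc : rp m (c ∘ₗ cst h) x) :
    rp n c x := by
  subst h
  exact hc

theorem IsCoh.mul' (hH : IsCoh k δ ε rp) {a b c c' x y} (h1 : rp a c x) (h2 : rp b c' y)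
    (ψ : ∀ j, P (j + a) →ₗ[E] P j) (h0 : ε ∘ₗ ψ 0 = c ∘ₗ cst (zero_add a))
    (hψ : ∀ j < b, δ j ∘ₗ ψ (j + 1) ∘ₗ cst (add_right_comm j a 1) = ψ j ∘ₗ δ (j + a)) :
    rp (b + a) (c' ∘ₗ ψ b) (x * y) := by
  refine rp_cst (add_comm a b) (hH.mul h1 h2 (fun j => ψ j ∘ₗ cst (add_comm a j)) ?_ ?_)
  · rw [← LinearMap.comp_assoc, h0, LinearMap.comp_assoc, cst_cst]
    rfl
  · intro j hj
    have := congrArg (· ∘ₗ cst (congrArg (· + 1) (add_comm a j))) (hψ j hj)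
    refine Eq.trans ?_ (this.trans ?_)
    · show _ = δ j ∘ₗ ψ (j + 1) ∘ₗ (cst (add_right_comm j a 1) ∘ₗ cst _)
      rw [cst_cst]
    · rw [LinearMap.comp_assoc, cst_comp]; rfl

theorem IsCoh.neg (hH : IsCoh k δ ε rp) {n c x} (h : rp n c x) : rp n (-c) (-x) := by
  have := hH.smul (-1) h
  rwa [neg_one_smul, neg_one_smul] at this

theorem IsCoh.zsmul (hH : IsCoh k δ ε rp) {n c x} (r : ℤ) (h : rp n c x) : rp n (r • c) (r • x) := by
  have := hH.smul (r : k) h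
  rw [Int.cast_smul_eq_zsmul, Int.cast_smul_eq_zsmul] at this
  exact this

theorem IsCoh.sub (hH : IsCoh k δ ε rp) {n c c' x x'} (h : rp n c x) (h' : rp n c' x') :
    rp n (c - c') (x - x') := by
  rw [sub_eq_add_neg, sub_eq_add_neg]
  exact hH.add h (hH.neg h')

theorem IsCoh.sum (hH : IsCoh k δ ε rp) {ι : Type*} (s : Finset ι) {n : ℕ} {c : ι → (P n →ₗ[E] M)}
    {x : ι → H} (h : ∀ i ∈ s, rp n (c i) (x i)) : rp n (∑ i ∈ s, c i) (∑ i ∈ s, x i) := by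
  classical
  induction s using Finset.induction_on with
  | empty => exact hH.zero n
  | insert a s ha ih =>
    rw [Finset.sum_insert ha, Finset.sum_insert ha]
    exact hH.add (h a (Finset.mem_insert_self ..)) (ih fun i hi => h i (Finset.mem_insert_of_mem hi))

variable [HasExt.{1} (ModuleCat.{0} E)]

theorem Rep.smul (h : IsRes δ ε) {n : ℕ} {c : P n →ₗ[E] M}
    {e : Ext (ModuleCat.of E M) (ModuleCat.of E M) n} (r : k) (hc : Rep h n c e) :
    Rep h n (r • c) (r • e) := by
  obtain ⟨f, hf, rfl⟩ := hc
  refine ⟨(Linear.homModule (R := k) (Zy M δ n) (ModuleCat.of E M)).smul r f, ?_, ?_⟩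
  · refine (Linear.comp_smul _ _ _ (Zp δ ε n) r f).trans ?_
    rw [hf]
    ext x
    exact algebraMap_smul E r (c x)
  · rw [← Ext.comp_smul, ← Ext.mk₀_smul]
    rfl

/-- The representation of the elements of the Yoneda algebra by cocycles. -/
def rep (h : IsRes δ ε) (n : ℕ) (c : P n →ₗ[E] M)
    (x : DirectSum ℕ fun n => Ext (ModuleCat.of E M) (ModuleCat.of E M) n) : Prop :=
  ∃ e, Rep h n c e ∧ DirectSum.of _ n e = x

theorem isCoh_rep (h : IsRes δ ε) [∀ n, Module.Projective E (P n)] : IsCoh k δ ε (rep h) where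
  zero n := ⟨0, Rep.zero h n, map_zero _⟩
  add := by
    rintro n c c' _ _ ⟨e, he, rfl⟩ ⟨e', he', rfl⟩
    exact ⟨_, he.add h he', map_add _ _ _⟩
  smul := by
    rintro n c _ r ⟨e, he, rfl⟩
    exact ⟨_, he.smul h r, (DirectSum.lof k ℕ _ n).map_smul r e⟩
  unique := by
    rintro n c _ _ ⟨e, he, rfl⟩ ⟨e', he', rfl⟩
    rw [he.unique h he']
  cocycle := by
    rintro n c _ ⟨e, he, rfl⟩
    exact he.cocycle h
  exists_class hc := by
    obtain ⟨e, he⟩ := Rep.exists_class h hc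
    exact ⟨_, e, he, rfl⟩
  coboundary {n} b := by
    obtain ⟨e, he⟩ := Rep.exists_class h (n := n + 1) (c := b ∘ₗ δ n)
      (LinearMap.ext fun x => (congrArg b (h.comp n x)).trans (map_zero b))
    exact ⟨e, he, by rw [he.coboundary h, map_zero]⟩
  exists_coboundary := by
    rintro n c ⟨e, he, h0⟩
    obtain rfl := (DirectSum.of_injective _).eq_iff' (map_zero _) |>.1 h0
    exact he.exists_coboundary h
  eq_zero := by
    rintro c ⟨e, he, h0⟩
    obtain rfl := (DirectSum.of_injective _).eq_iff' (map_zero _) |>.1 h0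
    exact he.eq_zero h
  one := ⟨_, Rep.one h, rfl⟩
  mul := by
    rintro a b c c' _ _ ⟨e, he, rfl⟩ ⟨e', he', rfl⟩ ψ h0 hψ
    exact ⟨_, he.comp h he' ψ h0 hψ, (DirectSum.of_mul_of _ _).symm⟩

end Coh

/-- A lift of the generator with index `3` to a chain map. -/
def lTab3 : List (List Comb) :=
  [[[(1, 120)], [], []], [[(-1, 41), (1, 162), (-1, 229), (-1, 252), (-1, 338), (-1, 374)], [],
   [], [(-1, 264)], [(1, 363)]], [[(1, 29), (1, 184), (-1, 264), (-1, 618), (1, 638), (1, 650)],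
   [], [], [(1, 264)], [(1, 9), (-1, 42), (-1, 87), (-2, 186), (-2, 205), (-1, 231), (1, 304),
   (1, 307), (-1, 462), (-1, 494), (-1, 594), (1, 604), (1, 607), (-1, 639), (-2, 672)], [(1, 28),
   (-1, 49), (-1, 161), (-1, 162), (-1, 229), (-1, 473), (-1, 495), (-1, 619), (1, 649)]],
   [[(1, 10), (1, 42), (1, 153), (1, 229), (1, 252), (-1, 304), (-1, 338), (-1, 494), (1, 593),
   (1, 594), (1, 728), (1, 750)], [], [], [(-3, 10), (-1, 41), (-1, 42), (-1, 87), (1, 162),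
   (-1, 219), (-1, 229), (-1, 252), (1, 304), (2, 318), (1, 338), (-2, 374), (-2, 442), (-2, 473),
   (1, 483), (1, 494), (-1, 506), (2, 585), (-2, 593), (-1, 594), (-1, 651), (-2, 728), (1, 739),
   (-1, 749), (-1, 750), (-1, 781), (-1, 793)], [(-1, 29), (-1, 30), (-1, 49), (1, 172), (2, 185),
   (1, 186), (1, 264), (1, 305), (-1, 328), (1, 362), (1, 448), (-1, 462), (1, 604), (1, 617),
   (1, 662), (-1, 738), (-1, 771), (1, 794), (1, 807)], [(-1, 40), (-1, 61), (-1, 154), (-1, 195),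
   (-2, 316), (-1, 319), (-2, 337), (-1, 482), (-1, 518), (-2, 540), (1, 605), (-1, 627),
   (1, 751), (-1, 762), (-1, 769), (1, 795)], [(2, 69), (1, 238), (1, 370), (-3, 402), (1, 501),
   (2, 547), (1, 670), (-2, 834), (-1, 844)]], [[(1, 10), (1, 594)], [], [], [(-1, 10), (-3, 29),
   (1, 50), (1, 63), (-1, 86), (-1, 154), (-2, 219), (2, 264), (4, 318), (1, 328), (-2, 338),
   (2, 374), (1, 462), (-2, 475), (-2, 495), (-4, 507), (2, 552), (-2, 585), (-2, 593), (-1, 649),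
   (-1, 761), (1, 762), (-1, 782), (-3, 794), (1, 805)], [(1, 9), (1, 42), (-2, 87), (1, 160),
   (-2, 186), (1, 195), (-2, 205), (1, 231), (-2, 252), (3, 304), (2, 307), (3, 448), (2, 473),
   (1, 474), (1, 483), (1, 540), (-1, 584), (1, 619), (1, 625), (-2, 638), (2, 650), (-2, 696),
   (-1, 730), (-1, 738), (1, 795), (-3, 816), (-2, 866), (2, 888)], [(-1, 49), (-2, 161),
   (-1, 162), (3, 172), (-4, 218), (1, 229), (2, 296), (-2, 305), (-3, 306), (1, 316), (3, 319),
   (2, 337), (-2, 384), (-1, 450), (4, 460), (1, 463), (1, 481), (-3, 506), (-1, 528), (-2, 617),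
   (1, 618), (-4, 662), (-3, 749), (-4, 750), (-1, 771), (-1, 807), (1, 867), (-1, 900)],
   [(1, 224), (-1, 356), (1, 368), (3, 489), (4, 532), (6, 565), (-5, 623), (2, 668), (-6, 691),
   (-1, 701), (1, 702), (-5, 778), (-1, 814), (-3, 844), (-2, 847), (2, 874), (-3, 894), (3, 907),
   (2, 984)], [(1, 56), (2, 124), (1, 127), (1, 268), (-4, 380), (1, 467), (-2, 566), (-1, 634),
   (5, 645), (4, 690), (1, 788), (-2, 813), (-1, 832), (-2, 883), (3, 915), (-1, 972)], [(-2, 58),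
   (2, 126), (-1, 213), (2, 400), (-1, 501), (1, 558), (-2, 611), (-2, 633), (-2, 656), (1, 743),
   (-1, 802), (2, 833)]]]

/-- A lift of the generator with index `4` to a chain map. -/
def lTab4 : List (List Comb) :=
  [[[], [(1, 108)], []], [[], [(-1, 252)], [], [(-1, 49), (-1, 63), (-1, 205), (-1, 350)],
   [(-1, 61)]], [[], [(1, 252)], [], [(-2, 29), (-3, 40), (-2, 43), (-1, 63), (-1, 86), (-2, 184),
   (2, 264), (2, 618), (2, 625), (-1, 638), (-2, 650), (2, 661)], [(1, 9), (-1, 61), (1, 307),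
   (1, 593)], [(-1, 28), (-1, 161), (-1, 172), (1, 218), (1, 306), (-1, 316), (1, 442), (-1, 473),
   (-1, 495), (-1, 507), (1, 518), (-1, 585), (1, 606), (-1, 649)]], [[], [(-1, 252)], [],
   [(1, 41), (-2, 42), (-2, 74), (-5, 153), (2, 161), (-1, 184), (-2, 187), (-1, 193), (-3, 229),
   (-2, 252), (1, 304), (-1, 307), (-1, 318), (2, 442), (-1, 506), (-2, 585), (-1, 619), (1, 625),
   (-3, 728), (-2, 736), (-2, 739), (1, 749), (-3, 750), (-1, 770), (-1, 793)], [(1, 29),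
   (-1, 30), (2, 185), (1, 186), (-1, 264), (1, 462), (1, 730), (1, 737), (-2, 760), (-1, 763),
   (1, 771), (1, 782), (1, 794), (1, 807)], [(2, 40), (1, 43), (1, 154), (-1, 160), (1, 218),
   (-3, 231), (1, 316), (-1, 330), (2, 440), (2, 450), (1, 475), (1, 482), (1, 518), (1, 586),
   (2, 606), (-1, 748), (-2, 751), (1, 762), (1, 769), (-1, 795)], [(-1, 115), (1, 415),
   (-1, 524), (-2, 544), (-2, 565), (1, 611), (-1, 656), (1, 670), (1, 679), (-2, 777),
   (-2, 844)]], [[], [(1, 252)], [], [(-1, 29), (2, 30), (2, 86), (2, 154), (1, 184), (2, 187),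
   (1, 264), (-2, 318), (1, 328), (1, 462), (1, 475), (-2, 594), (1, 607), (-1, 762)], [(-1, 41),
   (1, 42), (-3, 153), (2, 160), (-2, 185), (1, 205), (-4, 231), (3, 252), (-1, 304), (-1, 448),
   (2, 474), (1, 505), (1, 584), (-1, 606), (-1, 751)], [(-1, 28), (2, 31), (-1, 49), (1, 218),
   (-2, 229), (3, 296), (3, 305), (-3, 316), (2, 337), (-2, 384), (-2, 440), (2, 450), (1, 463),
   (-2, 494), (-1, 506), (-1, 528), (1, 586), (3, 617), (2, 618), (-2, 626), (-2, 662), (1, 749),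
   (-2, 760), (-1, 763), (1, 793), (1, 867), (-1, 900)], [(3, 68), (-3, 167), (1, 224), (3, 237),
   (-1, 368), (-1, 489), (1, 500), (-1, 532), (1, 546), (-2, 623), (-2, 646), (1, 701), (2, 702),
   (-1, 844), (-2, 847), (-1, 893), (-1, 904), (-3, 950), (-1, 984)], [(-1, 124), (-1, 245),
   (2, 268), (-1, 323), (1, 370), (1, 566), (-1, 645), (1, 676), (-5, 690), (-2, 767), (3, 788),
   (2, 832), (1, 835), (-1, 915), (1, 937), (2, 972)], [(-3, 69), (-1, 125), (4, 126), (-2, 213),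
   (-3, 225), (-4, 501), (-1, 611), (-1, 656), (2, 669), (2, 703), (-2, 834), (2, 881), (2, 892),
   (-2, 960)]]]

/-- A lift of the generator with index `5` to a chain map. -/
def lTab5 : List (List Comb) :=
  [[[], [], [(1, 96)]], [[], [], [(1, 41), (-1, 87), (-1, 162), (1, 252), (1, 338)], [(1, 49)],
   [(1, 218)]], [[], [], [(1, 161), (1, 162), (-1, 218), (-1, 373), (1, 473), (1, 495), (1, 507),
   (-1, 518), (1, 619)], [(2, 40), (1, 43), (1, 63), (-1, 173), (1, 318), (-1, 463), (-1, 625),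
   (-1, 661)], [(-2, 9), (1, 42), (2, 186), (-1, 252), (1, 304), (-1, 494), (-1, 593), (1, 594)],
   [(1, 49), (1, 218)]], [[], [], [(1, 28), (1, 31), (-1, 42), (-2, 153), (-1, 162), (-1, 184),
   (-1, 229), (1, 304), (-1, 318), (1, 338), (1, 442), (1, 460), (1, 473), (1, 494), (1, 506),
   (-1, 585), (-1, 594), (-1, 661), (-1, 728), (-2, 750), (-1, 793)], [(1, 10), (-1, 28),
   (-1, 41), (2, 42), (1, 87), (5, 153), (-2, 161), (2, 184), (1, 219), (1, 229), (1, 252),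
   (-1, 304), (-1, 338), (-1, 442), (1, 463), (-1, 483), (-1, 494), (-1, 506), (1, 585), (2, 594),
   (1, 619), (-1, 639), (4, 728), (-1, 739), (3, 750), (1, 781), (1, 793)], [(1, 19), (1, 30),
   (-1, 172), (-1, 185), (-1, 205), (1, 264), (1, 305), (-1, 328), (1, 362), (-1, 481), (1, 584),
   (1, 617), (2, 618), (-1, 637), (1, 662), (1, 730), (1, 738), (-1, 771), (1, 794), (-1, 807)],
   [(-2, 40), (-1, 43), (-1, 61), (1, 160), (1, 231), (-1, 297), (-2, 316), (-1, 319), (-1, 337),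
   (-1, 450), (-1, 475), (1, 762), (-1, 769), (1, 795)], [(-2, 238), (-1, 415), (2, 524),
   (-1, 534), (2, 544), (2, 565), (-1, 611), (-1, 670), (-1, 676), (1, 834)]], [[], [], [(-1, 28),
   (1, 49), (1, 162), (-1, 172), (-1, 296), (1, 306), (-1, 362), (-1, 460), (1, 481), (-1, 586),
   (1, 617), (2, 618), (1, 639), (1, 750), (-1, 760), (1, 771), (-1, 793)], [(1, 10), (-1, 50),
   (-1, 63), (-3, 184), (1, 219), (-1, 264), (1, 318), (1, 374), (1, 518), (1, 594), (-1, 637),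
   (-1, 739), (1, 762), (-1, 769), (-1, 782), (1, 805)], [(2, 153), (-1, 160), (1, 195), (1, 231),
   (-1, 252), (1, 304), (1, 307), (1, 361), (-1, 448), (-1, 473), (-1, 474), (1, 483), (2, 505),
   (-1, 540), (-1, 584), (2, 606), (1, 625), (2, 650), (-2, 696), (1, 748), (1, 795), (-1, 816),
   (2, 866), (-2, 888)], [(1, 18), (2, 28), (-1, 49), (2, 161), (1, 172), (1, 218), (2, 229),
   (-1, 296), (1, 305), (2, 306), (1, 316), (-1, 319), (-2, 337), (2, 384), (1, 450), (1, 460),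
   (-1, 463), (-3, 481), (1, 528), (-2, 617), (-2, 618), (-3, 639), (1, 662), (1, 749), (2, 760),
   (-2, 771), (1, 793), (1, 807), (-1, 867), (1, 900)], [(5, 167), (-2, 224), (-1, 356), (1, 388),
   (-1, 489), (1, 546), (-2, 565), (3, 623), (2, 646), (3, 814), (3, 821), (2, 822), (6, 844),
   (1, 847), (2, 874), (-1, 914), (-2, 984)], [(-1, 124), (2, 245), (-1, 323), (1, 390), (1, 556),
   (1, 566), (-2, 645), (-4, 690), (-1, 711), (1, 767), (1, 800), (2, 813), (1, 832), (-1, 845),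
   (-1, 915), (1, 972)], [(1, 69), (-2, 126), (-1, 238), (1, 501), (-1, 544), (1, 656), (-3, 776),
   (1, 802), (2, 820), (1, 834), (2, 913), (-1, 960)]]]

/-- A lift of the generator with index `6` to a chain map. -/
def lTab6 : List (List Comb) :=
  [[[(2, 96), (-1, 108)], [(1, 96), (1, 120)], [(-1, 108)]], [[(2, 49), (1, 61)], [(1, 218),
   (-1, 264)], [(1, 49), (1, 63), (1, 205), (1, 350)], [(1, 41), (1, 61), (-1, 87), (-1, 162),
   (2, 218), (2, 252), (1, 338), (1, 363)], [(1, 41), (2, 49), (1, 63), (-2, 87), (-1, 162),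
   (1, 205), (-1, 229), (2, 252), (1, 338), (1, 350), (-1, 374)]], [[], [(1, 264)], [(-1, 9),
   (1, 29), (1, 40), (1, 43), (1, 63), (1, 184), (-1, 264), (-1, 307), (-1, 593), (-1, 618),
   (-1, 625), (1, 638), (1, 650), (-1, 661)], [(-2, 9), (1, 28), (1, 41), (1, 42), (1, 49),
   (1, 61), (1, 87), (1, 161), (1, 162), (2, 186), (-1, 218), (-1, 229), (-1, 252), (1, 304),
   (1, 350), (-2, 373), (1, 473), (-1, 494), (2, 495), (2, 507), (-2, 518), (-1, 593), (1, 594),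
   (1, 619), (-1, 639), (1, 649)], [(2, 28), (4, 29), (6, 40), (5, 43), (4, 63), (-1, 85),
   (1, 86), (1, 161), (1, 162), (2, 172), (4, 184), (-1, 218), (-2, 219), (-4, 264), (3, 316),
   (1, 319), (2, 338), (1, 350), (1, 473), (2, 483), (2, 495), (3, 507), (-3, 518), (-2, 605),
   (-2, 606), (-4, 618), (1, 619), (-3, 625), (3, 638), (2, 649), (4, 650), (-3, 661)], [(-2, 9),
   (3, 29), (5, 40), (1, 41), (1, 42), (4, 43), (1, 61), (3, 63), (1, 86), (3, 184), (2, 186),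
   (-1, 219), (-1, 231), (-2, 252), (-3, 264), (1, 304), (1, 338), (-1, 462), (1, 483), (-1, 494),
   (-1, 593), (1, 594), (1, 604), (1, 607), (-3, 618), (-3, 625), (2, 638), (3, 650), (-3, 661)]],
   [[], [(-1, 264)], [(-1, 29), (1, 63), (1, 195), (1, 231), (-1, 297), (-1, 475)], [(3, 30),
   (-3, 40), (-2, 43), (-1, 49), (-1, 61), (-1, 63), (-1, 86), (-3, 154), (1, 160), (-6, 185),
   (-5, 186), (1, 195), (-1, 205), (-4, 218), (6, 231), (1, 264), (-5, 316), (-3, 319), (-3, 329),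
   (-2, 337), (1, 441), (4, 448), (-1, 450), (-3, 475), (-1, 481), (-1, 482), (-4, 518), (3, 605),
   (1, 626), (-1, 637), (-1, 650), (-2, 662), (-1, 730), (-6, 737), (-4, 738), (3, 751), (5, 760),
   (1, 761), (1, 762), (2, 763), (-2, 769), (-3, 771), (-3, 794), (4, 795), (-3, 807)], [(4, 10),
   (-1, 28), (-5, 40), (-1, 41), (5, 42), (-3, 43), (-1, 86), (1, 87), (6, 153), (-3, 154),
   (2, 160), (-3, 161), (-2, 162), (2, 195), (-3, 218), (-1, 219), (3, 229), (6, 231), (5, 252),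
   (-4, 297), (-2, 304), (-7, 316), (-2, 318), (-4, 319), (-3, 338), (-2, 450), (2, 460),
   (-1, 463), (-4, 475), (-2, 482), (-1, 483), (-2, 494), (1, 506), (-4, 518), (2, 593), (4, 594),
   (3, 605), (1, 627), (-1, 639), (-1, 650), (-2, 661), (6, 728), (-2, 739), (-1, 749), (4, 750),
   (3, 751), (1, 761), (1, 762), (-2, 769), (1, 770), (2, 781), (3, 795)], [(4, 10), (-5, 19),
   (-4, 28), (9, 30), (-2, 31), (5, 42), (1, 49), (5, 153), (-2, 162), (-7, 172), (-6, 185),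
   (1, 207), (5, 229), (5, 252), (-4, 304), (6, 306), (-2, 338), (7, 441), (1, 442), (-8, 448),
   (5, 462), (-1, 463), (1, 473), (1, 483), (-1, 494), (2, 506), (1, 519), (-1, 585), (4, 593),
   (3, 594), (-7, 604), (5, 618), (-1, 625), (-5, 626), (-3, 662), (6, 728), (-7, 730), (8, 738),
   (1, 749), (7, 750), (3, 763), (1, 770), (-4, 771), (1, 781), (-6, 782), (2, 793), (-4, 794),
   (-4, 807)], [(2, 47), (-3, 58), (-1, 68), (8, 70), (4, 82), (8, 93), (11, 125), (1, 126),
   (1, 191), (4, 213), (10, 237), (10, 258), (3, 259), (5, 268), (-4, 344), (-3, 368), (2, 388),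
   (3, 479), (4, 489), (-3, 500), (-1, 512), (-1, 526), (8, 545), (-3, 556), (-5, 558), (9, 566),
   (-1, 623), (-7, 633), (-12, 646), (9, 677), (-9, 678), (5, 690), (7, 703), (9, 755), (-2, 778),
   (1, 788), (1, 800), (3, 814), (7, 820), (7, 823), (10, 845), (3, 854)]], [[], [(1, 264)],
   [(-1, 29), (-1, 63), (1, 297)], [(-4, 8), (-9, 9), (9, 28), (2, 41), (6, 42), (-1, 49),
   (4, 87), (2, 161), (-3, 172), (9, 186), (-3, 195), (1, 205), (5, 229), (4, 231), (-2, 252),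
   (-3, 296), (-2, 297), (1, 304), (-4, 305), (-1, 306), (-1, 307), (5, 316), (2, 319), (2, 361),
   (-3, 448), (-6, 450), (4, 463), (-2, 473), (4, 474), (-2, 481), (1, 505), (-2, 506),
   (-11, 584), (-7, 586), (4, 592), (-1, 605), (11, 606), (-3, 618), (-5, 619), (-1, 626),
   (6, 638), (1, 639), (1, 650), (2, 661), (3, 662), (-8, 730), (9, 738), (4, 748), (3, 750),
   (6, 760), (3, 763), (2, 771), (2, 793), (1, 795), (1, 807), (3, 816), (3, 866), (-3, 888)],
   [(4, 10), (-5, 18), (2, 28), (-9, 30), (10, 40), (5, 43), (1, 49), (-1, 63), (-1, 154),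
   (4, 161), (6, 172), (-1, 184), (7, 187), (2, 193), (1, 219), (4, 229), (-1, 264), (-2, 296),
   (3, 305), (-1, 306), (2, 316), (-3, 318), (3, 374), (9, 440), (2, 442), (1, 449), (-8, 462),
   (-2, 463), (8, 475), (2, 482), (2, 506), (2, 518), (1, 528), (-5, 586), (4, 594), (7, 604),
   (9, 607), (2, 617), (1, 618), (-3, 626), (-8, 637), (-1, 639), (2, 684), (1, 750), (-10, 769),
   (-3, 771), (-2, 793), (1, 867), (-1, 900)], [(-3, 10), (5, 29), (5, 41), (-3, 42), (4, 63),
   (-1, 87), (1, 108), (6, 153), (-1, 184), (6, 185), (-4, 187), (2, 195), (-1, 205), (-1, 219),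
   (4, 231), (-5, 252), (-3, 264), (-2, 297), (-4, 307), (-1, 318), (3, 338), (-7, 349),
   (-1, 361), (3, 441), (1, 448), (3, 461), (4, 473), (-3, 474), (-1, 475), (2, 495), (1, 505),
   (2, 585), (2, 593), (1, 594), (-3, 604), (5, 605), (3, 606), (3, 627), (4, 637), (-2, 638),
   (2, 650), (-1, 696), (-5, 728), (-4, 730), (2, 751), (5, 769), (-6, 770), (3, 782), (3, 794),
   (1, 805), (-1, 816)], [(-11, 69), (4, 124), (-11, 125), (13, 127), (-1, 191), (1, 213),
   (-1, 238), (9, 245), (4, 323), (-5, 369), (-4, 370), (3, 479), (-12, 501), (-16, 524),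
   (4, 526), (-18, 534), (6, 544), (-1, 547), (9, 557), (11, 558), (-12, 566), (8, 567),
   (-2, 633), (28, 634), (8, 645), (-3, 669), (37, 670), (-6, 690), (-5, 700), (38, 711),
   (-5, 788), (-6, 800), (-39, 813), (1, 820), (-5, 832), (-1, 834), (24, 835), (38, 845),
   (-1, 854), (-10, 883), (-6, 913), (-3, 915), (2, 937), (2, 960), (3, 972)], [(-20, 58),
   (9, 69), (10, 167), (-7, 225), (31, 237), (8, 238), (-29, 258), (-9, 259), (-4, 356),
   (-3, 368), (-9, 388), (-12, 401), (17, 479), (2, 489), (-1, 490), (10, 501), (13, 526),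
   (-1, 544), (-5, 545), (6, 565), (11, 611), (23, 633), (-2, 644), (1, 668), (17, 677),
   (-15, 691), (8, 700), (-1, 701), (16, 702), (-10, 778), (-1, 789), (-19, 814), (-3, 822),
   (-12, 834), (2, 844), (12, 847), (14, 854), (-5, 926), (-7, 938), (-21, 950), (-29, 984)],
   [(-15, 127), (12, 167), (13, 237), (-4, 245), (-2, 268), (1, 323), (-2, 368), (3, 370),
   (3, 401), (2, 467), (-5, 489), (5, 532), (-3, 534), (-5, 546), (-1, 566), (23, 623), (-3, 634),
   (8, 645), (7, 646), (1, 668), (-4, 670), (3, 676), (2, 688), (16, 691), (-2, 701), (-4, 702),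
   (-10, 711), (11, 778), (8, 788), (13, 814), (5, 832), (6, 835), (10, 844), (-7, 845), (9, 874),
   (3, 880), (-2, 883), (-6, 893), (-8, 907), (4, 915), (-5, 984)]]]

/-- A lift of the generator with index `7` to a chain map. -/
def lTab7 : List (List Comb) :=
  [[[(1, 12)], [(1, 24)], [(1, 36)]], [[(-1, 12)], [(-1, 168)], [(-1, 324)], [(-1, 36), (-1, 156),
   (-1, 312)], [(-1, 24), (-1, 180), (-1, 300)]], [[(1, 12)], [(1, 168)], [(1, 324)], [(1, 156),
   (1, 300), (1, 468), (1, 600)], [(1, 24), (1, 312), (1, 444), (1, 612)], [(1, 36), (1, 180),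
   (1, 456), (1, 588)]], [[(-1, 12)], [(-1, 168)], [(-1, 324)], [(-1, 444), (-1, 600), (-1, 756)],
   [(-1, 36), (-1, 156), (-1, 312), (-1, 468), (-1, 588), (-1, 744)], [(-1, 24), (-1, 180),
   (-1, 300), (-1, 456), (-1, 612), (-1, 732)], [(2, 41), (-2, 87), (-2, 153), (2, 161),
   (-2, 184), (-2, 219), (-2, 229), (4, 296), (2, 304), (2, 318), (2, 338), (3, 442), (-2, 463),
   (2, 473), (2, 474), (1, 483), (1, 494), (1, 506), (-2, 519), (1, 585), (1, 625), (-1, 651),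
   (-1, 661), (1, 728), (1, 770), (-1, 793)]], [[(1, 12)], [(1, 168)], [(-1, 324)], [(1, 156),
   (1, 300), (1, 444), (1, 612), (1, 744)], [(1, 24), (1, 312), (1, 456), (1, 588), (1, 756)],
   [(1, 36), (1, 180), (2, 324), (1, 468), (1, 600), (1, 732)], [(-2, 10), (1, 29), (1, 40),
   (-1, 50), (2, 63), (2, 184), (-2, 187), (-3, 219), (-1, 264), (-2, 318), (2, 328), (1, 363),
   (1, 374), (1, 442), (-2, 462), (2, 495), (2, 585), (1, 649), (-1, 663), (-2, 739), (-2, 769),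
   (1, 794), (1, 805), (1, 876)], [(2, 297), (2, 349), (2, 396), (2, 441), (-1, 448), (-1, 451),
   (-1, 474), (1, 540), (2, 584), (-2, 606), (-1, 866), (2, 888)], [(2, 28), (-2, 49), (2, 296),
   (-2, 337), (2, 384), (1, 450), (1, 460), (-2, 481), (1, 528), (2, 651), (-2, 771), (2, 793),
   (-1, 867), (2, 900)]]]

/-- A lift of the generator with index `8` to a chain map. -/
def lTab8 : List (List Comb) :=
  [[[(1, 0)], [], [], [], []], [[(1, 0)], [], [], [], [(1, 144)], [(1, 288)]], [[(1, 0)], [], [],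
   [(1, 144), (1, 288)], [(1, 432)], [(1, 576)], [(-1, 183), (1, 438), (1, 446), (-1, 469),
   (-1, 492)]], [[(1, 0)], [], [], [(1, 432)], [(1, 144), (1, 576)], [(1, 288), (1, 720)],
   [(-2, 27), (-2, 169), (-2, 228), (1, 292), (-1, 295), (-1, 303), (-2, 459), (-1, 581),
   (-1, 601), (-1, 615), (-1, 660), (-1, 727), (-1, 735), (-1, 746), (-1, 792)], [(1, 315),
   (1, 326), (1, 436), (1, 439), (-1, 457), (1, 471), (-1, 492), (-1, 504)], [(1, 437), (1, 438),
   (1, 447), (-1, 458), (1, 480)]], [[(1, 0)], [], [], [(1, 144), (1, 288), (1, 432)], [(1, 576)],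
   [(1, 720)], [(-1, 183), (1, 582), (1, 590), (-1, 613), (-1, 636), (-2, 745), (-2, 768),
   (1, 864)], [(-1, 26), (1, 39), (-1, 458), (-1, 581), (1, 648), (1, 724), (1, 768), (1, 804)],
   [(-1, 39), (-1, 582), (-1, 590), (-1, 648), (-1, 758), (-1, 768), (-1, 804)], [(1, 292),
   (-1, 302), (1, 315), (2, 336), (1, 436), (-1, 446), (1, 469), (1, 480), (1, 516), (-2, 746),
   (2, 780), (2, 792)], [(1, 294), (-1, 348), (-2, 747)]]]

/-- A lift of the generator with index `9` to a chain map. -/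
def lTab9 : List (List Comb) :=
  [[[], [(1, 0)], [], [], []], [[], [(1, 144)], [], [(1, 0)], [], [(1, 288)]], [[], [(1, 144)],
   [], [(1, 0), (1, 288)], [(1, 432)], [(1, 576)], [(-1, 39), (1, 437), (1, 438), (1, 446),
   (-1, 459), (1, 504)]], [[], [(1, 144)], [], [(1, 0), (1, 432)], [(1, 576)], [(1, 288),
   (1, 720)], [(1, 303), (1, 325), (1, 581), (-1, 601), (1, 615), (-1, 660)], [(1, 7), (-2, 14),
   (1, 39), (-2, 60), (-1, 159), (1, 294), (-1, 446), (-1, 492), (-1, 591), (-1, 733), (-1, 768)],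
   [(1, 580), (-1, 589), (1, 614), (-1, 636)]], [[], [(1, 144)], [], [(1, 0), (1, 288), (1, 432)],
   [(1, 576)], [(1, 720)], [(-1, 39), (1, 301), (-1, 471), (1, 724), (1, 745), (-1, 758),
   (-1, 804)], [(-1, 39), (-1, 590), (-1, 648), (1, 864)], [(1, 39), (1, 471), (-1, 724),
   (-1, 745), (1, 758), (1, 804)], [(1, 292), (-1, 315), (-1, 591)], [(-1, 6), (-1, 38), (-1, 60),
   (1, 169), (-1, 216), (1, 293), (1, 294), (1, 313), (1, 457), (-1, 504), (-1, 589), (1, 602),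
   (1, 624), (1, 747)]]]

/-- A lift of the generator with index `10` to a chain map. -/
def lTab10 : List (List Comb) :=
  [[[], [], [(1, 0)], [], []], [[], [], [(1, 288)], [(1, 0)], [(1, 144)], []], [[], [],
   [(1, 288)], [(1, 0), (1, 144)], [(1, 432)], [(1, 576)], [(2, 438), (2, 446), (-1, 469),
   (-1, 492), (1, 504), (-1, 583), (1, 591)]], [[], [], [(-1, 288)], [(1, 0), (1, 432)],
   [(1, 144), (1, 576)], [(2, 288), (1, 720)], [(-2, 27), (-2, 169), (-2, 228), (2, 292),
   (-2, 459), (-2, 601), (-2, 660), (1, 724), (-1, 746), (-1, 792)], [(-2, 14), (-2, 60),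
   (-2, 159), (2, 294), (2, 436), (-1, 457), (-2, 492), (-1, 504), (-2, 591), (1, 602), (-1, 725),
   (-1, 733), (1, 758), (-1, 768)], [(1, 437), (1, 438), (1, 447), (-1, 458), (1, 480), (1, 580),
   (-1, 589), (1, 614), (-1, 636), (1, 759)]], [[], [], [(-1, 288)], [(1, 0), (1, 144), (2, 288),
   (1, 432)], [(1, 576)], [(1, 720)], [(1, 582), (1, 590), (1, 648), (1, 724), (-1, 745),
   (-1, 768)], [(1, 458), (1, 582), (-1, 590), (-1, 648), (1, 724), (1, 745), (1, 768)],
   [(1, 471), (-1, 582), (-1, 590), (-1, 648), (-1, 724), (-1, 745), (-1, 768), (1, 864)],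
   [(2, 292), (-2, 302), (2, 336), (1, 436), (1, 439), (1, 469), (1, 480), (1, 516), (-2, 591),
   (-2, 746), (2, 780), (2, 792)], [(-2, 6), (-2, 38), (-2, 60), (-2, 149), (2, 159), (2, 294),
   (-2, 437), (2, 447), (1, 457), (-1, 492), (-1, 504), (2, 580)]]]

/-- A lift of the generator with index `11` to a chain map. -/
def lTab11 : List (List Comb) :=
  [[[], [], [], [(1, 0)], [(1, 0)]], [[], [], [], [(1, 144), (1, 288)], [(1, 0), (1, 288)],
   [(1, 0), (1, 144)]], [[], [], [], [(1, 432), (1, 576)], [(1, 0), (1, 144), (1, 288), (1, 576)],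
   [(1, 0), (1, 144), (1, 288), (1, 432)], [(1, 6), (2, 14), (1, 27), (-1, 60), (1, 159),
   (1, 169), (1, 192), (1, 216), (-1, 228), (1, 292), (2, 294), (2, 302), (1, 360), (-1, 439),
   (1, 447), (1, 457), (1, 582), (1, 589), (1, 590), (1, 602), (-1, 613), (-1, 636)]], [[], [],
   [], [(1, 144), (1, 288), (1, 576), (1, 720)], [(1, 0), (1, 288), (1, 432), (1, 720)], [(1, 0),
   (1, 144), (1, 432), (1, 576)], [(-1, 6), (-1, 60), (-1, 159), (-1, 313), (1, 436), (1, 504),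
   (-1, 516), (1, 580), (1, 602), (-1, 603), (-1, 768)], [(-1, 6), (2, 26), (-1, 27), (-1, 48),
   (-1, 157), (1, 192), (2, 216), (-1, 228), (-1, 302), (-1, 437), (-2, 447), (1, 458), (-1, 469),
   (1, 516), (2, 580), (1, 582), (-1, 589), (-1, 601), (-1, 636), (-1, 735), (-1, 759), (-1, 780),
   (-1, 792)], [(-1, 7), (-1, 27), (-1, 159), (-2, 169), (1, 181), (-2, 228), (1, 292), (2, 294),
   (-2, 314), (1, 336), (1, 436), (-1, 439), (-2, 445), (1, 446), (-1, 459), (1, 581), (1, 582),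
   (-2, 590), (1, 591), (-1, 601), (-1, 725), (-1, 735), (-2, 746), (1, 758), (1, 768),
   (-1, 780)]], [[], [], [], [(1, 576), (1, 720)], [(1, 0), (1, 144), (1, 288), (1, 432),
   (1, 720)], [(1, 0), (1, 144), (1, 288), (1, 432), (1, 576)], [(-1, 5), (1, 7), (2, 14),
   (1, 72), (2, 169), (1, 192), (1, 204), (-1, 228), (-1, 293), (2, 302), (2, 313), (-1, 315),
   (-1, 325), (-1, 326), (1, 436), (1, 438), (1, 439), (2, 446), (-1, 447), (2, 457), (1, 492),
   (-1, 516), (1, 580), (-1, 589), (1, 601), (1, 602), (1, 624), (-1, 660), (1, 725), (1, 726),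
   (1, 733), (1, 746), (1, 747), (-1, 759), (-1, 780)], [(-1, 5), (2, 14), (2, 27), (1, 38),
   (1, 72), (1, 149), (2, 169), (2, 192), (1, 204), (2, 216), (-2, 228), (1, 292), (1, 294),
   (2, 302), (1, 313), (1, 360), (1, 436), (1, 437), (2, 438), (1, 446), (1, 457), (-1, 516),
   (1, 591), (1, 601), (1, 602), (1, 624), (1, 726), (1, 733), (1, 746), (-1, 780), (-1, 792)],
   [(-1, 6), (-1, 7), (-2, 14), (-1, 38), (-1, 72), (-3, 149), (2, 159), (-2, 169), (-1, 192),
   (1, 228), (-1, 293), (1, 294), (-2, 295), (-2, 302), (1, 303), (-1, 313), (2, 315), (2, 336),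
   (-2, 437), (-1, 438), (-2, 446), (-1, 457), (1, 469), (3, 480), (3, 516), (-2, 583), (-1, 601),
   (-1, 602), (1, 615), (-1, 624), (-1, 725), (-1, 726), (-1, 733), (-1, 734), (-1, 746),
   (2, 759), (3, 780), (2, 792)], [(-1, 6), (-1, 38), (1, 39), (-1, 149), (1, 157), (1, 159),
   (-1, 169), (1, 216), (1, 301), (1, 438), (-1, 445), (-1, 447), (1, 458), (-1, 492), (-2, 504),
   (1, 580), (-1, 602), (1, 624), (1, 648), (-1, 724), (-2, 745), (1, 758), (-1, 768), (1, 804),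
   (1, 864)], [(1, 37), (1, 39), (1, 151), (-1, 228), (-1, 302), (1, 314), (1, 336), (2, 436),
   (2, 439), (-1, 445), (-1, 446), (1, 469), (1, 480), (1, 516), (-1, 590), (-1, 591), (1, 601),
   (-1, 648), (-1, 745), (-1, 746), (1, 758), (1, 780), (1, 792), (1, 804), (1, 864)]]]

/-- A lift of the generator with index `12` to a chain map. -/
def lTab12 : List (List Comb) :=
  [[[(1, 12)], [(1, 24)], [(1, 36)], [], [], []], [[(-1, 12)], [(1, 146)], [(1, 291)], [],
   [(1, 2), (1, 147), (1, 289)], [(-1, 24), (-1, 180), (-1, 300)], [(-2, 28), (-2, 184),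
   (-2, 229), (-2, 252)]], [[(1, 12)], [(1, 146)], [(-1, 291)], [(1, 156), (1, 300), (1, 468),
   (1, 579)], [(1, 2), (1, 312), (1, 444), (1, 577)], [(1, 3), (1, 180), (2, 291), (1, 456),
   (1, 578)], [(2, 40), (-2, 154), (2, 184), (2, 328), (2, 363), (2, 374), (2, 460)], [(-2, 205),
   (2, 297), (-2, 494), (-2, 639), (-2, 672)], [(2, 28), (-2, 49), (-2, 161), (-2, 172),
   (-2, 229), (2, 306), (-2, 337), (2, 442), (-2, 473), (-2, 495), (2, 606), (-2, 637)]],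
   [[(-1, 12)], [(1, 146)], [(-1, 291)], [(2, 291), (1, 433), (1, 578), (1, 723)], [(2, 2),
   (1, 36), (-1, 156), (-1, 312), (1, 434), (1, 579), (1, 721)], [(2, 3), (1, 24), (-1, 180),
   (-1, 300), (1, 435), (1, 577), (1, 722)], [(2, 10), (1, 41), (-4, 42), (-1, 87), (-4, 153),
   (5, 193), (1, 252), (2, 304), (-2, 318), (1, 338), (-2, 361), (-3, 384), (2, 442), (-1, 463),
   (-3, 474), (1, 483), (-1, 552), (-2, 585), (-1, 593), (-4, 594), (1, 616), (1, 625), (3, 736),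
   (-3, 750), (1, 770)], [(-1, 28), (2, 41), (-1, 42), (-2, 87), (1, 120), (-2, 153), (1, 161),
   (-2, 162), (-1, 184), (-1, 229), (-1, 252), (1, 304), (-2, 318), (1, 338), (2, 442), (-1, 463),
   (1, 473), (1, 483), (2, 494), (1, 506), (-1, 519), (2, 552), (-1, 594), (1, 625), (-1, 661),
   (-1, 750), (1, 770), (1, 816)], [(-2, 10), (2, 161), (2, 162), (2, 252), (-2, 304), (-2, 338),
   (-2, 361), (-1, 442), (2, 463), (-1, 473), (-3, 494), (-3, 506), (1, 519), (-2, 552), (1, 585),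
   (1, 619), (-1, 625), (-1, 639), (-2, 651), (1, 661), (-1, 728), (2, 739), (-1, 770), (-2, 781),
   (-1, 793)], [(2, 63), (-2, 264), (2, 328), (-4, 362), (-4, 396), (2, 441), (2, 462), (2, 495),
   (-2, 604), (-2, 617), (-2, 649), (-2, 662), (-2, 763), (2, 771), (-2, 794), (2, 807)],
   [(-2, 40), (-2, 43), (-2, 61), (2, 297), (2, 316), (-2, 337), (2, 440), (-2, 475), (-2, 540),
   (2, 586), (-2, 751), (-2, 769)]], [[(1, 12)], [(1, 146)], [(1, 291)], [(1, 156), (1, 300),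
   (1, 433), (1, 578), (1, 723)], [(3, 2), (-2, 24), (1, 312), (1, 434), (1, 579), (1, 721)],
   [(3, 3), (-2, 36), (1, 180), (1, 435), (1, 577), (1, 722)], [(2, 10), (1, 40), (1, 43),
   (1, 63), (1, 442), (-1, 507), (1, 518), (2, 552), (-4, 594), (-1, 769), (1, 876)], [(1, 153),
   (1, 252), (2, 441), (-1, 448), (-1, 451), (-1, 474), (1, 540), (3, 584), (-3, 606), (-1, 650),
   (1, 888)], [(-2, 28), (2, 49), (-2, 161), (-4, 162), (2, 218), (-2, 229), (-2, 305), (-4, 337),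
   (-2, 362), (-2, 373), (2, 384), (-1, 450), (-1, 460), (1, 528), (-2, 618), (2, 639), (2, 662),
   (2, 763), (-2, 793), (1, 900)], [(-2, 10), (5, 40), (4, 43), (6, 63), (-3, 120), (-1, 154),
   (1, 184), (2, 264), (-2, 338), (1, 442), (-1, 472), (2, 475), (-4, 482), (2, 495), (-2, 518),
   (1, 594), (1, 604), (-4, 769), (2, 828)], [(2, 42), (-4, 153), (-3, 185), (-2, 186), (2, 195),
   (1, 205), (-3, 231), (4, 339), (-5, 361), (2, 441), (2, 448), (-2, 474), (2, 483), (-7, 505),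
   (3, 616), (2, 625), (3, 638), (-3, 661), (-1, 795), (1, 816), (1, 866), (-1, 888)], [(3, 28),
   (-1, 31), (1, 49), (6, 62), (-4, 172), (6, 193), (-7, 218), (-5, 229), (-1, 306), (5, 337),
   (5, 449), (4, 450), (3, 481), (5, 494), (2, 586), (-2, 618), (6, 626), (-1, 662), (2, 749),
   (4, 750), (-3, 763), (3, 781), (2, 793), (-3, 807), (1, 840)]]]

/-- The multiples of the relations with integral coefficients, and cochains of which they are the
coboundaries. -/
def relTab : List (List (ℤ × List ℕ) × Comb) :=
  [([(1, [0, 0])], []), ([(1, [0, 1])], []), ([(1, [0, 2])], []), ([(1, [1, 1])], []),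
   ([(1, [1, 2])], []), ([(1, [2, 2])], []), ([(1, [0, 3])], []), ([(1, [0, 4])], []),
   ([(1, [0, 5])], []), ([(1, [0, 6])], []), ([(1, [1, 3])], []), ([(1, [1, 4])], []),
   ([(1, [1, 5])], []), ([(1, [1, 6])], []), ([(1, [2, 3])], []), ([(1, [2, 4])], []),
   ([(1, [2, 5])], []), ([(1, [2, 6])], []), ([(1, [2, 7])], []), ([(1, [3, 4])], []),
   ([(1, [3, 5])], []), ([(1, [3, 6])], []), ([(1, [4, 5])], []), ([(1, [4, 6])], []),
   ([(1, [5, 6])], []),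
   ([(1, [0, 10]), (-2, [0, 8]), (-2, [0, 9])], [(-2, 2), (-2, 13), (-1, 25), (-1, 26)]),
   ([(1, [0, 11]), (-1, [0, 8]), (-1, [0, 9])], [(-1, 2), (-1, 13), (-1, 27)]),
   ([(1, [1, 8]), (1, [0, 8])], [(1, 2), (-1, 3)]),
   ([(1, [1, 9]), (-2, [0, 9])], [(-1, 13), (1, 15)]),
   ([(1, [1, 10]), (-1, [0, 8]), (-1, [0, 9])], [(-1, 2), (-1, 13), (-1, 25)]),
   ([(1, [1, 11]), (-1, [0, 9])], [(-1, 13), (1, 14)]), ([(1, [2, 8]), (1, [7, 3])], []),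
   ([(1, [2, 9]), (1, [7, 4])], []), ([(1, [2, 10]), (-1, [7, 5])], []),
   ([(2, [2, 11]), (-1, [7, 6])], []), ([(1, [8, 4]), (1, [8, 5])], [(1, 43)]),
   ([(1, [8, 4]), (-1, [9, 3])], [(-1, 40)]), ([(1, [8, 4]), (1, [9, 5])], [(1, 43)]),
   ([(1, [8, 4]), (-1, [10, 3])], [(-1, 40)]), ([(1, [8, 4]), (-1, [10, 4])], []),
   ([(6, [11, 3]), (-1, [8, 6]), (4, [9, 6])], [(3, 4), (1, 7), (-4, 18), (4, 19), (4, 41), (4, 52)]),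
   ([(6, [11, 4]), (1, [8, 6]), (-6, [11, 5]), (5, [9, 6])], [(-3, 4), (-1, 7), (-5, 18), (5, 19), (2, 41), (2, 52)]),
   ([(1, [9, 6]), (-1, [10, 6])], [(-1, 18), (1, 19), (1, 30), (-1, 31)]),
   ([(3, [11, 6]), (12, [8, 4]), (-1, [8, 6]), (-2, [9, 6])], [(3, 4), (1, 7), (2, 18), (-2, 19), (3, 40), (1, 41), (9, 43), (-2, 52)]),
   ([(1, [8, 9]), (-1, [8, 10])], []), ([(1, [8, 9]), (-1, [9, 10])], []),
   ([(1, [8, 11]), (-1, [11, 11]), (2, [8, 9]), (1, [13, 0]), (-1, [13, 1])], []),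
   ([(1, [9, 11]), (-1, [11, 11]), (2, [8, 9]), (1, [13, 1])], []),
   ([(1, [10, 11]), (-1, [11, 11]), (2, [8, 9]), (-1, [13, 0])], []),
   ([(1, [0, 12]), (-4, [11, 5]), (2, [9, 6])], [(-1, 4), (-3, 18), (2, 19), (1, 30), (-2, 31), (2, 52)]),
   ([(3, [1, 12]), (2, [8, 6]), (-12, [11, 5]), (4, [9, 6])], [(-3, 4), (1, 7), (-7, 18), (1, 19), (3, 30), (-3, 31), (-2, 41), (4, 52)]),
   ([(1, [2, 12])], []), ([(1, [7, 12]), (2, [13, 2])], []), ([(1, [12, 3]), (1, [8, 8, 2])], []),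
   ([(1, [12, 4]), (1, [9, 9, 2])], []), ([(1, [12, 5]), (-1, [10, 10, 2])], []),
   ([(1, [12, 6]), (-2, [11, 11, 2]), (4, [8, 9, 2])], []),
   ([(1, [0, 7, 11]), (-2, [11, 5]), (1, [9, 6])], [(-1, 18), (1, 19), (1, 43), (1, 52), (1, 53)]),
   ([(3, [1, 7, 11]), (1, [8, 6]), (-6, [11, 5]), (2, [9, 6])], [(-3, 4), (-1, 7), (-2, 18), (2, 19), (-3, 40), (-1, 41), (3, 43), (2, 52)]),
   ([(1, [8, 12]), (-1, [8, 8, 7]), (-2, [13, 3])], []),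
   ([(1, [9, 12]), (-1, [9, 9, 7]), (-2, [13, 4])], []),
   ([(1, [10, 12]), (-1, [10, 10, 7]), (2, [13, 5])], []),
   ([(1, [11, 12]), (-1, [10, 11, 7]), (1, [13, 6]), (1, [13, 1, 7])], [(1, 76)])]

/-- Cochains of which the graded commutators are the coboundaries. -/
def comTab : List (ℕ × ℕ × Comb) :=
  [(3, 10, [(-1, 40)]), (3, 11, [(-1, 5)]), (4, 8, [(-2, 40), (-1, 43)]), (4, 11, [(-1, 41)]),
   (5, 8, [(1, 40)]), (5, 9, [(-1, 40)]), (5, 11, [(-1, 30)]),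
   (6, 8, [(3, 4), (1, 7), (-1, 30), (1, 41), (2, 52)]), (6, 9, [(1, 18), (-2, 52)]),
   (6, 10, [(-1, 52)]), (6, 11, [(-1, 30), (1, 31), (2, 40), (-1, 41), (1, 43), (2, 52)]),
   (6, 12, [(-1, 56)]), (6, 13, [(-3, 76), (-9, 79)]), (11, 12, [(-1, 48), (2, 76)])]

/-- Lifts of the generators of positive degree to chain maps. -/
def lTab : List (List (List Comb)) :=
  [lTab3, lTab4, lTab5, lTab6, lTab7, lTab8, lTab9, lTab10, lTab11, lTab12]

/-- The differential of the resolution on generators, in degrees up to `7`. -/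
noncomputable def DT (n G : ℕ) : Comb :=
  bif Nat.ble 6 G then bif Nat.ble n 2 then [] else
    fm (dT (n - 3) (G - 6)) (fun c i r => (c, Nat.add i 864) :: r) (fT (n - 3) (G - 6))
  else dT (n + 1) G

/-- The table of a map which sends generators to generators. -/
noncomputable def idT (r G : ℕ) : Comb := bif Nat.ble r G then [] else [(1, 144 * G)]

/-- The table of `sh`. -/
noncomputable def shT (r G : ℕ) : Comb := bif Nat.ble r G then [] else [(1, 144 * (G + 6))]

/-- The table of `pr`. -/
noncomputable def prT (r G : ℕ) : Comb :=
  bif Nat.ble 6 G then bif Nat.ble (r + 6) G then [] else [(1, 144 * (G - 6))] else []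

/-- The differential of the resolution on generators. -/
noncomputable def dlT : ℕ → ℕ → Comb
  | 0 => fun G => app acF (idT 1) (app acF (dT 1) (idT 3 G))
  | 1 => fun G => app acF (idT 3) (app acF (dT 2) (idT 5 G))
  | 2 => fun G => app acF (idT 5) (app acF (dT 3) (idT 6 G))
  | 3 => fun G => app acF (idT 6) (app acF (dT 4) (idT 6 G) ++
      app acF (fT 0) (app acF (idT 1) (prT 1 G)))
  | n + 4 => fun G => app acF (idT 6) (app acF (dT (n + 5)) (idT 6 G) ++
      app acF (fT (n + 1)) (app acF (idT (rk (n + 1))) (prT (R (n + 1)) G))) ++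
      app acF (shT (R n)) (app acF (dlT n) (prT (R (n + 1)) G))

/-- The degrees of the generators. -/
noncomputable def dg (i : ℕ) : ℕ :=
  bif Nat.ble i 2 then 0 else bif Nat.ble i 7 then 1 else bif Nat.ble i 11 then 2 else
    bif Nat.ble i 12 then 3 else 4

/-- The degree of a word. -/
noncomputable def dgW (l : List ℕ) : ℕ :=
  List.rec (motive := fun _ => ℕ) 0 (fun i _ d => Nat.add (dg i) d) l

/-- The central elements which represent the generators of degree `0`. -/
def zTab : List Comb := [[(1, 48), (1, 72)], [(1, 48), (-1, 60), (1, 84)], [(1, 132)]]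

/-- Lifts of the generators to chain maps. -/
noncomputable def LT (i j G : ℕ) : Comb :=
  bif Nat.ble (R (dg i + j)) G then [] else bif Nat.ble i 2 then
    fm (gD zTab i) (fun c a r => (c, Nat.add (Nat.mul 144 G) a) :: r) []
  else bif Nat.ble i 12 then gD (gD (gD lTab (i - 3)) j) G
  else prT (R j) G

/-- The degrees up to which the lifts are chain maps. -/
noncomputable def lv (i : ℕ) : ℕ := bif Nat.ble i 12 then 4 else 3

/-- The cochains which represent the words in the generators. -/
noncomputable def cwT (l : List ℕ) : ℕ → Comb :=
  List.rec (motive := fun _ => ℕ → Comb) (fun G => bif Nat.beq G 0 then [(1, 0)] else [])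
    (fun i l T G => app acA T (LT i (dgW l) G)) l

/-- Whether the available lifts are sufficient for a word. -/
noncomputable def okW (l : List ℕ) : Bool :=
  List.rec (motive := fun _ => Bool) true
    (fun i l b => bif Nat.ble i 13 then bif Nat.ble (dgW l) (lv i) then b else false else false) l

/-- The table of a cochain, coded by `12 * G + a`. -/
noncomputable def cT (r : ℕ) (b : Comb) (G : ℕ) : Comb :=
  bif Nat.ble r G then [] else
    fm b (fun c i l => bif Nat.beq (Nat.div i 12) G then (c, Nat.mod i 12) :: l else l) []

/-- Formal integral combinations of words. -/
abbrev Wcomb := List (ℤ × List ℕ)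

/-- Evaluation of a combination of words. -/
def evW {S : Type*} [Ring S] (e : ℕ → S) (r : Wcomb) : S :=
  (r.map fun p => p.1 • (p.2.map e).prod).sum

/-- The cochain which represents a combination of words. -/
noncomputable def cT' (r : Wcomb) (G : ℕ) : Comb := r.flatMap fun p => sc p.1 (cwT p.2 G)

/-- Whether a combination of words of degree `n + 1` is the coboundary of `b`. -/
noncomputable def relOK (n : ℕ) (r : Wcomb) (b : Comb) : Bool :=
  (r.all fun p => okW p.2 && Nat.beq (dgW p.2) (n + 1)) &&
    (List.range (R (n + 1))).all fun G => eqv (cT' r G) (app acA (cT (R n) b) (DT n G))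

/-- Whether a combination of words of degree `0` vanishes. -/
noncomputable def relOK₀ (r : Wcomb) : Bool :=
  (r.all fun p => okW p.2 && Nat.beq (dgW p.2) 0) && eqv (cT' r 0) []

section

variable {k : Type} [Field k] {A : Type} [Ring A] [Algebra k A] {w : ℕ → A}

lemma IsTab.congr {M : Type*} [AddCommGroup M] [Module (Env k A) M] {r : ℕ}
    {f : Fr k A r →ₗ[Env k A] M} {e : ℕ → M} {T T' : ℕ → Comb} (hf : IsTab f e T)
    (h : ((List.range r).all fun G => eqv (T G) (T' G)) = true) (h' : ∀ G, r ≤ G → T' G = []) :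
    IsTab f e T' := fun G => by
  rcases lt_or_ge G r with hG | hG
  · rw [hf]
    exact ev_congr e (List.all_eq_true.1 h G (List.mem_range.2 hG))
  · rw [gen_of_le hG, h' G hG, map_zero, ev_nil]

variable (hw : IsFK k w)
include hw

lemma isTab_of_gen {r r' : ℕ} {f : Fr k A r →ₗ[Env k A] Fr k A r'} {v : ℕ → ℕ}
    (h : ∀ G < r, f (gen k A r G) = gen k A r' (v G)) :
    IsTab f (atm k w r') (fun G => bif Nat.ble r G then [] else [(1, 144 * v G)]) := fun G => by
  rcases lt_or_ge G r with hG | hG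
  · have : Nat.ble r G = false := by
      rw [← Bool.not_eq_true, Nat.ble_eq]
      exact not_le.2 hG
    simp only [this, cond_false, ev_cons, ev_nil, one_smul, add_zero]
    rw [h G hG, gen_eq hw]
  · simp only [gen_of_le hG, Nat.ble_eq_true_of_le hG, map_zero, cond_true, ev_nil]

lemma isTab_inl (n : ℕ) : IsTab (inl k A n) (atm k w (R n)) (idT (rk n)) :=
  isTab_of_gen hw fun _ hG => inl_gen hG

lemma isTab_ka (n : ℕ) : IsTab (ka k A n) (atm k w (rk n)) (idT (rk n)) := fun G =>
  (ka_gen n G).trans (isTab_of_gen hw (f := LinearMap.id) (v := id) (fun _ _ => rfl) G)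

lemma isTab_sh (n : ℕ) : IsTab (sh k A n) (atm k w (R (n + 4))) (shT (R n)) :=
  isTab_of_gen hw fun _ _ => sh_gen _ _

lemma isTab_pr (n : ℕ) : IsTab (pr k A n) (atm k w (R n)) (prT (R n)) := fun G => by
  rcases lt_or_ge G 6 with hG | hG
  · rw [pr_gen_of_lt hG, prT]
    have : Nat.ble 6 G = false := by
      rw [← Bool.not_eq_true, Nat.ble_eq]
      exact not_le.2 hG
    rw [this]
    rfl
  · obtain ⟨G, rfl⟩ := Nat.exists_eq_add_of_le' hG
    rw [pr_gen_add, prT, Nat.ble_eq_true_of_le hG, Nat.add_sub_cancel]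
    refine (isTab_of_gen hw (f := LinearMap.id) (v := id) (fun _ _ => rfl) G).trans ?_
    rw [show Nat.ble (R n + 6) (G + 6) = Nat.ble (R n) G by
      rw [Bool.eq_iff_iff, Nat.ble_eq, Nat.ble_eq]; omega]
    rfl

lemma isTab_dlT (n : ℕ) : IsTab (dl k w n) (atm k w (R n)) (dlT n) := by
  induction n using Nat.strong_induction_on with
  | _ n ih =>
  have kd (n : ℕ) := (isTab_ka hw (n + 1)).comp (isTab_dK w n) (isAct_atm hw _)
  have pf (n : ℕ) := ((isTab_pr hw n).comp (isTab_ka hw n) (isAct_atm hw _)).comp (isTab_fK w n)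
    (isAct_atm hw _)
  match n with
  | 0 => exact (kd 0).comp (isTab_inl hw 0) (isAct_atm hw _)
  | 1 => exact (kd 1).comp (isTab_inl hw 1) (isAct_atm hw _)
  | 2 => exact (kd 2).comp (isTab_inl hw 2) (isAct_atm hw _)
  | 3 => exact ((kd 3).add (pf 0)).comp (isTab_inl hw 3) (isAct_atm hw _)
  | n + 4 =>
    exact IsTab.add (((kd (n + 4)).add (pf (n + 1))).comp (isTab_inl hw (n + 4)) (isAct_atm hw _))
      (((isTab_pr hw (n + 1)).comp (ih n (by omega)) (isAct_atm hw _)).comp (isTab_sh hw n)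
        (isAct_atm hw _))

omit hw in
lemma DT_of_le {n G : ℕ} (hn : n < 7) (h : R (n + 1) ≤ G) : DT n G = [] := by
  unfold DT
  rcases lt_or_ge G 6 with hG | hG
  · have h6 : Nat.ble 6 G = false := by
      rw [← Bool.not_eq_true, Nat.ble_eq]
      exact not_le.2 hG
    rw [h6]
    exact dT_of_le ((rk_le _).trans h)
  · rw [Nat.ble_eq_true_of_le hG]
    interval_cases n
    · rfl
    · rfl
    · rfl
    all_goals
      have h3 : rk _ ≤ G - 6 := (rk_le _).trans (Nat.le_sub_of_add_le h)
      exact congrArg₂ (fun a b => fm a (fun c i r => (c, Nat.add i 864) :: r) b) (dT_of_le h3)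
        (fT_of_le h3)

lemma isTab_dl {n : ℕ} (hn : n < 7) : IsTab (dl k w n) (atm k w (R n)) (DT n) := by
  refine (isTab_dlT hw n).congr ?_ fun _ => DT_of_le hn
  have : ((List.range 7).all fun n => (List.range (R (n + 1))).all fun G => eqv (dlT n G) (DT n G)) =
    true := by decide +kernel
  exact List.all_eq_true.1 this n (List.mem_range.2 hn)

end

/-- Whether a combination of words is a coboundary, with a given witness. -/
noncomputable def isRel (p : Wcomb × Comb) : Bool :=
  match dgW ((p.1.map Prod.snd).headD []) with
  | 0 => relOK₀ p.1
  | n + 1 => Nat.ble n 6 && relOK n p.1 p.2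

/-- The graded commutators of the generators. -/
noncomputable def com (i j : ℕ) : Wcomb := [(1, [i, j]), (-(-1) ^ (dg i * dg j), [j, i])]

/-- The cochains whose coboundaries are the commutators. -/
noncomputable def comWit (i j : ℕ) : Comb :=
  comTab.foldr (fun p l => bif Nat.beq p.1 i && Nat.beq p.2.1 j then p.2.2 else l) []

lemma isRel_relTab : (relTab.all isRel) = true := by decide +kernel

lemma isRel_com : ((List.range 14).all fun j => (List.range j).all fun i =>
    isRel (com i j, comWit i j)) = true := by decide +kernel

lemma isRel_sq : ([3, 4, 5, 6, 7, 12].all fun i =>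
    isRel ([(1, [i, i])], bif Nat.beq i 12 then [(2, 37)] else [])) = true := by decide +kernel

section Words

variable {k : Type} [Field k] {A : Type} [Ring A] [Algebra k A] {w : ℕ → A}

/-- The lifts of the generators to chain maps. -/
noncomputable def ps (k : Type) [Field k] {A : Type} [Ring A] [Algebra k A] (w : ℕ → A) (i j : ℕ) :
    Fr k A (R (dg i + j)) →ₗ[Env k A] Fr k A (R j) :=
  mapOf _ fun G => ev (atm k w (R j)) (LT i j G)

lemma isTab_ps (i j : ℕ) : IsTab (ps k w i j) (atm k w (R j)) (LT i j) :=
  isTab_mapOf fun G hG => by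
    rw [LT, Nat.ble_eq_true_of_le hG]
    rfl

lemma check_ps : ((List.range 14).all fun i => (List.range (lv i)).all fun j =>
    (List.range (R (dg i + (j + 1)))).all fun G =>
      eqv (app acF (DT j) (LT i (j + 1) G)) (app acF (LT i j) (DT (dg i + j) G))) = true := by
  decide +kernel

lemma lv_lt : ∀ i < 14, dg i + lv i < 8 ∧ lv i < 5 := by decide +kernel

lemma dl_ps (hw : IsFK k w) {i j : ℕ} (hi : i < 14) (hj : j < lv i) :
    dl k w j ∘ₗ ps k w i (j + 1) = ps k w i j ∘ₗ dl k w (dg i + j) := by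
  have := lv_lt i hi
  refine ((isTab_ps i (j + 1)).comp (isTab_dl hw (by omega)) (isAct_atm hw _)).ext
    ((isTab_dl hw (by omega)).comp (isTab_ps i j) (isAct_atm hw _)) ?_
  exact List.all_eq_true.1 (List.all_eq_true.1 check_ps i (List.mem_range.2 hi)) j
    (List.mem_range.2 hj)

variable [Module (Env k A) A] [IsScalarTower k (Env k A) A]
  {H : Type*} [Ring H] [Algebra k H] {rp : ∀ n, (Fr k A (R n) →ₗ[Env k A] A) → H → Prop}

/-- The generators of the cohomology ring. -/
def IsGen (k : Type) [Field k] {A : Type} [Ring A] [Algebra k A] (w : ℕ → A) [Module (Env k A) A]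
    {H : Type*} (rp : ∀ n, (Fr k A (R n) →ₗ[Env k A] A) → H → Prop) (ξ : ℕ → H) : Prop :=
  ∀ i < 14, rp (dg i) (eps k w ∘ₗ ps k w i 0) (ξ i)

variable (hw : IsFK k w) (hA : ∀ x y m : A, (x ⊗ₜ[k] .op y : Env k A) • m = x * m * y)
  (hH : IsCoh k (P := fun n => Fr k A (R n)) (dl k w) (eps k w) rp)
include hw hA hH

lemma exists_isGen : ∃ ξ : ℕ → H, IsGen k w rp ξ := by
  have h (i : ℕ) : ∃ x : H, i < 14 → rp (dg i) (eps k w ∘ₗ ps k w i 0) x := by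
    rcases lt_or_ge i 14 with hi | hi
    · have h0 : 0 < lv i := (by decide +kernel : ∀ i < 14, 0 < lv i) i hi
      obtain ⟨x, hx⟩ := hH.exists_class (n := dg i) (c := eps k w ∘ₗ ps k w i 0)
        (LinearMap.ext fun x => (congrArg (eps k w) (LinearMap.congr_fun (dl_ps hw hi h0) x)).symm.trans
          (LinearMap.congr_fun (eps_dl hw hA) _))
      exact ⟨x, fun _ => hx⟩
    · exact ⟨0, fun h => absurd hi h.not_ge⟩
  choose ξ hξ using h
  exact ⟨ξ, hξ⟩

variable {ξ : ℕ → H} (hξ : IsGen k w rp ξ)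
include hξ

lemma exists_word (l : List ℕ) (hl : okW l = true) : ∃ c : Fr k A (R (dgW l)) →ₗ[Env k A] A,
    IsTab c w (cwT l) ∧ rp (dgW l) c (l.map ξ).prod := by
  induction l with
  | nil => exact ⟨eps k w, isTab_eps w, hH.one⟩
  | cons i l ih =>
    have h : (bif Nat.ble i 13 then bif Nat.ble (dgW l) (lv i) then okW l else false else false) =
      true := hl
    cases h1 : Nat.ble i 13 with
    | false => simp [h1] at h
    | true =>
    cases h2 : Nat.ble (dgW l) (lv i) with
    | false => simp [h1, h2] at h
    | true =>
    rw [h1, h2] at h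
    obtain ⟨c, hc, hx⟩ := ih h
    have hi : i < 14 := Nat.lt_succ_of_le (Nat.le_of_ble_eq_true h1)
    refine ⟨c ∘ₗ ps k w i (dgW l), (isTab_ps i _).comp hc (isAct_self hw hA), ?_⟩
    rw [List.map_cons, List.prod_cons]
    exact hH.mul (hξ i hi) hx (ps k w i) rfl
      fun j hj => dl_ps hw hi (hj.trans_le (Nat.le_of_ble_eq_true h2))

lemma exists_evW {n : ℕ} {r : Wcomb} (hr : (r.all fun p => okW p.2 && Nat.beq (dgW p.2) n) = true) :
    ∃ c : Fr k A (R n) →ₗ[Env k A] A, IsTab c w (cT' r) ∧ rp n c (evW ξ r) := by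
  induction r with
  | nil => exact ⟨0, IsTab.zero, hH.zero n⟩
  | cons p r ih =>
    rw [List.all_cons, Bool.and_eq_true, Bool.and_eq_true] at hr
    obtain ⟨⟨h1, h2⟩, h3⟩ := hr
    obtain rfl := Nat.eq_of_beq_eq_true h2
    obtain ⟨c, hc, hx⟩ := exists_word hw hA hH hξ p.2 h1
    obtain ⟨c', hc', hx'⟩ := ih h3
    refine ⟨p.1 • c + c', (hc.zsmul p.1).add hc', ?_⟩
    exact hH.add (hH.zsmul p.1 hx) hx'

lemma evW_eq_zero {n : ℕ} (hn : n < 7) {r : Wcomb} {b : Comb} (h : relOK n r b = true) :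
    evW ξ r = 0 := by
  unfold relOK at h
  rw [Bool.and_eq_true] at h
  obtain ⟨c, hc, hx⟩ := exists_evW hw hA hH hξ h.1
  have hb : IsTab (mapOf (k := k) (A := A) (R n) fun G => ev w (cT (R n) b G)) w (cT (R n) b) :=
    isTab_mapOf fun G hG => by
      rw [cT, Nat.ble_eq_true_of_le hG]
      rfl
  have := hc.ext ((isTab_dl hw hn).comp hb (isAct_self hw hA)) h.2
  rw [this] at hx
  exact hH.unique hx (hH.coboundary _)

lemma evW_eq_zero_of_deg_zero {r : Wcomb} (h : relOK₀ r = true) : evW ξ r = 0 := by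
  unfold relOK₀ at h
  rw [Bool.and_eq_true] at h
  obtain ⟨c, hc, hx⟩ := exists_evW hw hA hH hξ h.1
  have : c = 0 := hc.ext IsTab.zero ((Bool.and_true _).trans h.2)
  rw [this] at hx
  exact hH.unique hx (hH.zero 0)

lemma evW_eq_zero_of_isRel {p : Wcomb × Comb} (h : isRel p = true) : evW ξ p.1 = 0 := by
  unfold isRel at h
  split at h
  · exact evW_eq_zero_of_deg_zero hw hA hH hξ h
  · rename_i n _
    rw [Bool.and_eq_true] at h
    exact evW_eq_zero hw hA hH hξ (Nat.lt_succ_of_le (Nat.le_of_ble_eq_true h.1)) h.2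

lemma evW_relTab {p : Wcomb × Comb} (hp : p ∈ relTab) : evW ξ p.1 = 0 :=
  evW_eq_zero_of_isRel hw hA hH hξ (List.all_eq_true.1 isRel_relTab p hp)

lemma evW_com {i j : ℕ} (hj : j < 14) (hi : i < j) : evW ξ (com i j) = 0 :=
  evW_eq_zero_of_isRel hw hA hH hξ (p := (com i j, comWit i j)) (List.all_eq_true.1
    (List.all_eq_true.1 isRel_com j (List.mem_range.2 hj)) i (List.mem_range.2 hi))

lemma sq_eq_zero {i : ℕ} (hi : i ∈ [3, 4, 5, 6, 7, 12]) : ξ i * ξ i = 0 := by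
  have := evW_eq_zero_of_isRel hw hA hH hξ (List.all_eq_true.1 isRel_sq i hi)
  simpa [evW] using this

end Words
end FKH

/-! ### Cohomology of the Koszul cochains -/

namespace FKH

/-- Words whose classes span the cohomology modulo the periodicity generator. -/
noncomputable def nwTab : List (List (List ℕ)) :=
  [[[], [0], [1], [2]],
   [[3], [4], [5], [6], [7], [0, 7], [1, 7]],
   [[8], [9], [10], [11], [0, 8], [0, 9], [2, 11], [3, 7], [4, 7], [5, 7]],
   [[12], [3, 11], [4, 11], [5, 11], [7, 11], [5, 10], [7, 10], [4, 9], [3, 9], [7, 9], [3, 8],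
    [7, 8]],
   [[8, 8], [8, 9], [8, 11], [9, 9], [10, 10], [3, 7, 8], [3, 7, 9], [3, 7, 11], [4, 7, 9],
    [5, 7, 10]],
   [[3, 8, 8], [3, 8, 9], [3, 8, 11], [4, 9, 9], [5, 10, 10], [7, 8, 8], [7, 8, 9], [7, 8, 11],
    [7, 9, 9], [7, 10, 10]]]

/-- A contraction of the Koszul cochains onto the classes, scaled by `12`. -/
noncomputable def sTab : List (List Comb) :=
  [[],
   [[], [], [], [], [], [(12, 3)], [(12, 1), (-12, 2)], [], [], [(6, 5)], [], [(6, 10)], [],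
    [], [], [], [], [], [], [], [], [], [(-6, 4), (6, 5)], [(6, 9)], [], [], [], [], [],
    [(-12, 1)], [], [], [], [(-6, 4)], [(6, 4)], [(-6, 8)]],
   [[], [], [], [], [], [(-12, 2), (12, 3)], [], [], [(12, 4), (-12, 18), (6, 28), (-6, 30)],
    [(12, 4), (12, 7), (-6, 16), (6, 17), (12, 18), (6, 19), (-12, 28), (-12, 31)], [], [], [],
    [], [(-6, 0), (6, 12)], [], [], [], [], [(-12, 13), (12, 15)], [], [], [], [], [], [], [],
    [(6, 24)], [(-24, 2), (-24, 13), (-12, 25), (-12, 26)], [], [], [(12, 2), (12, 13),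
    (12, 26)], [], [], [(-6, 16), (-6, 17), (6, 19), (-6, 28), (6, 30), (-12, 31)], [], [], [],
    [], [(12, 0)], [], [], [(-12, 2)], [], [(3, 16), (3, 17), (-3, 19), (9, 28), (-3, 30),
    (6, 31)], [(6, 16), (6, 19)], [(-3, 16), (3, 17), (12, 18), (3, 19), (-9, 28), (3, 30),
    (-6, 31)], [(-6, 8)], [], [], [], [], [(-12, 13)], [(-12, 14)], [(-12, 27)], [], [(3, 16),
    (3, 17), (-3, 19), (3, 28), (3, 30), (6, 31)], [(-6, 17)], [(3, 16), (-3, 17), (-3, 19),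
    (-3, 28), (-3, 30), (-6, 31)], [(6, 8)]],
   [[], [], [], [], [], [(12, 3), (6, 50)], [(12, 1), (-12, 2), (6, 50)], [], [(-4, 4), (8, 7),
    (4, 30), (-20, 41), (8, 55)], [(-12, 30), (12, 41)], [], [(6, 10)], [], [], [], [],
    [(12, 1), (-12, 13), (6, 50)], [], [], [(12, 15), (6, 37), (6, 38), (6, 49)], [(-8, 4),
    (-8, 7), (12, 16), (8, 30), (20, 41), (-8, 55)], [], [(8, 4), (8, 7), (-12, 16), (12, 17),
    (-8, 30), (-8, 41), (8, 55)], [(6, 21)], [], [], [], [], [(-12, 25), (12, 26), (6, 37),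
    (-6, 38), (6, 49), (-6, 50)], [(-12, 26), (-6, 37), (6, 38), (-6, 49)], [], [], [],
    [(12, 4), (12, 7), (-12, 29), (12, 30)], [(4, 4), (4, 7), (-12, 29), (-4, 30), (8, 41),
    (-8, 55)], [(-6, 32)], [], [], [], [(-6, 48)], [(-6, 37)], [(-6, 38), (-6, 49)], [(-6, 38),
    (6, 49)], [], [(-4, 4), (-4, 7), (4, 30), (4, 41), (-4, 55)], [], [], [(6, 22)], [], [],
    [], [(6, 48)], [], [], [(-6, 50)], [], [(4, 4), (4, 7), (8, 30), (-4, 41), (4, 55)],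
    [(-12, 40)], [(8, 4), (8, 7), (4, 30), (4, 41), (-4, 55)], [(6, 33)], [], [], [], [], [],
    [(6, 51)], [], [(-12, 1), (-6, 50), (-6, 51)], [(12, 40), (12, 43)], [(12, 41)], [(4, 4),
    (4, 7), (-4, 30), (-4, 41), (4, 55)], [(-6, 20)]],
   [[], [(6, 0)], [], [], [(-12, 3), (4, 38), (-8, 49), (-4, 61), (-4, 62)], [], [(12, 2),
    (12, 3), (-8, 38), (16, 49), (8, 61), (8, 62)], [], [(12, 4), (6, 43), (6, 53), (-6, 66)],
    [(12, 4), (12, 7), (-6, 43), (6, 53), (-6, 66)], [], [], [], [], [(6, 12)], [], [(12, 13),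
    (8, 38), (-4, 49), (4, 61), (4, 62)], [], [], [(12, 15), (8, 38), (-4, 49), (4, 61),
    (4, 62)], [(12, 18), (6, 43), (6, 53), (-6, 64)], [], [(12, 17), (12, 18), (6, 43),
    (-6, 53), (-6, 64)], [], [], [], [], [(6, 24)], [(-12, 25), (4, 38), (4, 49), (8, 61),
    (8, 62)], [], [(-12, 26), (4, 38), (4, 49), (8, 61), (8, 62)], [], [], [(12, 30), (12, 31),
    (6, 52), (6, 53), (-6, 55), (6, 64), (-18, 66)], [(-12, 31), (-6, 52), (-6, 53), (6, 55),
    (-6, 64), (6, 66)], [], [], [(6, 36)], [(6, 48)], [(6, 60)], [(8, 38), (8, 49), (4, 61),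
    (4, 62)], [(4, 38), (4, 49), (8, 61), (-4, 62)], [], [], [], [], [], [], [], [], [], [],
    [(-12, 27)], [(-8, 38), (4, 49), (-4, 61), (-4, 62)], [(4, 38), (4, 49), (8, 61), (8, 62)],
    [(-12, 37)], [(6, 64)], [(6, 52), (6, 55)], [(-6, 43)], [(-24, 45)], [], [], [], [], [],
    [], [], [], [(6, 66)], [(-6, 53)], [(6, 52), (-6, 55), (-6, 66)], [(-12, 45)]],
   [[], [], [], [], [], [(12, 3), (6, 62)], [(-12, 2), (-6, 50), (-6, 51), (-6, 63)], [],
    [(-24, 5), (24, 7), (-8, 42), (-20, 43), (-8, 64), (8, 67)], [(12, 5), (12, 42),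
    (-12, 43)], [(12, 65), (-24, 66)], [(6, 10)], [], [], [], [], [(-12, 13), (-6, 50),
    (-6, 51), (-6, 63)], [], [], [(12, 15), (6, 49), (6, 50), (6, 61)], [(-12, 18), (8, 42),
    (8, 43), (-4, 64), (4, 67)], [(-36, 65), (-12, 66)], [(12, 5), (-12, 7), (12, 17),
    (12, 18), (-8, 42), (16, 43), (16, 64), (-4, 67)], [(6, 21)], [], [], [], [], [(12, 25),
    (-12, 26), (-6, 49), (6, 50), (-6, 61), (6, 62)], [(12, 26), (6, 49), (6, 50), (12, 51),
    (6, 61), (12, 63)], [], [], [(24, 65), (36, 66)], [(12, 5), (-12, 7), (12, 29), (12, 42),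
    (12, 43), (12, 64)], [(12, 31), (-4, 42), (-16, 43), (8, 64), (4, 67)], [(6, 32),
    (-12, 44)], [], [], [], [(6, 48)], [(-6, 49)], [(-6, 50), (-6, 61)], [(-6, 50), (6, 61)],
    [], [(-12, 5), (12, 7), (4, 42), (-20, 43), (-8, 64), (8, 67)], [], [(-12, 66)], [(6, 46)],
    [], [], [], [(-6, 48)], [], [], [(-6, 62)], [], [(-4, 42), (8, 43), (-4, 64), (4, 67)], [],
    [(12, 5), (-12, 7), (-8, 42), (28, 43), (16, 64), (-4, 67)], [(6, 45)], [], [], [], [], [],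
    [(6, 63)], [], [(6, 50), (6, 51)], [(12, 65), (12, 66)], [(12, 5), (-12, 7), (24, 43),
    (12, 64)], [(-4, 42), (-4, 43), (8, 64), (4, 67)], [(-6, 44)]]]

/-- The coordinates of the classes of Koszul cochains, scaled by `12`. -/
noncomputable def taTab : List (List Comb) :=
  [[[(12, 0)], [], [], [], [], [], [(12, 1)], [(12, 2)], [], [], [], [(12, 3)]],
   [[], [(12, 4)], [], [], [], [], [], [], [], [(-6, 3)], [(12, 0)], [], [], [], [], [], [],
    [], [], [], [(6, 3), (6, 6)], [(12, 1)], [(6, 5), (-6, 6)], [], [], [], [], [], [], [], [],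
    [], [(12, 2)], [(6, 5)], [(-6, 3), (6, 5), (-6, 6)]],
   [[(12, 0)], [], [], [], [], [(12, 4)], [(12, 4)], [], [], [], [], [(12, 7)], [(12, 1)], [],
    [], [], [], [], [(12, 5)], [(24, 5)], [], [], [], [(12, 8)], [(12, 2)], [], [], [],
    [(24, 4), (24, 5)], [], [], [(-12, 4), (-12, 5)], [], [], [], [(-12, 9)], [(12, 3)], [],
    [], [], [], [], [(12, 4)], [], [], [], [], [(6, 6)], [], [], [], [], [(12, 5)], [], [], [],
    [], [], [], [(6, 6)]],
   [[], [(6, 0), (-6, 6), (-6, 9), (6, 11)], [], [], [], [], [], [], [(8, 1), (-16, 2),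
    (4, 3)], [(-12, 1), (-12, 3)], [(12, 10)], [], [], [], [(6, 0), (6, 6), (6, 9), (-6, 11)],
    [], [], [], [], [], [(-8, 1), (16, 2), (8, 3)], [(12, 7)], [(8, 1), (-4, 2), (-8, 3)], [],
    [], [], [], [], [], [], [], [], [(12, 5)], [(12, 1), (12, 2), (12, 3)], [(4, 1), (4, 2),
    (8, 3)], [], [], [], [], [(6, 4)], [], [], [], [], [(-4, 1), (-4, 2), (4, 3)], [],
    [(12, 8)], [], [], [], [(12, 6)], [(6, 4)], [], [], [], [], [(4, 1), (4, 2), (8, 3)],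
    [(12, 8)], [(8, 1), (8, 2), (4, 3)], [], [], [], [], [(-6, 0), (-6, 6), (6, 9), (6, 11)],
    [], [], [], [], [(-12, 8)], [(12, 2)], [(4, 1), (-8, 2), (-4, 3)]],
   [[(12, 0)], [], [], [], [], [], [], [], [], [], [], [(12, 5)], [(12, 3)], [], [], [], [],
    [], [], [], [], [], [], [(12, 8)], [(12, 4)], [], [], [], [], [], [], [], [], [], [],
    [(-12, 9)], [(12, 1)], [], [], [], [], [], [], [], [], [], [], [(12, 6)], [], [], [], [],
    [], [], [], [], [], [], [], [(6, 7)], [(12, 2)], [], [], [], [], [], [], [], [], [], [],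
    [(6, 7)]],
   [[], [(12, 5), (-12, 6)], [], [], [], [], [], [], [(-12, 2)], [], [(12, 0)], [], [], [],
    [(12, 6), (12, 8), (-12, 9)], [], [], [], [], [], [], [(12, 3)], [(12, 2)], [], [], [], [],
    [], [], [], [], [], [(-24, 1), (-12, 4)], [(12, 2)], [], [], [], [], [], [(6, 7)], [], [],
    [], [], [(-12, 2)], [], [(12, 1)], [], [], [], [(24, 6), (-12, 9)], [(6, 7)], [], [], [],
    [], [], [(12, 1)], [(12, 2)], [], [], [], [], [(-12, 6), (12, 9)], [], [], [], [],
    [(-12, 1)], [(12, 2)]]]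

/-- The number of classes in each degree. -/
def hN : ℕ → ℕ
  | 0 => 4
  | 1 => 7
  | 2 => 10
  | 3 => 12
  | _ + 4 => 10

/-- The combination of coded elementary cochains with a given table. -/
noncomputable def cod (r : ℕ) (T : ℕ → Comb) : Comb :=
  (List.range r).flatMap fun G => fm (T G) (fun c a l => (c, Nat.add (Nat.mul 12 G) a) :: l) []

/-- The table of the coboundary of an elementary Koszul cochain. -/
noncomputable def bdT (n x : ℕ) (G : ℕ) : Comb := app acA (cT (rk n) [(1, x)]) (dT (n + 1) G)

/-- The coboundary of an elementary Koszul cochain. -/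
noncomputable def bd (n x : ℕ) : Comb :=
  bif Nat.ble (12 * rk n) x then [] else cod (rk (n + 1)) (bdT n x)

/-- The Koszul part of the cochain of a word. -/
noncomputable def tw (n i : ℕ) : Comb :=
  bif Nat.ble (hN n) i then [] else cod (rk n) (cwT (gD (gD nwTab n) i))

/-- The scaled contraction. -/
noncomputable def sT (n x : ℕ) : Comb :=
  bif Nat.ble (12 * rk n) x then [] else gD (gD sTab (bif Nat.beq n 6 then 4 else n)) x

/-- The scaled coordinates of a class. -/
noncomputable def ta (n x : ℕ) : Comb :=
  bif Nat.ble (12 * rk n) x then [] else gD (gD taTab n) x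

lemma check_bd : ((List.range 6).all fun n => (List.range (12 * rk n)).all fun x =>
    (List.range (rk (n + 1))).all fun G => eqv (bdT n x G) (cT (rk (n + 1)) (bd n x) G)) = true := by
  decide +kernel

lemma check_tw : ((List.range 6).all fun n => (List.range (hN n)).all fun i =>
    okW (gD (gD nwTab n) i) && Nat.beq (dgW (gD (gD nwTab n) i)) n && (List.range (rk n)).all fun G =>
      eqv (cwT (gD (gD nwTab n) i) G) (cT (rk n) (tw n i) G)) = true := by
  decide +kernel

lemma check_contraction : ((List.range 6).all fun n => (List.range (12 * rk n)).all fun x =>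
    eqv [(12, x)] (bnd (tw n) (ta n x) ++
      (bnd (bd (n - 1)) (sT n x) ++ bnd (sT (n + 1)) (bd n x)))) = true := by
  decide +kernel

lemma check_ta_tw : ((List.range 6).all fun n => (List.range (hN n)).all fun i =>
    eqv (bnd (ta n) (tw n i)) [(12, i)]) = true := by
  decide +kernel

lemma check_ta_bd : ((List.range 5).all fun n => (List.range (12 * rk n)).all fun x =>
    eqv (bnd (ta (n + 1)) (bd n x)) []) = true := by
  decide +kernel

lemma ble_false {a b : ℕ} (h : b < a) : Nat.ble a b = false := by
  rw [← Bool.not_eq_true, Nat.ble_eq]; exact not_le.2 h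

section Koszul

variable {k : Type} [Field k] {A : Type} [Ring A] [Algebra k A] {w : ℕ → A}
  [Module (Env k A) A]

/-- The elementary cochains. -/
noncomputable def cat (k : Type) [Field k] {A : Type} [Ring A] [Algebra k A] (w : ℕ → A)
    [Module (Env k A) A] (r x : ℕ) : Fr k A r →ₗ[Env k A] A :=
  mapOf r fun G => ev w (cT r [(1, x)] G)

lemma cT_of_le {r G : ℕ} (b : Comb) (h : r ≤ G) : cT r b G = [] := by
  rw [cT, Nat.ble_eq_true_of_le h]
  rfl

lemma isTab_cat (r x : ℕ) : IsTab (cat k w r x) w (cT r [(1, x)]) :=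
  isTab_mapOf fun _ hG => cT_of_le _ hG

lemma isTab_ev_cat (r : ℕ) (b : Comb) : IsTab (ev (cat k w r) b) w (cT r b) := fun G => by
  rcases lt_or_ge G r with hG | hG
  · have hG' : Nat.ble r G = false := ble_false hG
    have h (x : ℕ) : cat k w r x (gen k A r G) = bif Nat.beq (Nat.div x 12) G then w (x % 12) else 0 := by
      rw [isTab_cat r x G, cT, hG']
      show ev w (bif Nat.beq (Nat.div x 12) G then _ else _) = _
      cases Nat.beq (Nat.div x 12) G
      · rfl
      · exact (add_zero _).trans (one_smul _ _)
    let φ : (Fr k A r →ₗ[Env k A] A) →+ A := AddMonoidHom.mk' (fun f => f (gen k A r G)) fun _ _ => rfl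
    rw [cT, hG', cond_false]
    refine ((ev_fm (φ := φ) (cat k w r) b (e' := w) (fun p _ l => ?_) []).trans (add_zero _)).symm
    show _ = p.1 • cat k w r p.2 (gen k A r G) + _
    rw [h]
    cases Nat.beq (Nat.div p.2 12) G
    · exact ((congrArg (· + _) (smul_zero _)).trans (zero_add _)).symm
    · rfl
  · rw [cT_of_le _ hG, gen_of_le hG, map_zero, ev_nil]

lemma eq_ev_cat {r : ℕ} {f : Fr k A r →ₗ[Env k A] A} {T : ℕ → Comb} (hf : IsTab f w T) (b : Comb)
    (h : ((List.range r).all fun G => eqv (T G) (cT r b G)) = true) : f = ev (cat k w r) b :=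
  hf.ext (isTab_ev_cat r b) h

lemma cat_of_le {r x : ℕ} (h : 12 * r ≤ x) : cat k w r x = 0 :=
  (isTab_cat r x).ext IsTab.zero (List.all_eq_true.2 fun G hG => by
    have hG := List.mem_range.1 hG
    have h1 : Nat.ble r G = false := ble_false hG
    have h2 : Nat.beq (Nat.div x 12) G = false := by
      rw [← Bool.not_eq_true, Nat.beq_eq]
      rintro h
      have : x / 12 = G := h
      omega
    rw [cT, h1]
    show eqv (bif Nat.beq (Nat.div x 12) G then _ else _) _ = _
    rw [h2]; rfl)

/-- The Koszul parts of the classes. -/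
noncomputable def tk (k : Type) [Field k] {A : Type} [Ring A] [Algebra k A] (w : ℕ → A)
    [Module (Env k A) A] : ∀ n, ℕ → (Fr k A (rk n) →ₗ[Env k A] A)
  | n + 6 => tk k w (n + 4)
  | n => fun i => ev (cat k w (rk n)) (tw n i)

lemma tk_of_lt {n : ℕ} (hn : n < 6) (i : ℕ) : tk k w n i = ev (cat k w (rk n)) (tw n i) := by
  interval_cases n <;> rfl

variable [IsScalarTower k (Env k A) A] (hw : IsFK k w) (hA : ∀ x y m : A, (x ⊗ₜ[k] .op y : Env k A) • m = x * m * y)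

section basis
include hw

/-- The elementary cochains form a basis. -/
noncomputable def basC (r : ℕ) : Module.Basis (Σ _ : Fin r, Fin 12) k (Fr k A r →ₗ[Env k A] A) :=
  (Pi.basis fun _ : Fin r => bas hw).map ((Pi.basisFun (Env k A) (Fin r)).constr k)

lemma basC_apply (r : ℕ) (i : Fin r) (a : Fin 12) :
    basC hw r ⟨i, a⟩ = cat k w r (12 * i + a) := by
  refine hom_ext fun G hG => ?_
  have hG' : Nat.ble r G = false := ble_false hG
  have e1 : (12 * i + a : ℕ) / 12 = i := by omega
  have e2 : (12 * i + a : ℕ) % 12 = a := by omega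
  rw [isTab_cat, cT, hG']
  show _ = ev w (bif Nat.beq ((12 * i + a : ℕ) / 12) G then [((1 : ℤ), (12 * i + a : ℕ) % 12)] else [])
  rw [e1, e2, gen, dif_pos hG, basC, Module.Basis.map_apply, Pi.basis_apply, ← Pi.basisFun_apply,
    Module.Basis.constr_basis]
  by_cases h : (⟨G, hG⟩ : Fin r) = i
  · subst h
    simp [bas_apply]
  · have h' : Nat.beq i G = false := by
      rw [← Bool.not_eq_true, Nat.beq_eq]; rintro rfl; exact h rfl
    simp [h, h']

lemma exists_linearMap_cat {N : Type*} [AddCommGroup N] [Module k N] (r : ℕ) (v : ℕ → N)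
    (hv : ∀ x, 12 * r ≤ x → v x = 0) :
    ∃ h : (Fr k A r →ₗ[Env k A] A) →ₗ[k] N, ∀ x, h (cat k w r x) = v x := by
  refine ⟨(basC hw r).constr k fun i => v (12 * i.1 + i.2), fun x => ?_⟩
  rcases lt_or_ge x (12 * r) with hx | hx
  · have := basC_apply hw r ⟨x / 12, by omega⟩ ⟨x % 12, by omega⟩
    have e : 12 * (x / 12) + x % 12 = x := by omega
    dsimp only at this
    rw [e] at this
    rw [← this, Module.Basis.constr_basis, e]
  · rw [cat_of_le hx, hv x hx, map_zero]

lemma linearMap_cat_ext {N : Type*} [AddCommGroup N] [Module k N] {r : ℕ}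
    {f g : (Fr k A r →ₗ[Env k A] A) →ₗ[k] N}
    (h : ∀ x < 12 * r, f (cat k w r x) = g (cat k w r x)) : f = g :=
  (basC hw r).ext fun ⟨i, a⟩ => by rw [basC_apply]; exact h _ (by omega)

end basis

include hw hA

/-- The coboundary operator on Koszul cochains. -/
noncomputable def dC (k : Type) [Field k] {A : Type} [Ring A] [Algebra k A] (w : ℕ → A)
    [Module (Env k A) A] [IsScalarTower k (Env k A) A] (n : ℕ) :
    (Fr k A (rk n) →ₗ[Env k A] A) →ₗ[k] (Fr k A (rk (n + 1)) →ₗ[Env k A] A) where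
  toFun f := f ∘ₗ dK k w n
  map_add' _ _ := rfl
  map_smul' _ _ := rfl

lemma dC_cat {n : ℕ} (hn : n < 6) (x : ℕ) :
    dC k w n (cat k w (rk n) x) = ev (cat k w (rk (n + 1))) (bd n x) := by
  rcases lt_or_ge x (12 * rk n) with hx | hx
  · exact eq_ev_cat ((isTab_dK w n).comp (isTab_cat _ x) (isAct_self hw hA)) _
      (List.all_eq_true.1 (List.all_eq_true.1 check_bd n (List.mem_range.2 hn)) x
        (List.mem_range.2 hx))
  · rw [cat_of_le hx, bd, Nat.ble_eq_true_of_le hx, map_zero]; rfl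

lemma dC_ev {n : ℕ} (hn : n < 6) (b : Comb) :
    dC k w n (ev (cat k w (rk n)) b) = ev (cat k w (rk (n + 1))) (bnd (bd n) b) :=
  map_ev_bnd (φ := (dC k w n).toAddMonoidHom) _ b (dC_cat hw hA hn)

omit hA in
lemma exists_coord (n : ℕ) : ∃ τ : (Fr k A (rk n) →ₗ[Env k A] A) →ₗ[k] (ℕ → k),
    ∀ x, τ (cat k w (rk n) x) = ev (fun i => Pi.single i 1) (ta n x) :=
  exists_linearMap_cat hw (rk n) (fun x => ev (fun i => Pi.single i (1 : k)) (ta n x))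
    fun x hx => by rw [ta, Nat.ble_eq_true_of_le hx]; rfl

omit hA in
lemma exists_contr (n m : ℕ) :
    ∃ s : (Fr k A (rk n) →ₗ[Env k A] A) →ₗ[k] (Fr k A (rk m) →ₗ[Env k A] A),
      ∀ x, s (cat k w (rk n) x) = ev (cat k w (rk m)) (sT n x) :=
  exists_linearMap_cat hw (rk n) (fun x => ev (cat k w (rk m)) (sT n x))
    fun x hx => by rw [sT, Nat.ble_eq_true_of_le hx]; rfl

variable (k) in
omit hw hA [IsScalarTower k (Env k A) A] in
lemma invertible_twelve (h2 : (2 : k) ≠ 0) (h3 : (3 : k) ≠ 0) : (12 : k) ≠ 0 := by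
  rw [show (12 : k) = 2 * 2 * 3 by norm_num]
  exact mul_ne_zero (mul_ne_zero h2 h2) h3

variable (h2 : (2 : k) ≠ 0) (h3 : (3 : k) ≠ 0)
include h2 h3

lemma contraction {n : ℕ} (hn : n < 6)
    (D : (Fr k A (rk (n - 1)) →ₗ[Env k A] A) →ₗ[k] (Fr k A (rk n) →ₗ[Env k A] A))
    (hD : ∀ x, D (ev (cat k w (rk (n - 1))) (sT n x)) = ev (cat k w (rk n)) (bnd (bd (n - 1)) (sT n x)))
    (c : Fr k A (rk n) →ₗ[Env k A] A) (hc : dC k w n c = 0) : ∃ (α : ℕ → k) (b : _),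
    c = ∑ i ∈ Finset.range (hN n), α i • tk k w n i + D b := by
  obtain ⟨τ, hτ⟩ := exists_coord hw n
  obtain ⟨s, hs⟩ := exists_contr hw n (n - 1)
  obtain ⟨s', hs'⟩ := exists_contr hw (n + 1) n
  let T : (ℕ → k) →ₗ[k] (Fr k A (rk n) →ₗ[Env k A] A) :=
    ∑ i ∈ Finset.range (hN n), (LinearMap.proj i).smulRight (tk k w n i)
  have hT' (v : ℕ → k) : T v = ∑ i ∈ Finset.range (hN n), v i • tk k w n i := by
    simp only [T, LinearMap.sum_apply, LinearMap.smulRight_apply, LinearMap.proj_apply]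
  have hT (i : ℕ) : T (Pi.single i 1) = ev (cat k w (rk n)) (tw n i) := by
    rw [hT']
    rcases lt_or_ge i (hN n) with hi | hi
    · rw [Finset.sum_eq_single i, Pi.single_eq_same, one_smul, tk_of_lt hn]
      · intro j _ hj
        rw [Pi.single_eq_of_ne hj, zero_smul]
      · intro h
        exact absurd (Finset.mem_range.2 hi) h
    · rw [tw, Nat.ble_eq_true_of_le hi, Finset.sum_eq_zero]
      · rfl
      · intro j hj
        rw [Pi.single_eq_of_ne ((Finset.mem_range.1 hj).trans_le hi).ne, zero_smul]
  have key : (12 : k) • LinearMap.id = T ∘ₗ τ + (D ∘ₗ s + s' ∘ₗ dC k w n) := by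
    refine linearMap_cat_ext hw fun x hx => ?_
    have h := ev_congr (cat k w (rk n)) (List.all_eq_true.1 (List.all_eq_true.1 check_contraction n
      (List.mem_range.2 hn)) x (List.mem_range.2 hx))
    rw [ev_append, ev_append, ← hD, ← map_ev_bnd (φ := T.toAddMonoidHom) _ (ta n x) hT,
      ← map_ev_bnd (φ := s'.toAddMonoidHom) _ (bd n x) hs', ← dC_cat hw hA hn, ← hτ, ← hs] at h
    refine Eq.trans ?_ (((add_zero _).symm.trans h).trans ?_)
    · show (12 : k) • cat k w (rk n) x = (12 : ℤ) • cat k w (rk n) x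
      rw [← Int.cast_smul_eq_zsmul k]
      norm_num
    · rfl
  have h12 := invertible_twelve k h2 h3
  have hk := LinearMap.congr_fun key c
  refine ⟨(12 : k)⁻¹ • τ c, (12 : k)⁻¹ • s c, ?_⟩
  rw [← hT', map_smul, map_smul, ← smul_add, eq_inv_smul_iff₀ h12]
  refine hk.trans (congrArg (T (τ c) + ·) ?_)
  show D (s c) + s' (dC k w n c) = D (s c)
  rw [hc, map_zero, add_zero]

omit hA in
lemma eq_zero_of_sum_tk {n : ℕ} (hn : n < 6) (y : Fr k A (rk n) →ₗ[Env k A] A)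
    (hy : ∀ τ : (Fr k A (rk n) →ₗ[Env k A] A) →ₗ[k] (ℕ → k),
      (∀ x, τ (cat k w (rk n) x) = ev (fun i => Pi.single i 1) (ta n x)) → τ y = 0)
    {α : ℕ → k} (h : ∑ i ∈ Finset.range (hN n), α i • tk k w n i = y) {i : ℕ} (hi : i < hN n) :
    α i = 0 := by
  obtain ⟨τ, hτ⟩ := exists_coord hw n
  have h0 := hy τ hτ
  have ht (j : ℕ) (hj : j < hN n) : τ (tk k w n j) = (12 : k) • Pi.single j 1 := by
    have h1 := ev_congr (fun i => (Pi.single i 1 : ℕ → k)) (List.all_eq_true.1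
      (List.all_eq_true.1 check_ta_tw n (List.mem_range.2 hn)) j (List.mem_range.2 hj))
    rw [← map_ev_bnd (φ := τ.toAddMonoidHom) _ (tw n j) hτ, ← tk_of_lt hn] at h1
    refine (h1.trans (add_zero _)).trans ?_
    show (12 : ℤ) • (Pi.single j 1 : ℕ → k) = _
    rw [← Int.cast_smul_eq_zsmul k]
    norm_num
  rw [← h, map_sum] at h0
  have h1 := congrFun h0 i
  rw [Finset.sum_apply, Finset.sum_eq_single i] at h1
  · rw [map_smul, ht i hi] at h1
    simpa [invertible_twelve k h2 h3] using h1
  · intro j hj hji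
    rw [map_smul, ht j (Finset.mem_range.1 hj)]
    simp [Pi.single_eq_of_ne hji.symm]
  · intro hh
    exact absurd (Finset.mem_range.2 hi) hh

lemma exists_sum_tk_zero (c : Fr k A (rk 0) →ₗ[Env k A] A) (hc : c ∘ₗ dK k w 0 = 0) :
    ∃ α : ℕ → k, c = ∑ i ∈ Finset.range (hN 0), α i • tk k w 0 i := by
  obtain ⟨α, b, h⟩ := contraction hw hA h2 h3 (n := 0) (by norm_num) 0 (fun x => by
    have : sT 0 x = [] := by
      unfold sT
      cases Nat.ble (12 * rk 0) x <;> rfl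
    rw [this]; rfl) c hc
  exact ⟨α, h.trans (add_zero _)⟩

lemma exists_sum_tk (n : ℕ) (c : Fr k A (rk (n + 1)) →ₗ[Env k A] A) (hc : c ∘ₗ dK k w (n + 1) = 0) :
    ∃ (α : ℕ → k) (b : Fr k A (rk n) →ₗ[Env k A] A),
      c = ∑ i ∈ Finset.range (hN (n + 1)), α i • tk k w (n + 1) i + b ∘ₗ dK k w n := by
  induction n using Nat.strong_induction_on with
  | _ n ih =>
  rcases lt_or_ge n 5 with hn | hn
  · exact contraction hw hA h2 h3 (n := n + 1) (by omega) (dC k w n)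
      (fun x => dC_ev hw hA (by omega) _) c hc
  · obtain ⟨n, rfl⟩ := Nat.exists_eq_add_of_le' hn
    have e1 : dK k w (n + 5 + 1) = dK k w (n + 3 + 1) := dK_add_two w (n + 1)
    have e2 : dK k w (n + 5) = dK k w (n + 3) := dK_add_two w n
    rw [e1] at hc
    rw [e2]
    exact ih (n + 3) (by omega) c hc

omit h2 h3 in
lemma coord_dC {n : ℕ} (hn : n < 5) (τ : (Fr k A (rk (n + 1)) →ₗ[Env k A] A) →ₗ[k] (ℕ → k))
    (hτ : ∀ x, τ (cat k w (rk (n + 1)) x) = ev (fun i => Pi.single i 1) (ta (n + 1) x)) :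
    τ ∘ₗ dC k w n = 0 :=
  linearMap_cat_ext hw fun x hx => by
    rw [LinearMap.comp_apply, dC_cat hw hA (by omega)]
    refine (map_ev_bnd (φ := τ.toAddMonoidHom) _ (bd n x) hτ).trans ?_
    exact ev_congr _ (List.all_eq_true.1 (List.all_eq_true.1 check_ta_bd n (List.mem_range.2 hn)) x
      (List.mem_range.2 hx))

omit hA in
lemma tk_indep_zero {α : ℕ → k} (h : ∑ i ∈ Finset.range (hN 0), α i • tk k w 0 i = 0) {i : ℕ}
    (hi : i < hN 0) : α i = 0 :=
  eq_zero_of_sum_tk hw h2 h3 (by norm_num) 0 (fun τ _ => map_zero τ) h hi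

lemma tk_indep (n : ℕ) {α : ℕ → k} (b : Fr k A (rk n) →ₗ[Env k A] A)
    (h : ∑ i ∈ Finset.range (hN (n + 1)), α i • tk k w (n + 1) i = b ∘ₗ dK k w n) {i : ℕ}
    (hi : i < hN (n + 1)) : α i = 0 := by
  induction n using Nat.strong_induction_on with
  | _ n ih =>
  rcases lt_or_ge n 5 with hn | hn
  · exact eq_zero_of_sum_tk hw h2 h3 (by omega) _
      (fun τ hτ => LinearMap.congr_fun (coord_dC hw hA hn τ hτ) b) h hi
  · obtain ⟨n, rfl⟩ := Nat.exists_eq_add_of_le' hn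
    have e2 : dK k w (n + 5) = dK k w (n + 3) := dK_add_two w n
    rw [e2] at h
    exact ih (n + 3) (by omega) b h hi

end Koszul
end FKH

/-! ### Additive structure of the cohomology ring -/

namespace FKH

/-- The classes spanning a complement of the multiples of the periodicity generator. -/
noncomputable def nyE {S : Type*} [Ring S] (X : ℕ → S) : ℕ → ℕ → S
  | n + 6, j => (X 8 + X 9 - X 10) * nyE X (n + 4) j
  | n, j => ((gD (gD nwTab n) j).map X).prod

lemma nyE_of_lt {S : Type*} [Ring S] (X : ℕ → S) {n : ℕ} (hn : n < 6) (j : ℕ) :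
    nyE X n j = ((gD (gD nwTab n) j).map X).prod := by
  interval_cases n <;> rfl

section
variable {k : Type} [Field k] {A : Type} [Ring A] [Algebra k A] {w : ℕ → A}
  [Module (Env k A) A] [IsScalarTower k (Env k A) A]
  {H : Type*} [Ring H] [Algebra k H] {rp : ∀ n, (Fr k A (R n) →ₗ[Env k A] A) → H → Prop}
  (hw : IsFK k w) (hA : ∀ x y m : A, (x ⊗ₜ[k] .op y : Env k A) • m = x * m * y)
  (hH : IsCoh k (P := fun n => Fr k A (R n)) (dl k w) (eps k w) rp)
  {ξ : ℕ → H} (hξ : IsGen k w rp ξ)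
include hw hA hH hξ

lemma rp_yK : rp 2 (eps k w ∘ₗ yK k w 0) (ξ 8 + ξ 9 - ξ 10) := by
  obtain ⟨c, hc, hx⟩ := exists_evW hw hA hH hξ (n := 2) (r := [(1, [8]), (1, [9]), (-1, [10])])
    (by decide +kernel)
  have e : eps k w ∘ₗ yK k w 0 = c :=
    ((((isTab_ka hw 2).comp (isTab_thK w 0) (isAct_atm hw _)).comp (isTab_inl hw 0)
      (isAct_atm hw _)).comp (isTab_eps w) (isAct_self hw hA)).ext hc (by decide +kernel)
  have e' : evW ξ [(1, [8]), (1, [9]), (-1, [10])] = ξ 8 + ξ 9 - ξ 10 := by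
    simp [evW]
    abel
  rw [e, ← e']
  exact hx

omit hH [IsScalarTower k (Env k A) A] [Ring H] [Algebra k H] in
lemma rp_pr : rp 4 (eps k w ∘ₗ pr k A 0) (ξ 13) := by
  have e : eps k w ∘ₗ pr k A 0 = eps k w ∘ₗ ps k w 13 0 :=
    ((isTab_pr hw 0).comp (isTab_eps w) (isAct_self hw hA)).ext
      ((isTab_ps 13 0).comp (isTab_eps w) (isAct_self hw hA)) (by decide +kernel)
  rw [e]
  exact hξ 13 (by norm_num)

lemma rp_pr_mul {n : ℕ} {c : Fr k A (R n) →ₗ[Env k A] A} {x : H} (hc : rp n c x) :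
    rp (n + 4) (c ∘ₗ pr k A n) (ξ 13 * x) :=
  hH.mul' (rp_pr hw hA hξ) hc (pr k A) rfl
    fun j _ => LinearMap.ext fun x => (pr_dl w j x).symm

lemma rp_yK_mul {n : ℕ} {c : Fr k A (R n) →ₗ[Env k A] A} {x : H} (hc : rp n c x) :
    rp (n + 2) (c ∘ₗ yK k w n) ((ξ 8 + ξ 9 - ξ 10) * x) :=
  hH.mul' (rp_yK hw hA hH hξ) hc (yK k w) rfl
    fun j _ => (yK_dl hw j).symm

lemma exists_nyE (n j : ℕ) (hj : j < hN n) : ∃ c : Fr k A (R n) →ₗ[Env k A] A,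
    rp n c (nyE ξ n j) ∧ c ∘ₗ inl k A n = tk k w n j := by
  induction n using Nat.strong_induction_on with
  | _ n ih =>
  rcases lt_or_ge n 6 with hn | hn
  · have h := List.all_eq_true.1 (List.all_eq_true.1 check_tw n (List.mem_range.2 hn)) j
      (List.mem_range.2 hj)
    rw [Bool.and_eq_true, Bool.and_eq_true] at h
    obtain ⟨c, hc, hx⟩ := exists_word hw hA hH hξ _ h.1.1
    rw [nyE_of_lt ξ hn, tk_of_lt hn]
    have e := Nat.eq_of_beq_eq_true h.1.2
    generalize gD (gD nwTab n) j = l at *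
    subst e
    refine ⟨c, hx, hom_ext fun G hG => ?_⟩
    rw [LinearMap.comp_apply, inl_gen hG, hc, isTab_ev_cat]
    exact ev_congr w (List.all_eq_true.1 h.2 G (List.mem_range.2 hG))
  · obtain ⟨n, rfl⟩ := Nat.exists_eq_add_of_le' hn
    obtain ⟨c, hc, hi⟩ := ih (n + 4) (by omega) hj
    refine ⟨c ∘ₗ yK k w (n + 4), rp_yK_mul hw hA hH hξ hc, LinearMap.ext fun x => ?_⟩
    refine (congrArg c (yK_inl w (n + 4) x)).trans ((LinearMap.congr_fun hi _).trans ?_)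
    exact congrArg (tk k w (n + 4) j) (LinearMap.congr_fun (thK_add_three hw (n + 1)) x)

lemma exists_sum_nyE (n : ℕ) (α : ℕ → k) : ∃ c : Fr k A (R n) →ₗ[Env k A] A,
    rp n c (∑ i ∈ Finset.range (hN n), α i • nyE ξ n i) ∧
      c ∘ₗ inl k A n = ∑ i ∈ Finset.range (hN n), α i • tk k w n i := by
  have h (j : ℕ) : ∃ c : Fr k A (R n) →ₗ[Env k A] A, j ∈ Finset.range (hN n) →
      rp n c (nyE ξ n j) ∧ c ∘ₗ inl k A n = tk k w n j := by
    by_cases hj : j ∈ Finset.range (hN n)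
    · obtain ⟨c, hc⟩ := exists_nyE hw hA hH hξ n j (Finset.mem_range.1 hj)
      exact ⟨c, fun _ => hc⟩
    · exact ⟨0, fun h => absurd h hj⟩
  choose c hc using h
  refine ⟨∑ i ∈ Finset.range (hN n), α i • c i,
    hH.sum _ fun i hi => hH.smul (α i) (hc i hi).1, LinearMap.ext fun x => ?_⟩
  rw [LinearMap.comp_apply, LinearMap.sum_apply, LinearMap.sum_apply]
  exact Finset.sum_congr rfl fun i hi => congrArg (α i • ·) (LinearMap.congr_fun (hc i hi).2 x)

variable (h2 : (2 : k) ≠ 0) (h3 : (3 : k) ≠ 0)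
include h2 h3

lemma exists_sub_inl_eq_zero {n : ℕ} (c : Fr k A (R (n + 1)) →ₗ[Env k A] A)
    (hc : ∀ x, c (inl k A (n + 1) (dK k w (n + 1) x)) = 0) :
    ∃ (α : ℕ → k) (b : Fr k A (R n) →ₗ[Env k A] A) (c' : Fr k A (R (n + 1)) →ₗ[Env k A] A),
      rp (n + 1) c' (∑ i ∈ Finset.range (hN (n + 1)), α i • nyE ξ (n + 1) i) ∧
        ∀ x, (c - c' - b ∘ₗ dl k w n) (inl k A (n + 1) x) = 0 := by
  obtain ⟨α, b, h⟩ := exists_sum_tk hw hA h2 h3 n (c ∘ₗ inl k A (n + 1)) (LinearMap.ext hc)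
  obtain ⟨c', hc', hi⟩ := exists_sum_nyE hw hA hH hξ (n + 1) α
  refine ⟨α, b ∘ₗ ka k A n, c', hc', fun x => ?_⟩
  have e1 : c (inl k A (n + 1) x) = c' (inl k A (n + 1) x) + b (dK k w n x) :=
    (LinearMap.congr_fun h x).trans (congrArg (· + b (dK k w n x)) (LinearMap.congr_fun hi x).symm)
  have e2 : b (ka k A n (dl k w n (inl k A (n + 1) x))) = b (dK k w n x) :=
    congrArg b ((congrArg (ka k A n) (dl_inl w n x)).trans (ka_inl_apply n _))
  show c (inl k A (n + 1) x) - c' (inl k A (n + 1) x) -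
    b (ka k A n (dl k w n (inl k A (n + 1) x))) = 0
  rw [e1, e2, add_sub_cancel_left, sub_self]

omit hξ hw hA h2 h3 in
lemma apply_inl_dK {n : ℕ} {c : Fr k A (R n) →ₗ[Env k A] A} {x : H} (hc : rp n c x)
    (y : Fr k A (rk (n + 1))) : c (inl k A n (dK k w n y)) = 0 :=
  (congrArg c (dl_inl w n y)).symm.trans (LinearMap.congr_fun (hH.cocycle hc) _)

lemma exists_eq_sum_of_lt {n : ℕ} (hn : n < 4) {c : Fr k A (R n) →ₗ[Env k A] A} {x : H}
    (hc : rp n c x) : ∃ α : ℕ → k, x = ∑ i ∈ Finset.range (hN n), α i • nyE ξ n i := by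
  cases n with
  | zero =>
    obtain ⟨α, h⟩ := exists_sum_tk_zero hw hA h2 h3 (c ∘ₗ inl k A 0)
      (LinearMap.ext fun y => apply_inl_dK hH hc y)
    obtain ⟨c', hc', hi⟩ := exists_sum_nyE hw hA hH hξ 0 α
    have : c = c' := res_ext_of_lt hn (h.trans hi.symm)
    exact ⟨α, hH.unique hc (this ▸ hc')⟩
  | succ n =>
    obtain ⟨α, b, c', hc', hi⟩ := exists_sub_inl_eq_zero hw hA hH hξ h2 h3 c
      fun y => apply_inl_dK hH hc y
    refine ⟨α, ?_⟩
    have h0 := hH.sub (hH.sub hc hc') (hH.coboundary b)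
    have h1 : c - c' - b ∘ₗ dl k w n = 0 := res_ext_of_lt hn (LinearMap.ext hi)
    rw [h1, sub_zero] at h0
    exact sub_eq_zero.1 (hH.unique h0 (hH.zero _))

lemma exists_eq_sum_add {n : ℕ} {c : Fr k A (R (n + 4)) →ₗ[Env k A] A} {x : H}
    (hc : rp (n + 4) c x) : ∃ (α : ℕ → k) (c' : Fr k A (R n) →ₗ[Env k A] A) (x' : H), rp n c' x' ∧
      x = ∑ i ∈ Finset.range (hN (n + 4)), α i • nyE ξ (n + 4) i + ξ 13 * x' := by
  obtain ⟨α, b, c', hc', hi⟩ := exists_sub_inl_eq_zero hw hA hH hξ h2 h3 (n := n + 3) c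
    fun y => apply_inl_dK hH hc y
  have h0 := hH.sub (hH.sub hc hc') (hH.coboundary b)
  generalize c - c' - b ∘ₗ dl k w (n + 3) = e at *
  have he : e = (e ∘ₗ sh k A n) ∘ₗ pr k A n := by
    refine res_ext (LinearMap.ext fun y => ?_) (LinearMap.ext fun y => ?_)
    · exact (hi y).trans ((congrArg (e ∘ₗ sh k A n) (pr_inl_apply n y)).trans (map_zero _)).symm
    · exact (congrArg (e ∘ₗ sh k A n) (pr_sh_apply n y)).symm
  obtain ⟨x', hx'⟩ := hH.exists_class (n := n) (c := e ∘ₗ sh k A n) (LinearMap.ext fun y => by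
    have h1 := LinearMap.congr_fun (hH.cocycle h0) (sh k A (n + 1) y)
    rw [LinearMap.comp_apply] at h1
    have h2 := (LinearMap.congr_fun he _).symm.trans h1
    have h3 : pr k A n (dl k w (n + 4) (sh k A (n + 1) y)) = dl k w n y :=
      (pr_dl w n _).trans (congrArg (dl k w n) (pr_sh_apply (n + 1) y))
    exact (congrArg (e ∘ₗ sh k A n) h3).symm.trans h2)
  refine ⟨α, _, x', hx', ?_⟩
  have h1 := rp_pr_mul hw hA hH hξ hx'
  rw [← he] at h1
  have := hH.unique h0 h1
  rw [sub_zero] at this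
  rw [← this, add_sub_cancel]

lemma eq_zero_of_sum_eq_zero {n : ℕ} (hn : n < 4) {α : ℕ → k}
    (h : ∑ i ∈ Finset.range (hN n), α i • nyE ξ n i = 0) {i : ℕ} (hi : i < hN n) : α i = 0 := by
  obtain ⟨c, hc, hci⟩ := exists_sum_nyE hw hA hH hξ n α
  rw [h] at hc
  cases n with
  | zero =>
    have := hH.eq_zero hc
    refine tk_indep_zero hw h2 h3 (hci.symm.trans ?_) hi
    rw [this]
    exact LinearMap.zero_comp _
  | succ n =>
    obtain ⟨b, rfl⟩ := hH.exists_coboundary hc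
    exact tk_indep hw hA h2 h3 n (b ∘ₗ inl k A n) (hci.symm.trans
      (LinearMap.ext fun y => congrArg b (dl_inl w n y))) hi

lemma eq_zero_of_sum_add_eq_zero {n : ℕ} {α : ℕ → k} {c : Fr k A (R n) →ₗ[Env k A] A} {x : H}
    (hc : rp n c x) (h : ∑ i ∈ Finset.range (hN (n + 4)), α i • nyE ξ (n + 4) i + ξ 13 * x = 0) :
    (∀ i < hN (n + 4), α i = 0) ∧ x = 0 := by
  obtain ⟨e, he, hei⟩ := exists_sum_nyE hw hA hH hξ (n + 4) α
  have h0 := hH.add he (rp_pr_mul hw hA hH hξ hc)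
  rw [h] at h0
  obtain ⟨b, hb⟩ := hH.exists_coboundary (n := n + 3) h0
  have hα (i : ℕ) (hi : i < hN (n + 4)) : α i = 0 := by
    refine tk_indep hw hA h2 h3 (n + 3) (b ∘ₗ inl k A (n + 3)) (hei.symm.trans
      (LinearMap.ext fun y => ?_)) hi
    have h1 := LinearMap.congr_fun hb (inl k A (n + 4) y)
    have h2 : c (pr k A n (inl k A (n + 4) y)) = 0 := (congrArg c (pr_inl_apply n y)).trans (map_zero c)
    have h3 : e (inl k A (n + 4) y) + c (pr k A n (inl k A (n + 4) y)) =
      b (dl k w (n + 3) (inl k A (n + 4) y)) := h1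
    rw [h2, add_zero] at h3
    exact h3.trans (congrArg b (dl_inl w (n + 3) y))
  refine ⟨hα, ?_⟩
  rw [Finset.sum_eq_zero fun i hi => by rw [hα i (Finset.mem_range.1 hi), zero_smul], zero_add] at h
  have h1 := rp_pr_mul hw hA hH hξ hc
  rw [h] at h1
  obtain ⟨b, hb⟩ := hH.exists_coboundary (n := n + 3) h1
  have hb' (y) : c (pr k A n y) = b (dl k w (n + 3) y) := LinearMap.congr_fun hb y
  obtain ⟨β, g, c', hc', hi⟩ := exists_sub_inl_eq_zero hw hA hH hξ h2 h3 (n := n + 2) b fun y =>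
    (congrArg b (dl_inl w (n + 3) y)).symm.trans ((hb' _).symm.trans
      ((congrArg c (pr_inl_apply n y)).trans (map_zero c)))
  have hq (y) : c (pr k A n y) = (b - c' - g ∘ₗ dl k w (n + 2)) (dl k w (n + 3) y) := by
    have e1 : c' (dl k w (n + 3) y) = 0 := LinearMap.congr_fun (hH.cocycle hc') y
    have e2 : g (dl k w (n + 2) (dl k w (n + 3) y)) = 0 :=
      (congrArg g (LinearMap.congr_fun (dl_dl hw (n + 2)) y)).trans (map_zero g)
    show _ = b (dl k w (n + 3) y) - c' (dl k w (n + 3) y) - g (dl k w (n + 2) (dl k w (n + 3) y))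
    rw [e1, e2, sub_zero, sub_zero, hb']
  generalize b - c' - g ∘ₗ dl k w (n + 2) = q at *
  have hc0 (y) : c y = q (dl k w (n + 3) (sh k A n y)) :=
    (congrArg c (pr_sh_apply n y)).symm.trans (hq _)
  cases n with
  | zero =>
    have : q = 0 := res_ext_of_lt (n := 3) (by norm_num) (LinearMap.ext hi)
    have hc1 : c = 0 := LinearMap.ext fun y => by rw [hc0, this]; rfl
    rw [hc1] at hc
    exact hH.unique hc (hH.zero 0)
  | succ n =>
    have hc1 : c = (q ∘ₗ sh k A n) ∘ₗ dl k w n := LinearMap.ext fun y => by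
      rw [hc0]
      refine (congrArg q (dl_sh w n y)).trans ((map_add q _ _).trans ?_)
      exact (congrArg (· + q (sh k A n (dl k w n y))) (hi _)).trans (zero_add _)
    rw [hc1] at hc
    exact hH.unique hc (hH.coboundary _)

end
end FKH

/-! ### Additive structure of algebras satisfying the relations -/

namespace FKH

/-- The pairs of generators with vanishing product. -/
def zpTab : List (ℕ × ℕ) :=
  [(0, 0), (0, 1), (0, 2), (0, 3), (0, 4), (0, 5), (0, 6), (1, 1), (1, 2), (1, 3), (1, 4),
    (1, 5), (1, 6), (2, 2), (2, 3), (2, 4), (2, 5), (2, 6), (2, 7), (2, 12), (3, 4), (3, 5),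
    (3, 6), (4, 5), (4, 6), (5, 6), (3, 3), (4, 4), (5, 5), (6, 6), (7, 7), (12, 12)]

/-- For every degree, the generators `a` in a suitable order, together with the monomials which
have to be expressed in order to express the products with `a`. Each monomial comes with a
combination of multiples of relations which expresses it. -/
def pTab : List (List (ℕ × List (List ℕ × List (ℤ × List ℕ × ℕ)))) :=
  [[(0, []), (1, []), (2, [])],
   [(3, []), (4, []), (5, []), (6, []), (7, []), (0, []), (1, []), (2, [])],
   [(3, []), (4, []), (5, []), (8, [([1, 8], [(1, [], 27)]), ([2, 8], [(1, [], 31)])]),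
    (9, [([1, 9], [(1, [], 28)]), ([2, 9], [(1, [], 32)])]), (11, [([0, 11], [(1, [], 26)]),
    ([1, 11], [(1, [], 30)])]), (10, [([0, 10], [(1, [], 25)]), ([1, 10], [(1, [], 29)]),
    ([2, 10], [(1, [], 33)])]), (6, [([6, 7], [(1, [], 34)])]), (7, []), (0, []), (1, []),
    (2, [])],
   [(3, [([4, 8], [(1, [], 36)]), ([3, 10], [(1, [], 38)])]), (4, [([4, 8], [(1, [], 36)]),
    ([4, 10], [(1, [], 39)])]), (9, [([5, 9], [(1, [], 37)]), ([6, 9], [(1, [], 41),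
    (1, [], 40)]), ([6, 8], [(1, [], 40)]), ([1, 7, 11], [(1, [], 58)]), ([0, 7, 9],
    [(1, [7], 30)]), ([1, 7, 9], [(1, [7], 28)])]), (5, [([5, 8], [(1, [], 35)])]),
    (8, [([6, 8], [(1, [], 40)]), ([0, 7, 11], [(1, [], 57)]), ([0, 7, 8], [(1, [7], 26)]),
    ([1, 7, 8], [(1, [7], 27)])]), (7, []), (10, [([6, 10], [(1, [], 42)])]), (11, [([6, 11],
    [(1, [], 43)])]), (6, []), (12, [([0, 12], [(1, [], 49)]), ([1, 12], [(1, [], 50)])]),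
    (0, []), (1, []), (2, [])],
   [(8, [([2, 8, 11], [(1, [11], 31)]), ([4, 7, 8], [(1, [7], 36)]), ([5, 7, 8],
    [(1, [7], 35)]), ([8, 10], [(1, [], 44)]), ([0, 8, 9], [(1, [9], 27), (-1, [8], 28)]),
    ([1, 8, 11], [(1, [8], 30)]), ([0, 8, 11], [(1, [11], 27)]), ([0, 8, 8], [(1, [8], 26)])]),
    (3, [([3, 7, 10], [(1, [10], 31)]), ([3, 12], [(1, [], 53)])]), (9, [([5, 7, 9],
    [(1, [7], 37)]), ([9, 10], [(1, [], 45)]), ([6, 7, 9], [(1, [7], 40)]), ([2, 9, 11],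
    [(1, [9], 34)]), ([0, 9, 10], [(1, [0], 45)]), ([0, 9, 9], [(1, [9], 25)]), ([11, 11],
    [(1, [], 46)]), ([9, 11], [(1, [], 47)])]), (11, [([4, 7, 11], [(1, [11], 32)]),
    ([5, 7, 11], [(1, [7], 41)]), ([11, 11], [(1, [], 46)]), ([2, 11, 11], [(1, [2], 46)]),
    ([10, 11], [(1, [], 48)])]), (10, [([4, 7, 10], [(1, [10], 32)])]), (4, [([4, 12],
    [(1, [], 54)])]), (5, [([5, 12], [(1, [], 55)])]), (6, [([6, 12], [(1, [], 56)])]),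
    (7, [([7, 12], [(1, [], 52)])]), (12, []), (0, []), (1, []), (2, [])],
   [(7, []), (8, [([8, 12], [(1, [], 59)]), ([4, 8, 8], [(1, [8], 36)]), ([5, 8, 9],
    [(1, [8], 37)]), ([4, 8, 9], [(1, [9], 35)]), ([5, 8, 10], [(1, [5], 44)]), ([3, 11, 11],
    [(1, [3], 46)]), ([3, 9, 11], [(1, [3], 47)]), ([4, 8, 11], [(1, [11], 36)]), ([5, 8, 11],
    [(1, [11], 35)])]), (4, [([4, 10, 10], [(1, [10], 39)])]), (5, [([5, 9, 9],
    [(1, [9], 37)])]), (9, [([3, 9, 9], [(1, [9], 36)]), ([3, 9, 11], [(1, [11], 36)]),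
    ([9, 12], [(1, [], 60)])]), (10, [([3, 10, 11], [(1, [11], 38)]), ([10, 12],
    [(1, [], 61)])]), (3, []), (6, []), (11, [([11, 12], [(1, [], 62)])]), (12, []), (0, []),
    (1, []), (2, [])],
   [(8, [([8, 8, 8], [(1, [8, 8], 63), (-1, [8], 44)]), ([8, 8, 9], [(1, [8, 9], 63),
    (-1, [9], 44)]), ([8, 9, 10], [(1, [8], 45)]), ([8, 9, 9], [(1, [9], 44)]), ([8, 10, 10],
    [(1, [10], 44)]), ([8, 8, 11], [(1, [8, 11], 63), (-1, [11], 44)]), ([3, 7, 8, 8],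
    [(-1, [8, 8], 31), (1, [2, 8, 8], 63), (1, [8, 8], 33), (1, [7, 8], 35),
    (-1, [8, 8], 32)]), ([3, 7, 8, 9], [(-1, [8, 9], 31), (1, [2, 8, 9], 63), (-1, [8, 9], 32),
    (1, [7, 9], 35), (1, [8, 9], 33)]), ([2, 8, 8, 9], [(1, [8, 9], 31)]), ([4, 7, 8, 8],
    [(1, [8, 8], 32)]), ([5, 7, 8, 9], [(1, [7, 8], 37)]), ([4, 7, 8, 9], [(1, [7, 9], 35)]),
    ([5, 7, 8, 10], [(1, [5, 7], 44)]), ([3, 7, 8, 11], [(-1, [8, 11], 31),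
    (1, [2, 8, 11], 63), (1, [7, 11], 35), (1, [8, 11], 33), (-1, [8, 11], 32)])]),
    (3, [([3, 7, 9, 9], [(1, [9, 9], 31)]), ([3, 7, 10, 10], [(1, [10, 10], 31)])]),
    (10, [([4, 7, 9, 10], [(1, [7, 9], 39)]), ([9, 9, 10], [(1, [9], 45)]), ([5, 7, 9, 10],
    [(1, [7, 10], 37)]), ([5, 7, 10, 10], [(1, [5, 7, 10], 63)]), ([9, 10, 10],
    [(1, [10], 45)]), ([10, 10, 10], [(1, [10, 10], 63)])]), (9, [([9, 9, 9],
    [(1, [9, 9], 63)]), ([4, 7, 9, 9], [(1, [4, 7, 9], 63)])]), (4, []), (5, []), (6, []),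
    (7, []), (11, []), (12, [])],
   [(8, [([7, 8, 8, 9], [(1, [7, 8, 9], 63), (-1, [7, 9], 44)]), ([7, 8, 8, 10],
    [(1, [7, 8], 44)]), ([7, 8, 8, 8], [(1, [7, 8, 8], 63)]), ([7, 8, 9, 10],
    [(1, [7, 8], 45)]), ([7, 8, 9, 9], [(1, [7, 9], 44)]), ([7, 8, 10, 10],
    [(1, [7, 10], 44)]), ([3, 8, 8, 8], [(1, [3, 8, 8], 63), (1, [8, 8], 36),
    (-1, [8, 8], 38)]), ([3, 8, 8, 9], [(1, [3, 8, 9], 63), (1, [8, 9], 36),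
    (-1, [8, 9], 38)]), ([4, 8, 8, 8], [(1, [8, 8], 36)]), ([5, 8, 8, 9], [(1, [8, 8], 37)]),
    ([4, 8, 8, 9], [(1, [8, 9], 35)]), ([5, 8, 9, 9], [(1, [8, 9], 37)]), ([4, 8, 9, 9],
    [(1, [9, 9], 35)]), ([3, 8, 9, 10], [(1, [8, 9], 38)]), ([4, 8, 8, 10],
    [(1, [8, 10], 36)]), ([5, 8, 9, 10], [(1, [8, 10], 37)]), ([5, 8, 10, 10],
    [(1, [5, 10], 44)]), ([3, 8, 8, 11], [(1, [8, 11], 36), (1, [3, 8, 11], 63),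
    (-1, [8, 11], 38)]), ([7, 8, 8, 11], [(-1, [11], 59), (1, [11, 12], 63), (-1, [12], 47),
    (1, [12], 48)])]), (9, [([5, 9, 10, 10], [(1, [10, 10], 37)]), ([7, 9, 10, 10],
    [(1, [7, 10], 45)]), ([4, 9, 9, 10], [(1, [9, 9], 39)]), ([4, 9, 9, 9],
    [(1, [4, 9, 9], 63)]), ([7, 9, 9, 10], [(1, [7, 9], 45)]), ([7, 9, 9, 9],
    [(1, [7, 9, 9], 63)])]), (10, [([7, 10, 10, 10], [(1, [7, 10, 10], 63)]), ([5, 10, 10, 10],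
    [(1, [5, 10, 10], 63)])]), (11, []), (12, [])],
   [(12, [])]]

/-- Insertion of a letter into a word, with the sign. -/
noncomputable def ins (i : ℕ) : List ℕ → ℤ × List ℕ
  | [] => (1, [i])
  | a :: l => bif Nat.ble i a then (1, i :: a :: l) else
      ((-1) ^ (dg i * dg a) * (ins i l).1, a :: (ins i l).2)

/-- Sorting of a word, with the sign. -/
noncomputable def srt : List ℕ → ℤ × List ℕ
  | [] => (1, [])
  | a :: l => ((srt l).1 * (ins a (srt l).2).1, (ins a (srt l).2).2)

/-- The coefficient of a word. -/
def cf (r : Wcomb) (l : List ℕ) : ℤ := (r.map fun p => bif p.2 == l then p.1 else 0).sum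

/-- Whether a word contains a pair of letters with vanishing product. -/
def zpW (l : List ℕ) : Bool := zpTab.any fun p => l.contains p.1 && (l.erase p.1).contains p.2

/-- Whether a word is of degree `n`. -/
noncomputable def okl (n : ℕ) (l : List ℕ) : Bool := Nat.beq (dgW l) n

/-- Whether a word vanishes, contains one of the letters `B`, or is one of the words `K`. -/
def kn (B : List ℕ) (K : List (List ℕ)) (l : List ℕ) : Bool :=
  zpW l || (B.any fun b => l.contains b) || K.contains l

/-- The relations, followed by the central element of degree `2`. -/
def relw (j : ℕ) : Wcomb := bif Nat.beq j 63 then [(1, [8]), (1, [9]), (-1, [10])] else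
  (relTab.map Prod.fst).getD j []

/-- A combination of multiples of relations. -/
def ctW (ct : List (ℤ × List ℕ × ℕ)) : Wcomb :=
  ct.flatMap fun t => (relw t.2.2).map fun p => (t.1 * p.1, t.2.1 ++ p.2)

/-- Sorting of the words in a combination. -/
noncomputable def srtW (r : Wcomb) : Wcomb := r.map fun p => (p.1 * (srt p.2).1, (srt p.2).2)

/-- Whether a combination of multiples of relations expresses a monomial by known words. -/
noncomputable def certOK (n : ℕ) (B : List ℕ) (K : List (List ℕ)) (m : List ℕ)
    (ct : List (ℤ × List ℕ × ℕ)) : Bool :=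
  (ct.all fun t => !Nat.beq t.2.2 63 || (Nat.ble 6 n && okl (n - 2) t.2.1)) &&
  (Nat.beq (7776 % (cf (srtW (ctW ct)) m).natAbs) 0) &&
  (srtW (ctW ct)).all fun p =>
    p.2 == m || cf (srtW (ctW ct)) p.2 == 0 || okl n p.2 && kn B K p.2

/-- The monomials which are known after a list of certificates. -/
def addK (K : List (List ℕ)) (cs : List (List ℕ × List (ℤ × List ℕ × ℕ))) : List (List ℕ) :=
  cs.foldl (fun K c => c.1 :: K) K

/-- Whether a list of certificates is correct. -/
noncomputable def certsOK (n : ℕ) (B : List ℕ) :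
    List (List ℕ) → List (List ℕ × List (ℤ × List ℕ × ℕ)) → Bool
  | _, [] => true
  | K, c :: cs => certOK n B K c.1 c.2 && certsOK n B (c.1 :: K) cs

/-- The basis words in degree `n`. -/
noncomputable def nwB (n : ℕ) : List (List ℕ) := bif Nat.blt n 6 then gD nwTab n else []

/-- Whether the products with the letter `a` can be expressed. -/
noncomputable def phaseOK (n : ℕ) (B : List ℕ) (a : ℕ)
    (cs : List (List ℕ × List (ℤ × List ℕ × ℕ))) : Bool :=
  certsOK n B (nwB n) cs && (gD nwTab (n - dg a)).all fun l =>
    okl (n - dg a) l && kn B (addK (nwB n) cs) (srt (a :: l)).2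

/-- Whether the products with letters in the table can be expressed. -/
noncomputable def phasesOK (n : ℕ) :
    List ℕ → List (ℕ × List (List ℕ × List (ℤ × List ℕ × ℕ))) → Bool
  | _, [] => true
  | B, p :: ps => Nat.ble (dg p.1) n && Nat.blt (n - dg p.1) 6 && phaseOK n B p.1 p.2 &&
      phasesOK n (bif Nat.ble p.1 2 then B else p.1 :: B) ps

/-- The letters of positive degree the products with which need no computation. -/
noncomputable def lets (n : ℕ) : List ℕ :=
  13 :: ([3, 4, 5, 6, 7, 8, 9, 10, 11, 12].filter fun a => Nat.ble (dg a + 6) n)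

lemma check_pTab : ((List.range 9).all fun n => phasesOK n (lets n) (gD pTab n) &&
    (List.range 13).all fun a => Nat.blt n (dg a) || Nat.ble (dg a + 6) n ||
      (gD pTab n).any fun p => Nat.beq p.1 a) = true := by
  decide +kernel

lemma check_nwTab : ((List.range 6).all fun n =>
    Nat.beq (gD nwTab n).length (hN n)) = true := by
  decide +kernel

lemma check_zpTab : (zpTab.all fun p => decide (p.1 = p.2 ∧ p.1 ∈ [3, 4, 5, 6, 7, 12]) ||
    relTab.any fun q => decide (q.1 = [(1, [p.1, p.2])])) = true := by
  decide +kernel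

/-- The defining relations of the presentation. -/
structure IsPres {S : Type*} [Ring S] (X : ℕ → S) : Prop where
  comm : ∀ i j, i ≠ j → X i * X j = ((-1 : ℤ) ^ (dg i * dg j)) • (X j * X i)
  sq : ∀ i ∈ [3, 4, 5, 6, 7, 12], X i * X i = 0
  zero : ∀ i, 14 ≤ i → X i = 0
  rel : ∀ p ∈ relTab, evW X p.1 = 0

section words
variable {S : Type*} [Ring S] {X : ℕ → S}

lemma evW_nil : evW X [] = 0 := rfl

lemma evW_cons (p : ℤ × List ℕ) (r : Wcomb) :
    evW X (p :: r) = p.1 • (p.2.map X).prod + evW X r := by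
  simp [evW]

lemma evW_append (r r' : Wcomb) : evW X (r ++ r') = evW X r + evW X r' := by
  simp [evW]

lemma evW_map (c : ℤ) (u : List ℕ) (r : Wcomb) :
    evW X (r.map fun p => (c * p.1, u ++ p.2)) = c • ((u.map X).prod * evW X r) := by
  induction r with
  | nil => simp [evW_nil]
  | cons p r ih =>
    rw [List.map_cons, evW_cons, evW_cons, ih, mul_add, smul_add, List.map_append, List.prod_append,
      mul_smul_comm, smul_smul]

lemma evW_eq_sum (r : Wcomb) : evW X r = ∑ l ∈ (r.map Prod.snd).toFinset,
    cf r l • (l.map X).prod := by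
  have h : ∀ s : Finset (List ℕ), (∀ p ∈ r, p.2 ∈ s) →
      evW X r = ∑ l ∈ s, cf r l • (l.map X).prod := by
    induction r with
    | nil => intro s _; simp [evW_nil, cf]
    | cons p r ih =>
      intro s hs
      have e : ∀ l, cf (p :: r) l = (if p.2 = l then p.1 else 0) + cf r l := fun l => by
        by_cases hl : p.2 = l
        · simp [cf, hl]
        · have : (p.2 == l) = false := by simpa using hl
          rw [if_neg hl, cf, cf, List.map_cons, List.sum_cons, this, cond_false]
      rw [evW_cons, ih s fun q hq => hs q (List.mem_cons_of_mem _ hq)]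
      simp only [e, add_smul, Finset.sum_add_distrib, ite_smul, zero_smul]
      rw [Finset.sum_ite_eq, if_pos (hs p List.mem_cons_self)]
  exact h _ fun p hp => by
    rw [List.mem_toFinset]
    exact List.mem_map_of_mem hp

variable (hX : IsPres X)
include hX

lemma IsPres.ins (i : ℕ) (l : List ℕ) :
    X i * (l.map X).prod = (ins i l).1 • (((FKH.ins i l).2).map X).prod := by
  induction l with
  | nil => simp [FKH.ins]
  | cons a l ih =>
    rw [FKH.ins]
    cases h : Nat.ble i a with
    | true => simp
    | false =>
      have hne : i ≠ a := by
        rintro rfl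
        rw [Nat.ble_eq_true_of_le le_rfl] at h
        exact Bool.noConfusion h
      simp only [cond_false, List.map_cons, List.prod_cons]
      rw [← mul_assoc, hX.comm i a hne, smul_mul_assoc, mul_assoc, ih, mul_smul_comm, smul_smul]

lemma IsPres.srt (l : List ℕ) : (l.map X).prod = (srt l).1 • (((FKH.srt l).2).map X).prod := by
  induction l with
  | nil => simp [FKH.srt]
  | cons a l ih =>
    rw [List.map_cons, List.prod_cons, ih, mul_smul_comm, hX.ins, smul_smul]
    rfl

lemma IsPres.evW_srtW (r : Wcomb) : evW X (srtW r) = evW X r := by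
  induction r with
  | nil => rfl
  | cons p r ih =>
    rw [srtW, List.map_cons, evW_cons, evW_cons]
    change _ + evW X (srtW r) = _
    rw [ih, hX.srt p.2, smul_smul]

lemma IsPres.erase {b : ℕ} {l : List ℕ} (hb : b ∈ l) :
    ∃ e : ℤ, (l.map X).prod = e • (X b * ((l.erase b).map X).prod) := by
  induction l with
  | nil => simp at hb
  | cons a l ih =>
    by_cases h : a = b
    · subst h
      exact ⟨1, by simp⟩
    · obtain ⟨e, he⟩ := ih (by simpa [Ne.symm h] using hb)
      refine ⟨e * (-1) ^ (dg a * dg b), ?_⟩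
      rw [List.erase_cons_tail (by simpa using h), List.map_cons, List.prod_cons, he,
        mul_smul_comm, ← mul_assoc, hX.comm a b h, smul_mul_assoc, smul_smul, mul_assoc,
        List.map_cons, List.prod_cons]

lemma IsPres.zpW {l : List ℕ} (h : zpW l = true) : (l.map X).prod = 0 := by
  obtain ⟨p, hp, h⟩ := List.any_eq_true.1 h
  rw [Bool.and_eq_true, List.contains_iff_mem, List.contains_iff_mem] at h
  obtain ⟨e, he⟩ := hX.erase h.1
  obtain ⟨e', he'⟩ := hX.erase h.2
  have h0 : X p.1 * X p.2 = 0 := by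
    have := List.all_eq_true.1 check_zpTab p hp
    rw [Bool.or_eq_true, decide_eq_true_eq, List.any_eq_true] at this
    rcases this with ⟨h1, h2⟩ | ⟨q, hq, h1⟩
    · rw [← h1]
      exact hX.sq _ h2
    · have := hX.rel q hq
      rw [of_decide_eq_true h1] at this
      simpa [evW] using this
  rw [he, he', mul_smul_comm, ← mul_assoc, h0, zero_mul, smul_zero, smul_zero]

lemma IsPres.comm_of_even {j : ℕ} (hj : Even (dg j)) (i : ℕ) : X i * X j = X j * X i := by
  by_cases h : i = j
  · rw [h]
  · rw [hX.comm i j h, (hj.mul_left _).neg_one_pow, one_smul]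

lemma IsPres.comm_y (i : ℕ) :
    X i * (X 8 + X 9 - X 10) = (X 8 + X 9 - X 10) * X i := by
  rw [mul_sub, mul_add, sub_mul, add_mul, hX.comm_of_even (j := 8) (by decide),
    hX.comm_of_even (j := 9) (by decide), hX.comm_of_even (j := 10) (by decide)]

lemma IsPres.comm_y_prod (l : List ℕ) :
    (l.map X).prod * (X 8 + X 9 - X 10) = (X 8 + X 9 - X 10) * (l.map X).prod := by
  induction l with
  | nil => simp
  | cons a l ih =>
    rw [List.map_cons, List.prod_cons, mul_assoc, ih, ← mul_assoc, hX.comm_y, mul_assoc]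

lemma IsPres.relw {j : ℕ} (hj : j ≠ 63) : evW X (relw j) = 0 := by
  have hb : Nat.beq j 63 = false := Bool.eq_false_iff.2 fun h => hj (Nat.eq_of_beq_eq_true h)
  rw [FKH.relw, hb, cond_false]
  rcases lt_or_ge j (relTab.map Prod.fst).length with h | h
  · rw [List.getD_eq_getElem _ _ h, List.getElem_map]
    exact hX.rel _ (List.getElem_mem _)
  · rw [List.getD_eq_default _ _ h]
    rfl

end words

section span
variable (k : Type*) [Field k] {S : Type*} [Ring S] [Algebra k S] (X : ℕ → S)

/-- The span of the basis elements in degree `n`. -/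
noncomputable def Vs : ℕ → Submodule k S
  | n + 4 => Submodule.span k ((fun j => nyE X (n + 4) j) '' Set.Iio (hN (n + 4))) ⊔
      (Vs n).map (LinearMap.mulLeft k (X 13))
  | n => Submodule.span k ((fun j => nyE X n j) '' Set.Iio (hN n))

variable {k X}

lemma Vs_of_lt {n : ℕ} (hn : n < 4) :
    Vs k X n = Submodule.span k ((fun j => nyE X n j) '' Set.Iio (hN n)) := by
  interval_cases n <;> rfl

lemma Vs_add (n : ℕ) :
    Vs k X (n + 4) = Submodule.span k ((fun j => nyE X (n + 4) j) '' Set.Iio (hN (n + 4))) ⊔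
      (Vs k X n).map (LinearMap.mulLeft k (X 13)) := by
  rw [Vs]

lemma nyE_mem {n j : ℕ} (hj : j < hN n) : nyE X n j ∈ Vs k X n := by
  have h : nyE X n j ∈ Submodule.span k ((fun j => nyE X n j) '' Set.Iio (hN n)) :=
    Submodule.subset_span ⟨j, hj, rfl⟩
  rcases lt_or_ge n 4 with hn | hn
  · rwa [Vs_of_lt hn]
  · obtain ⟨n, rfl⟩ := Nat.exists_eq_add_of_le' hn
    rw [Vs_add]
    exact Submodule.mem_sup_left h

lemma mul_mem_Vs {n : ℕ} {z : S} (hz : z ∈ Vs k X n) : X 13 * z ∈ Vs k X (n + 4) := by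
  rw [Vs_add]
  exact Submodule.mem_sup_right ⟨z, hz, rfl⟩

/-- A submodule containing the basis elements and the multiples of the periodicity generator
contains everything. -/
lemma Vs_le {n : ℕ} {W : Submodule k S} (h : ∀ j < hN n, nyE X n j ∈ W)
    (h' : ∀ m, m + 4 = n → ∀ z ∈ Vs k X m, X 13 * z ∈ W) : Vs k X n ≤ W := by
  rcases lt_or_ge n 4 with hn | hn
  · rw [Vs_of_lt hn, Submodule.span_le]
    rintro _ ⟨j, hj, rfl⟩
    exact h j hj
  · obtain ⟨n, rfl⟩ := Nat.exists_eq_add_of_le' hn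
    rw [Vs_add]
    refine sup_le ?_ ?_
    · rw [Submodule.span_le]
      rintro _ ⟨j, hj, rfl⟩
      exact h j hj
    · rintro _ ⟨z, hz, rfl⟩
      exact h' n rfl z hz

variable (k X) in
/-- The products of a generator with the spans of basis elements are in the spans. -/
def KL (n b : ℕ) : Prop := ∀ m, m + dg b = n → ∀ z ∈ Vs k X m, X b * z ∈ Vs k X n

lemma one_mem_Vs : (1 : S) ∈ Vs k X 0 := nyE_mem (X := X) (j := 0) (by decide)

lemma dgW_cons (a : ℕ) (l : List ℕ) : dgW (a :: l) = dg a + dgW l := rfl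

lemma dgW_erase {b : ℕ} {l : List ℕ} (hb : b ∈ l) : dg b + dgW (l.erase b) = dgW l := by
  induction l with
  | nil => simp at hb
  | cons a l ih =>
    by_cases h : a = b
    · subst h
      simp [dgW_cons]
    · rw [List.erase_cons_tail (by simpa using h), dgW_cons, dgW_cons,
        ← ih (by simpa [Ne.symm h] using hb), Nat.add_left_comm]

lemma prod_mem_Vs (l : List ℕ) (h : ∀ m ≤ dgW l, ∀ b, KL k X m b) :
    (l.map X).prod ∈ Vs k X (dgW l) := by
  induction l with
  | nil => exact one_mem_Vs
  | cons a l ih =>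
    rw [List.map_cons, List.prod_cons]
    exact h _ le_rfl a _ (add_comm _ _) _
      (ih fun m hm => h m (hm.trans (dgW_cons a l ▸ Nat.le_add_left _ _)))

lemma gD_getElem {l : List (List ℕ)} {j : ℕ} (hj : j < l.length) : gD l j = l[j] := by
  rw [gD_eq, List.getD_eq_getElem _ _ hj]

lemma dgW_ins (a : ℕ) (l : List ℕ) : dgW (ins a l).2 = dg a + dgW l := by
  induction l with
  | nil => rfl
  | cons b l ih =>
    rw [ins]
    cases Nat.ble a b with
    | true => rfl
    | false =>
      rw [cond_false, dgW_cons, dgW_cons, ih, Nat.add_left_comm]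

lemma dgW_srt (l : List ℕ) : dgW (srt l).2 = dgW l := by
  induction l with
  | nil => rfl
  | cons a l ih => rw [srt, dgW_ins, ih, dgW_cons]

variable (hX : IsPres X)
include hX

lemma kl_of_basis {n b m : ℕ} (hm : m + dg b = n) (hn : ∀ i < n, ∀ b, KL k X i b)
    (h : ∀ j < hN m, X b * nyE X m j ∈ Vs k X n) : KL k X n b := by
  intro m' hm' z hz
  obtain rfl : m' = m := by omega
  refine Vs_le (W := (Vs k X n).comap (LinearMap.mulLeft k (X b))) h ?_ hz
  intro i hi z hz
  change X b * (X 13 * z) ∈ Vs k X n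
  rw [← mul_assoc, hX.comm_of_even (by decide), mul_assoc]
  obtain rfl : (i + dg b) + 4 = n := by omega
  exact mul_mem_Vs (hn _ (by omega) b _ rfl z hz)

lemma y_mul_mem {n : ℕ} (hn : ∀ i < n + 6, ∀ b, KL k X i b) {z : S} (hz : z ∈ Vs k X (n + 4)) :
    (X 8 + X 9 - X 10) * z ∈ Vs k X (n + 6) := by
  refine Vs_le (W := (Vs k X (n + 6)).comap (LinearMap.mulLeft k (X 8 + X 9 - X 10))) ?_ ?_ hz
  · intro j hj
    exact nyE_mem (n := n + 6) hj
  · clear hz z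
    intro m hm z hz
    obtain rfl : m = n := by omega
    change (X 8 + X 9 - X 10) * (X 13 * z) ∈ Vs k X (m + 6)
    rw [← mul_assoc, ← hX.comm_y, mul_assoc]
    refine mul_mem_Vs (n := m + 2) ?_
    rw [sub_mul, add_mul]
    exact sub_mem (add_mem (hn (m + 2) (by omega) 8 _ rfl _ hz)
      (hn (m + 2) (by omega) 9 _ rfl _ hz)) (hn (m + 2) (by omega) 10 _ rfl _ hz)

lemma kl_of_ge {n b : ℕ} (hb : dg b + 6 ≤ n) (hn : ∀ i < n, ∀ b, KL k X i b) : KL k X n b := by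
  obtain ⟨m, rfl⟩ := Nat.exists_eq_add_of_le' hb
  refine kl_of_basis hX (m := m + 6) (by omega) hn fun j hj => ?_
  rw [nyE, ← mul_assoc, hX.comm_y, mul_assoc]
  have e : m + (dg b + 6) = (m + dg b) + 6 := by omega
  rw [e] at hn ⊢
  exact y_mul_mem hX hn (hn _ (by omega) b (m + 4) (by omega) _ (nyE_mem hj))

lemma prod_mem_of_mem {n b : ℕ} {l : List ℕ} (hl : dgW l = n) (hb : b ∈ l) (hd : 0 < dg b)
    (hn : ∀ i < n, ∀ b, KL k X i b) (h : KL k X n b) : (l.map X).prod ∈ Vs k X n := by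
  obtain ⟨e, he⟩ := hX.erase hb
  have hd' := dgW_erase hb
  rw [he]
  refine zsmul_mem (h _ (by omega) _ (prod_mem_Vs _ fun m hm => hn m (by omega))) e

lemma kn_mem {n : ℕ} {B : List ℕ} {K : List (List ℕ)} {l : List ℕ} (hl : dgW l = n)
    (hn : ∀ i < n, ∀ b, KL k X i b) (hB : ∀ b ∈ B, 0 < dg b ∧ KL k X n b)
    (hK : ∀ l ∈ K, (l.map X).prod ∈ Vs k X n) (h : kn B K l = true) :
    (l.map X).prod ∈ Vs k X n := by
  rw [kn, Bool.or_eq_true, Bool.or_eq_true, List.any_eq_true, List.contains_iff_mem] at h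
  rcases h with (h | ⟨b, hb, h⟩) | h
  · rw [hX.zpW h]
    exact zero_mem _
  · rw [List.contains_iff_mem] at h
    exact prod_mem_of_mem hX hl h (hB b hb).1 hn (hB b hb).2
  · exact hK l h

lemma evW_ctW_mem {n : ℕ} (hn : ∀ i < n, ∀ b, KL k X i b) {ct : List (ℤ × List ℕ × ℕ)}
    (h : (ct.all fun t => !Nat.beq t.2.2 63 || (Nat.ble 6 n && okl (n - 2) t.2.1)) = true) :
    evW X (ctW ct) ∈ Vs k X n := by
  induction ct with
  | nil => exact zero_mem _
  | cons t ct ih =>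
    rw [List.all_cons, Bool.and_eq_true] at h
    rw [ctW, List.flatMap_cons, evW_append, evW_map]
    refine add_mem (zsmul_mem ?_ _) (ih h.2)
    cases ht : Nat.beq t.2.2 63 with
    | false =>
      rw [hX.relw fun e => by rw [e] at ht; exact Bool.noConfusion ht, mul_zero]
      exact zero_mem _
    | true =>
      rw [ht, Bool.not_true, Bool.false_or, Bool.and_eq_true] at h
      obtain ⟨n, rfl⟩ := Nat.exists_eq_add_of_le' (Nat.le_of_ble_eq_true h.1.1)
      have hd : dgW t.2.1 = n + 4 := Nat.eq_of_beq_eq_true h.1.2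
      have e : evW X (relw t.2.2) = X 8 + X 9 - X 10 := by
        rw [relw, ht]
        simp [evW]
        abel
      rw [e, hX.comm_y_prod]
      refine y_mul_mem hX hn ?_
      rw [← hd]
      exact prod_mem_Vs _ fun m hm => hn m (by omega)

variable (h2 : (2 : k) ≠ 0) (h3 : (3 : k) ≠ 0)
include h2 h3

lemma certOK_mem {n : ℕ} {B : List ℕ} {K : List (List ℕ)}
    (hn : ∀ i < n, ∀ b, KL k X i b) (hB : ∀ b ∈ B, 0 < dg b ∧ KL k X n b)
    (hK : ∀ l ∈ K, (l.map X).prod ∈ Vs k X n) {m : List ℕ} {ct : List (ℤ × List ℕ × ℕ)}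
    (h : certOK n B K m ct = true) : (m.map X).prod ∈ Vs k X n := by
  rw [certOK, Bool.and_eq_true, Bool.and_eq_true] at h
  obtain ⟨⟨h1, hD⟩, h⟩ := h
  have he := evW_ctW_mem hX hn h1
  rw [← hX.evW_srtW, evW_eq_sum] at he
  generalize srtW (ctW ct) = r at *
  have hD : (cf r m).natAbs ∣ 7776 := Nat.dvd_of_mod_eq_zero (Nat.eq_of_beq_eq_true hD)
  have hD' : ((cf r m : ℤ) : k) ≠ 0 := by
    obtain ⟨d, hd⟩ := Int.natAbs_dvd.1 (Int.natCast_dvd_natCast.2 hD)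
    intro h0
    have := congrArg (Int.cast : ℤ → k) hd
    rw [Int.cast_mul, h0, zero_mul] at this
    have e : (((7776 : ℕ) : ℤ) : k) = 2 ^ 5 * 3 ^ 5 := by norm_num
    rw [e] at this
    exact mul_ne_zero (pow_ne_zero _ h2) (pow_ne_zero _ h3) this
  have hm : m ∈ (r.map Prod.snd).toFinset := by
    by_contra hm
    apply hD'
    have : cf r m = 0 := by
      rw [cf, List.sum_eq_zero]
      intro x hx
      obtain ⟨p, hp, rfl⟩ := List.mem_map.1 hx
      have : (p.2 == m) = false := by
        rw [beq_eq_false_iff_ne]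
        rintro rfl
        exact hm (List.mem_toFinset.2 (List.mem_map_of_mem hp))
      rw [this, cond_false]
    rw [this, Int.cast_zero]
  rw [← Finset.add_sum_erase _ _ hm] at he
  have ho : ∑ l ∈ (r.map Prod.snd).toFinset.erase m, cf r l • (l.map X).prod ∈ Vs k X n := by
    refine sum_mem fun l hl => ?_
    rw [Finset.mem_erase, List.mem_toFinset, List.mem_map] at hl
    obtain ⟨hlm, p, hp, rfl⟩ := hl
    have := List.all_eq_true.1 h p hp
    rw [Bool.or_eq_true, Bool.or_eq_true, Bool.and_eq_true, beq_iff_eq, beq_iff_eq] at this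
    rcases this with (h | h) | h
    · exact absurd h hlm
    · rw [h, zero_smul]
      exact zero_mem _
    · exact zsmul_mem (kn_mem hX (Nat.eq_of_beq_eq_true h.1) hn hB hK h.2) _
  have := (Submodule.add_mem_iff_left _ ho).1 he
  rw [← Int.cast_smul_eq_zsmul k] at this
  exact (Submodule.smul_mem_iff _ hD').1 this

lemma certsOK_mem {n : ℕ} {B : List ℕ} {K : List (List ℕ)}
    (hn : ∀ i < n, ∀ b, KL k X i b) (hB : ∀ b ∈ B, 0 < dg b ∧ KL k X n b)
    (hK : ∀ l ∈ K, (l.map X).prod ∈ Vs k X n) {cs : List (List ℕ × List (ℤ × List ℕ × ℕ))}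
    (h : certsOK n B K cs = true) : ∀ l ∈ addK K cs, (l.map X).prod ∈ Vs k X n := by
  induction cs generalizing K with
  | nil => exact hK
  | cons c cs ih =>
    rw [certsOK, Bool.and_eq_true] at h
    refine ih (K := c.1 :: K) ?_ h.2
    intro l hl
    rcases List.mem_cons.1 hl with rfl | hl
    · exact certOK_mem hX h2 h3 hn hB hK h.1
    · exact hK l hl

omit hX h2 h3 in
lemma nwB_mem {n : ℕ} {l : List ℕ} (hl : l ∈ nwB n) : (l.map X).prod ∈ Vs k X n := by
  cases h : Nat.blt n 6 with
  | false =>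
    rw [nwB, h] at hl
    simp at hl
  | true =>
    rw [nwB, h, cond_true] at hl
    have hn : n < 6 := Nat.le_of_ble_eq_true h
    obtain ⟨j, hj, rfl⟩ := List.getElem_of_mem hl
    have hl := Nat.eq_of_beq_eq_true (List.all_eq_true.1 check_nwTab n (List.mem_range.2 hn))
    have := nyE_mem (k := k) (X := X) (n := n) (j := j) (hl ▸ hj)
    rwa [nyE_of_lt X hn, gD_getElem hj] at this

lemma phaseOK_kl {n : ℕ} {B : List ℕ} {a : ℕ} {cs : List (List ℕ × List (ℤ × List ℕ × ℕ))}
    (hn : ∀ i < n, ∀ b, KL k X i b) (hB : ∀ b ∈ B, 0 < dg b ∧ KL k X n b)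
    (ha : dg a ≤ n) (ha' : n - dg a < 6) (h : phaseOK n B a cs = true) : KL k X n a := by
  rw [phaseOK, Bool.and_eq_true] at h
  refine kl_of_basis hX (m := n - dg a) (by omega) hn fun j hj => ?_
  have hl := Nat.eq_of_beq_eq_true (List.all_eq_true.1 check_nwTab _ (List.mem_range.2 ha'))
  rw [← hl] at hj
  have := List.all_eq_true.1 h.2 _ (List.getElem_mem hj)
  rw [Bool.and_eq_true] at this
  rw [nyE_of_lt X ha', gD_getElem hj, ← List.prod_cons, ← List.map_cons, hX.srt]
  refine zsmul_mem (kn_mem hX ?_ hn hB (certsOK_mem hX h2 h3 hn hB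
    (fun l hl => nwB_mem hl) h.1) this.2) _
  rw [dgW_srt, dgW_cons, Nat.eq_of_beq_eq_true this.1]
  omega

lemma phasesOK_kl {n : ℕ} {B : List ℕ}
    {ps : List (ℕ × List (List ℕ × List (ℤ × List ℕ × ℕ)))}
    (hn : ∀ i < n, ∀ b, KL k X i b) (hB : ∀ b ∈ B, 0 < dg b ∧ KL k X n b)
    (h : phasesOK n B ps = true) : ∀ p ∈ ps, KL k X n p.1 := by
  induction ps generalizing B with
  | nil => simp
  | cons p ps ih =>
    rw [phasesOK, Bool.and_eq_true, Bool.and_eq_true, Bool.and_eq_true] at h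
    have hp := phaseOK_kl hX h2 h3 hn hB (Nat.le_of_ble_eq_true h.1.1.1)
      (Nat.le_of_ble_eq_true h.1.1.2) h.1.2
    intro q hq
    rcases List.mem_cons.1 hq with rfl | hq
    · exact hp
    · refine ih ?_ h.2 q hq
      intro b hb
      cases hb' : Nat.ble p.1 2 with
      | true =>
        rw [hb', cond_true] at hb
        exact hB b hb
      | false =>
        rw [hb', cond_false] at hb
        rcases List.mem_cons.1 hb with rfl | hb
        · refine ⟨?_, hp⟩
          rw [dg, hb', cond_false]
          cases Nat.ble p.1 7 <;> cases Nat.ble p.1 11 <;> cases Nat.ble p.1 12 <;> decide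
        · exact hB b hb

lemma kl (n b : ℕ) : KL k X n b := by
  induction n using Nat.strong_induction_on generalizing b with
  | _ n ih =>
  rcases Nat.lt_or_ge b 14 with hb | hb
  · rcases Nat.lt_or_ge b 13 with hb' | hb'
    · rcases Nat.lt_or_ge n 9 with hn | hn
      · have h := List.all_eq_true.1 check_pTab n (List.mem_range.2 hn)
        rw [Bool.and_eq_true] at h
        have hk := phasesOK_kl hX h2 h3 ih ?_ h.1
        · have h := List.all_eq_true.1 h.2 b (List.mem_range.2 hb')
          rw [Bool.or_eq_true, Bool.or_eq_true, List.any_eq_true] at h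
          rcases h with (h | h) | ⟨p, hp, h⟩
          · intro m hm
            have : n < dg b := Nat.le_of_ble_eq_true h
            omega
          · exact kl_of_ge hX (Nat.le_of_ble_eq_true h) ih
          · rw [← Nat.eq_of_beq_eq_true h]
            exact hk p hp
        · intro a ha
          rcases List.mem_cons.1 ha with rfl | ha
          · exact ⟨by decide, fun m hm z hz => hm ▸ mul_mem_Vs hz⟩
          · rw [List.mem_filter] at ha
            refine ⟨?_, kl_of_ge hX (Nat.le_of_ble_eq_true ha.2) ih⟩
            exact (by decide : ∀ a ∈ [3, 4, 5, 6, 7, 8, 9, 10, 11, 12], 0 < dg a) a ha.1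
      · refine kl_of_ge hX ?_ ih
        have : dg b ≤ 3 := (by decide : ∀ b < 13, dg b ≤ 3) b hb'
        omega
    · obtain rfl : b = 13 := by omega
      exact fun m hm z hz => hm ▸ mul_mem_Vs hz
  · intro m hm z hz
    rw [hX.zero b hb, zero_mul]
    exact zero_mem _

/-- Every word lies in the span of the basis elements. -/
lemma word_mem (l : List ℕ) : (l.map X).prod ∈ Vs k X (dgW l) :=
  prod_mem_Vs l fun m _ b => kl hX h2 h3 m b

end span
end FKH

/-! ### Comparison of the two forms of the relations -/

namespace FKH

section scaled
variable (k : Type) [Field k] {S : Type*} [Ring S] [Algebra k S] (x : Fin 14 → S)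

/-- The ratios of the two normalisations of the generators. -/
def sf (i : ℕ) : k := if i = 6 then 2 else if i = 13 then -3 else 1

/-- The rescaled generators. -/
def Xs (i : ℕ) : S := if h : i < 14 then sf k i • x ⟨i, h⟩ else 0

variable {k}

lemma sf_ne_zero (h2 : (2 : k) ≠ 0) (h3 : (3 : k) ≠ 0) (i : ℕ) : sf k i ≠ 0 := by
  unfold sf
  split_ifs
  · exact h2
  · exact neg_ne_zero.2 h3
  · exact one_ne_zero

lemma Xs_eq :
    Xs k x 0 = x 0 ∧ Xs k x 1 = x 1 ∧ Xs k x 2 = x 2 ∧ Xs k x 3 = x 3 ∧ Xs k x 4 = x 4 ∧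
    Xs k x 5 = x 5 ∧ Xs k x 6 = (2 : k) • x 6 ∧ Xs k x 7 = x 7 ∧ Xs k x 8 = x 8 ∧
    Xs k x 9 = x 9 ∧ Xs k x 10 = x 10 ∧ Xs k x 11 = x 11 ∧ Xs k x 12 = x 12 ∧
    Xs k x 13 = (-3 : k) • x 13 := by
  refine ⟨?_, ?_, ?_, ?_, ?_, ?_, ?_, ?_, ?_, ?_, ?_, ?_, ?_, ?_⟩ <;> simp [Xs, sf]

set_option maxHeartbeats 4000000 in
lemma forall₂_relTab (h2 : (2 : k) ≠ 0) (h3 : (3 : k) ≠ 0) :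
    List.Forall₂ (fun (p : Wcomb × Comb) q => ∃ c : k, c ≠ 0 ∧
      evW (Xs k x) p.1 = c • FreeAlgebra.lift k x q) relTab (R2list k) := by
  obtain ⟨e0, e1, e2, e3, e4, e5, e6, e7, e8, e9, e10, e11, e12, e13⟩ := Xs_eq (k := k) x
  have h6 : (6 : k) ≠ 0 := by
    have := mul_ne_zero h2 h3
    norm_num at this
    exact this
  unfold relTab R2list
  repeat' apply List.Forall₂.cons
  any_goals exact List.Forall₂.nil
  all_goals
    simp only [evW, List.map_cons, List.map_nil, List.sum_cons, List.sum_nil, List.prod_cons,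
      List.prod_nil, mul_one, add_zero, e0, e1, e2, e3, e4, e5, e6, e7, e8, e9, e10, e11, e12, e13,
      xv, map_mul, map_add, map_sub, map_smul, FreeAlgebra.lift_ι_apply, smul_mul_assoc,
      mul_smul_comm, one_smul, neg_smul, neg_mul, mul_assoc]
    first
    | (refine ⟨1, one_ne_zero, ?_⟩; module)
    | (refine ⟨2, h2, ?_⟩; module)
    | (refine ⟨3, h3, ?_⟩; (match_scalars <;> field_simp <;> norm_num); done)
    | (refine ⟨6, h6, ?_⟩; (match_scalars <;> field_simp <;> norm_num))

end scaled
end FKH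

/-! ### Comparison of the presented algebra with cohomology -/

namespace FKH

lemma map_nyE {S T G : Type*} [Ring S] [Ring T] [FunLike G S T] [RingHomClass G S T] (F : G)
    (X : ℕ → S) (n j : ℕ) : F (nyE X n j) = nyE (fun i => F (X i)) n j := by
  induction n using Nat.strong_induction_on with
  | _ n ih =>
    rcases lt_or_ge n 6 with hn | hn
    · rw [nyE_of_lt X hn, nyE_of_lt _ hn, map_list_prod, List.map_map]
      rfl
    · obtain ⟨m, rfl⟩ := Nat.exists_eq_add_of_le' hn
      rw [nyE, nyE, map_mul, map_sub, map_add, ih (m + 4) (by omega)]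

section
variable {k : Type} [Field k] {S : Type*} [Ring S] [Algebra k S] {X : ℕ → S}

lemma exists_eq_sum_of_mem_span {f : ℕ → S} {N : ℕ} {z : S}
    (hz : z ∈ Submodule.span k (f '' Set.Iio N)) :
    ∃ α : ℕ → k, z = ∑ i ∈ Finset.range N, α i • f i := by
  rw [← Finset.coe_range, Submodule.mem_span_image_finset_iff_exists_fun'] at hz
  obtain ⟨α, rfl⟩ := hz
  exact ⟨α, rfl⟩

lemma exists_eq_sum_of_mem_Vs {n : ℕ} (hn : n < 4) {z : S} (hz : z ∈ Vs k X n) :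
    ∃ α : ℕ → k, z = ∑ i ∈ Finset.range (hN n), α i • nyE X n i := by
  rw [Vs_of_lt hn] at hz
  exact exists_eq_sum_of_mem_span hz

lemma exists_eq_sum_add_of_mem_Vs {n : ℕ} {z : S} (hz : z ∈ Vs k X (n + 4)) :
    ∃ (α : ℕ → k), ∃ z' ∈ Vs k X n,
      z = ∑ i ∈ Finset.range (hN (n + 4)), α i • nyE X (n + 4) i + X 13 * z' := by
  rw [Vs_add] at hz
  obtain ⟨y, hy, _, ⟨z', hz', rfl⟩, rfl⟩ := Submodule.mem_sup.1 hz
  obtain ⟨α, rfl⟩ := exists_eq_sum_of_mem_span hy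
  exact ⟨α, z', hz', rfl⟩

lemma sum_nyE_mem (n : ℕ) (α : ℕ → k) :
    ∑ i ∈ Finset.range (hN n), α i • nyE X n i ∈ Vs k X n :=
  Submodule.sum_mem _ fun _ hi => Submodule.smul_mem _ _ (nyE_mem (Finset.mem_range.1 hi))

lemma map_sum_nyE {H : Type*} [Ring H] [Algebra k H] (F : S →ₐ[k] H) (n : ℕ) (α : ℕ → k) :
    F (∑ i ∈ Finset.range (hN n), α i • nyE X n i) =
      ∑ i ∈ Finset.range (hN n), α i • nyE (fun i => F (X i)) n i := by
  simp only [map_sum, map_smul, map_nyE]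

variable {A : Type} [Ring A] [Algebra k A] {w : ℕ → A}
  [Module (Env k A) A] [IsScalarTower k (Env k A) A]
  {H : Type*} [Ring H] [Algebra k H] {rp : ∀ n, (Fr k A (R n) →ₗ[Env k A] A) → H → Prop}
  (hw : IsFK k w) (hA : ∀ x y m : A, (x ⊗ₜ[k] .op y : Env k A) • m = x * m * y)
  (hH : IsCoh k (P := fun n => Fr k A (R n)) (dl k w) (eps k w) rp)
  {F : S →ₐ[k] H} (hξ : IsGen k w rp fun i => F (X i))
include hw hA hH hξ

lemma exists_rp_of_mem_Vs (n : ℕ) : ∀ z ∈ Vs k X n, ∃ c, rp n c (F z) := by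
  induction n using Nat.strong_induction_on with
  | _ n ih =>
    intro z hz
    rcases lt_or_ge n 4 with hn | hn
    · obtain ⟨α, rfl⟩ := exists_eq_sum_of_mem_Vs hn hz
      rw [map_sum_nyE]
      exact (exists_sum_nyE hw hA hH hξ n α).imp fun _ h => h.1
    · obtain ⟨m, rfl⟩ := Nat.exists_eq_add_of_le' hn
      obtain ⟨α, z', hz', rfl⟩ := exists_eq_sum_add_of_mem_Vs hz
      obtain ⟨c, hc, -⟩ := exists_sum_nyE hw hA hH hξ (m + 4) α
      obtain ⟨c', hc'⟩ := ih m (by omega) z' hz'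
      rw [map_add, map_mul, map_sum_nyE]
      exact ⟨_, hH.add hc (rp_pr_mul hw hA hH hξ hc')⟩

variable (h2 : (2 : k) ≠ 0) (h3 : (3 : k) ≠ 0)
include h2 h3

lemma eq_zero_of_mem_Vs (n : ℕ) : ∀ z ∈ Vs k X n, F z = 0 → z = 0 := by
  induction n using Nat.strong_induction_on with
  | _ n ih =>
    intro z hz h0
    rcases lt_or_ge n 4 with hn | hn
    · obtain ⟨α, rfl⟩ := exists_eq_sum_of_mem_Vs hn hz
      rw [map_sum_nyE] at h0
      refine Finset.sum_eq_zero fun i hi => ?_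
      rw [eq_zero_of_sum_eq_zero hw hA hH hξ h2 h3 hn h0 (Finset.mem_range.1 hi), zero_smul]
    · obtain ⟨m, rfl⟩ := Nat.exists_eq_add_of_le' hn
      obtain ⟨α, z', hz', rfl⟩ := exists_eq_sum_add_of_mem_Vs hz
      obtain ⟨c', hc'⟩ := exists_rp_of_mem_Vs hw hA hH hξ m z' hz'
      rw [map_add, map_mul, map_sum_nyE] at h0
      obtain ⟨hα, h0'⟩ := eq_zero_of_sum_add_eq_zero hw hA hH hξ h2 h3 hc' h0
      rw [ih m (by omega) z' hz' h0', mul_zero, add_zero]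
      refine Finset.sum_eq_zero fun i hi => ?_
      rw [hα i (Finset.mem_range.1 hi), zero_smul]

lemma exists_mem_Vs (n : ℕ) : ∀ (c) (x : H), rp n c x → ∃ z ∈ Vs k X n, F z = x := by
  induction n using Nat.strong_induction_on with
  | _ n ih =>
    intro c x hc
    rcases lt_or_ge n 4 with hn | hn
    · obtain ⟨α, rfl⟩ := exists_eq_sum_of_lt hw hA hH hξ h2 h3 hn hc
      exact ⟨_, sum_nyE_mem n α, map_sum_nyE F n α⟩
    · obtain ⟨m, rfl⟩ := Nat.exists_eq_add_of_le' hn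
      obtain ⟨α, c', x', hc', rfl⟩ := exists_eq_sum_add hw hA hH hξ h2 h3 hc
      obtain ⟨z', hz', rfl⟩ := ih m (by omega) c' x' hc'
      refine ⟨_, add_mem (sum_nyE_mem (m + 4) α) (mul_mem_Vs hz'), ?_⟩
      rw [map_add, map_mul, map_sum_nyE]

end

lemma hhDegs_eq (i : Fin 14) : hhDegs i = dg i := by
  revert i
  decide

lemma odd_dg_iff (i : Fin 14) : Odd (dg i) ↔ (i : ℕ) ∈ [3, 4, 5, 6, 7, 12] := by
  revert i
  decide

section respects
variable {k : Type} [Field k] {S : Type*} [Ring S] [Algebra k S] {x : Fin 14 → S}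

lemma Xs_fin (i : Fin 14) : Xs k x i = sf k i • x i := dif_pos i.2

lemma lift_xv (i : Fin 14) : FreeAlgebra.lift k x (xv k i) = x i := FreeAlgebra.lift_ι_apply _ _

lemma neg_one_pow_smul (m : ℕ) (z : S) : ((-1 : ℤ) ^ m) • z = ((-1 : k) ^ m) • z := by
  rw [← Int.cast_smul_eq_zsmul k]
  simp

lemma forall₂_exists_left {α β : Type*} {r : α → β → Prop} {l : List α} {l' : List β}
    (h : List.Forall₂ r l l') : ∀ a ∈ l, ∃ b ∈ l', r a b := by
  induction h with
  | nil => simp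
  | cons h _ ih =>
    intro a ha
    rcases List.mem_cons.1 ha with rfl | ha
    · exact ⟨_, List.mem_cons_self, h⟩
    · obtain ⟨b, hb, hr⟩ := ih a ha
      exact ⟨b, List.mem_cons_of_mem _ hb, hr⟩

variable (h2 : (2 : k) ≠ 0) (h3 : (3 : k) ≠ 0)
include h2 h3

lemma isPres_Xs (h : ∀ p q, PresRel k p q → FreeAlgebra.lift k x p = FreeAlgebra.lift k x q) :
    IsPres (Xs k x) where
  comm i j _ := by
    rcases lt_or_ge i 14 with hi | hi
    · rcases lt_or_ge j 14 with hj | hj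
      · have := h _ _ (.comm ⟨i, hi⟩ ⟨j, hj⟩)
        rw [map_mul, map_smul, map_mul, lift_xv, lift_xv, hhDegs_eq, hhDegs_eq] at this
        have ei := Xs_fin (k := k) (x := x) ⟨i, hi⟩
        have ej := Xs_fin (k := k) (x := x) ⟨j, hj⟩
        simp only at ei ej this
        rw [ei, ej, neg_one_pow_smul (k := k), smul_mul_smul_comm, smul_mul_smul_comm, this,
          smul_comm, mul_comm (sf k j)]
      · simp [Xs, hj.not_gt]
    · simp [Xs, hi.not_gt]
  sq i hi := by
    have hi' : i < 14 := by
      revert i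
      decide
    have := h _ _ (.sq ⟨i, hi'⟩ (by rw [hhDegs_eq, odd_dg_iff]; exact hi))
    rw [map_mul, lift_xv, map_zero] at this
    have ei := Xs_fin (k := k) (x := x) ⟨i, hi'⟩
    simp only at ei
    rw [ei, smul_mul_smul_comm, this, smul_zero]
  zero i hi := dif_neg hi.not_gt
  rel p hp := by
    obtain ⟨q, hq, c, -, hc⟩ := forall₂_exists_left (forall₂_relTab x h2 h3) p hp
    rw [hc, h _ _ (.rel q hq), map_zero, smul_zero]

lemma lift_eq_of_presRel (hX : IsPres (Xs k x)) (p q : FreeAlgebra k (Fin 14)) (h : PresRel k p q) :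
    FreeAlgebra.lift k x p = FreeAlgebra.lift k x q := by
  have sq (i : Fin 14) (hi : Odd (hhDegs i)) : x i * x i = 0 := by
    rw [hhDegs_eq, odd_dg_iff] at hi
    have := hX.sq i hi
    rw [Xs_fin, smul_mul_smul_comm] at this
    exact (smul_eq_zero.1 this).resolve_left
      (mul_ne_zero (sf_ne_zero h2 h3 _) (sf_ne_zero h2 h3 _))
  cases h with
  | comm i j =>
    rw [map_mul, map_smul, map_mul, lift_xv, lift_xv]
    by_cases hij : i = j
    · subst hij
      rcases Nat.even_or_odd (hhDegs i) with he | ho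
      · rw [(he.mul_left _).neg_one_pow, one_smul]
      · rw [sq i ho, smul_zero]
    · have := hX.comm i j (fun h => hij (Fin.ext h))
      rw [Xs_fin, Xs_fin, smul_mul_smul_comm, smul_mul_smul_comm, neg_one_pow_smul (k := k),
        mul_comm (sf k j), smul_comm, ← hhDegs_eq, ← hhDegs_eq] at this
      exact smul_right_injective _
        (mul_ne_zero (sf_ne_zero h2 h3 i) (sf_ne_zero h2 h3 j)) this
  | sq i hi => rw [map_mul, lift_xv, map_zero, sq i hi]
  | rel q hq =>
    obtain ⟨r, hr, c, h0, hc⟩ :=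
      forall₂_exists_left (List.Forall₂.flip (forall₂_relTab x h2 h3)) p hq
    rw [hX.rel r hr] at hc
    rw [map_zero]
    exact (smul_eq_zero.1 hc.symm).resolve_left h0

end respects

section presented
variable (k : Type) [Field k]

/-- The generators of the presented algebra. -/
noncomputable def xP (i : Fin 14) : HHPres k := RingQuot.mkAlgHom k (PresRel k) (xv k i)

lemma lift_xP : FreeAlgebra.lift k (xP k) = RingQuot.mkAlgHom k (PresRel k) :=
  FreeAlgebra.hom_ext (funext fun i => lift_xv i)

variable {k}

lemma presWord_eq_smul (h2 : (2 : k) ≠ 0) (h3 : (3 : k) ≠ 0) (l : List (Fin 14)) : ∃ c : k,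
    presWord k l = c • ((l.map Fin.val).map (Xs k (xP k))).prod := by
  induction l with
  | nil => exact ⟨1, (one_smul _ _).symm⟩
  | cons i l ih =>
    obtain ⟨c, hc⟩ := ih
    refine ⟨(sf k i)⁻¹ * c, ?_⟩
    have : presWord k (i :: l) = xP k i * presWord k l := rfl
    rw [this, hc, List.map_cons, List.map_cons, List.prod_cons, Xs_fin, smul_mul_assoc,
      mul_smul_comm, smul_smul, mul_right_comm, inv_mul_cancel₀ (sf_ne_zero h2 h3 _), one_mul]

lemma dgW_map_val (l : List (Fin 14)) : dgW (l.map Fin.val) = (l.map hhDegs).sum := by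
  induction l with
  | nil => rfl
  | cons i l ih => rw [List.map_cons, dgW_cons, ih, List.map_cons, List.sum_cons, hhDegs_eq]

lemma presComp_le (h2 : (2 : k) ≠ 0) (h3 : (3 : k) ≠ 0) (n : ℕ) :
    presComp k n ≤ Vs k (Xs k (xP k)) n := by
  refine Submodule.span_le.2 ?_
  rintro _ ⟨l, rfl, rfl⟩
  obtain ⟨c, hc⟩ := presWord_eq_smul h2 h3 l
  rw [hc, ← dgW_map_val]
  refine Submodule.smul_mem _ _ (word_mem (isPres_Xs h2 h3 fun p q h => ?_) h2 h3 _)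
  rw [lift_xP]
  exact RingQuot.mkAlgHom_rel k h

variable (k) in
lemma iSup_presComp : ⨆ n, presComp k n = ⊤ := by
  have h : Algebra.adjoin k (Set.range (xP k)) = ⊤ := by
    have := congrArg (Subalgebra.map (RingQuot.mkAlgHom k (PresRel k)))
      (FreeAlgebra.adjoin_range_ι k (Fin 14))
    rw [AlgHom.map_adjoin, ← Set.range_comp, Algebra.map_top,
      (AlgHom.range_eq_top _).2 (RingQuot.mkAlgHom_surjective k _)] at this
    exact this
  rw [eq_top_iff, ← Algebra.top_toSubmodule, ← h, Algebra.adjoin_eq_span, Submodule.span_le]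
  intro z hz
  obtain ⟨l, hl, rfl⟩ := Submonoid.exists_list_of_mem_closure hz
  obtain ⟨l, rfl⟩ : ∃ l' : List (Fin 14), l'.map (xP k) = l := by
    rwa [← Set.mem_range, Set.range_list_map]
  exact Submodule.mem_iSup_of_mem _ (Submodule.subset_span ⟨l, rfl, rfl⟩)

end presented

section hom
variable {k : Type} [Field k] {A : Type} [Ring A] [Algebra k A] {w : ℕ → A}
  [Module (Env k A) A] [IsScalarTower k (Env k A) A]
  {H : Type*} [Ring H] [Algebra k H] {rp : ∀ n, (Fr k A (R n) →ₗ[Env k A] A) → H → Prop}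
  (hw : IsFK k w) (hA : ∀ x y m : A, (x ⊗ₜ[k] .op y : Env k A) • m = x * m * y)
  (hH : IsCoh k (P := fun n => Fr k A (R n)) (dl k w) (eps k w) rp)
include hw hA hH

lemma isPres_of_isGen {ξ : ℕ → H} (hξ : IsGen k w rp ξ) (h0 : ∀ i, 14 ≤ i → ξ i = 0) :
    IsPres ξ where
  comm := by
    have key {i j : ℕ} (hij : i < j) : ξ i * ξ j = ((-1 : ℤ) ^ (dg i * dg j)) • (ξ j * ξ i) := by
      rcases lt_or_ge j 14 with hj | hj
      · have := evW_com hw hA hH hξ hj hij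
        rw [com, evW_cons, evW_cons, evW_nil] at this
        simpa [add_neg_eq_zero] using this
      · rw [h0 j hj, mul_zero, zero_mul, smul_zero]
    intro i j hij
    rcases hij.lt_or_gt with h | h
    · exact key h
    · rw [key h, smul_smul, mul_comm (dg j), ← mul_pow]
      simp
  sq _ hi := sq_eq_zero hw hA hH hξ hi
  zero := h0
  rel _ hp := evW_relTab hw hA hH hξ hp

lemma exists_hom (h2 : (2 : k) ≠ 0) (h3 : (3 : k) ≠ 0) :
    ∃ F : HHPres k →ₐ[k] H, IsGen k w rp fun i => F (Xs k (xP k) i) := by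
  obtain ⟨ξ, hξ⟩ := exists_isGen hw hA hH
  set x : Fin 14 → H := fun i => (sf k i)⁻¹ • ξ i with hx
  have hX (i : ℕ) (hi : i < 14) : Xs k x i = ξ i := by
    rw [Xs, dif_pos hi, hx]
    exact smul_inv_smul₀ (sf_ne_zero h2 h3 i) _
  have hp : IsPres (Xs k x) :=
    isPres_of_isGen hw hA hH (fun i hi => by rw [hX i hi]; exact hξ i hi)
      fun i hi => dif_neg hi.not_gt
  refine ⟨RingQuot.liftAlgHom k ⟨FreeAlgebra.lift k x, fun p q h =>
    lift_eq_of_presRel h2 h3 hp p q h⟩, fun i hi => ?_⟩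
  convert hξ i hi
  rw [← hX i hi]
  simp only [Xs, dif_pos hi, map_smul, xP, RingQuot.liftAlgHom_mkAlgHom_apply, lift_xv]

end hom

/-- A linear map between graded spaces which is bijective in each degree is bijective. -/
lemma bijective_of_graded {k S : Type*} [Ring k] [AddCommGroup S] [Module k S] {B : ℕ → Type*}
    [∀ n, AddCommGroup (B n)] (F : S →+ DirectSum ℕ B) (V : ℕ → Submodule k S)
    (hV : ⨆ n, V n = ⊤) (hF : ∀ n, ∀ z ∈ V n, ∃ e, DirectSum.of B n e = F z)
    (h0 : ∀ n, ∀ z ∈ V n, F z = 0 → z = 0) (hs : ∀ n e, ∃ z ∈ V n, F z = DirectSum.of B n e) :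
    Function.Bijective F := by
  constructor
  · rw [injective_iff_map_eq_zero]
    intro z hz
    obtain ⟨f, hf, rfl⟩ := (Submodule.mem_iSup_iff_exists_finsupp V z).1 (hV ▸ Submodule.mem_top)
    refine Finset.sum_eq_zero fun n _ => h0 n _ (hf n) ?_
    have key (m : ℕ) (hm : m ≠ n) : (F (f m)) n = 0 := by
      obtain ⟨e, he⟩ := hF m _ (hf m)
      rw [← he, DirectSum.of_eq_of_ne _ _ _ hm.symm]
    have hn : (F (f n)) n = 0 := by
      have := congrArg (fun y => y n) hz
      simp only [Finsupp.sum, map_sum, DirectSum.sum_apply] at this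
      by_cases hs : n ∈ f.support
      · rwa [Finset.sum_eq_single_of_mem n hs fun m _ hm => key m hm] at this
      · rw [Finsupp.notMem_support_iff.1 hs, map_zero]
        rfl
    obtain ⟨e, he⟩ := hF n _ (hf n)
    rw [← he, DirectSum.of_eq_same] at hn
    rw [← he, hn, map_zero]
  · intro y
    induction y using DirectSum.induction_on with
    | zero => exact ⟨0, map_zero F⟩
    | of n e => exact (hs n e).imp fun _ h => h.2
    | add y y' h h' =>
      obtain ⟨z, rfl⟩ := h
      obtain ⟨z', rfl⟩ := h'
      exact ⟨z + z', map_add F z z'⟩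

section main
variable {k : Type} [Field k] {A : Type} [Ring A] [Algebra k A] {w : ℕ → A}
  [Module (Env k A) A]
  (hw : IsFK k w) (hA : ∀ x y m : A, (x ⊗ₜ[k] .op y : Env k A) • m = x * m * y)
include hA

lemma isScalarTower : IsScalarTower k (Env k A) A := .of_algebraMap_smul fun c m =>
  (hA (algebraMap k A c) 1 m).trans ((mul_one _).trans (Algebra.smul_def c m).symm)

include hw

lemma eps_surjective : Function.Surjective (eps k w) := fun m => by
  refine ⟨(m ⊗ₜ[k] .op 1 : Env k A) • gen k A 1 0, ?_⟩
  rw [map_smul, eps, mapOf_gen _ one_pos, hA]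
  simp [ev, hw.one]

lemma isRes : IsRes (P := fun n => Fr k A (R n)) (dl k w) (eps k w) :=
  have := isScalarTower hA
  { surj := eps_surjective hw hA
    comp_zero x := LinearMap.congr_fun (eps_dl hw hA) x
    comp n x := LinearMap.congr_fun (dl_dl hw n) x
    exact_zero := dl_exact_zero hw hA
    exact := dl_exact hw hA }

open scoped DirectSum in
theorem exists_addEquiv [HasExt.{1} (ModuleCat.{0} (Env k A))] (h2 : (2 : k) ≠ 0)
    (h3 : (3 : k) ≠ 0) :
    ∃ Φ : HHPres k ≃+ ⨁ n : ℕ, Ext (ModuleCat.of (Env k A) A) (ModuleCat.of (Env k A) A) n,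
      (∀ (n : ℕ) (z : HHPres k), z ∈ presComp k n → ∀ m : ℕ, m ≠ n → (Φ z) m = 0) ∧
      (Φ 1 = DirectSum.of (fun n => Ext (ModuleCat.of (Env k A) A) (ModuleCat.of (Env k A) A) n) 0
        (Ext.mk₀ (𝟙 (ModuleCat.of (Env k A) A)))) ∧
      (∀ (c : k) (z : HHPres k) (n : ℕ),
        (Φ (algebraMap k (HHPres k) c * z)) n =
          (Ext.mk₀ ((Linear.homModule (R := k) _ _).smul c (𝟙 (ModuleCat.of (Env k A) A)))).comp ((Φ z) n) (zero_add n)) ∧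
      (∀ (a b : ℕ) (y z : HHPres k), y ∈ presComp k a → z ∈ presComp k b →
        (Φ (y * z)) (a + b) = ((Φ y) a).comp ((Φ z) b) rfl) := by
  have := isScalarTower hA
  have hr := isRes hw hA
  have hH := isCoh_rep (k := k) hr
  obtain ⟨F, hF⟩ := exists_hom hw hA hH h2 h3
  have hdeg (n : ℕ) (z : HHPres k) (hz : z ∈ Vs k (Xs k (xP k)) n) :
      ∃ e, DirectSum.of (fun n => Ext (ModuleCat.of (Env k A) A) (ModuleCat.of (Env k A) A) n) n e
        = F z := by
    obtain ⟨c, e, -, he⟩ := exists_rp_of_mem_Vs hw hA hH hF n z hz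
    exact ⟨e, he⟩
  have hbij : Function.Bijective F := by
    refine bijective_of_graded F.toLinearMap.toAddMonoidHom (Vs k (Xs k (xP k))) ?_ hdeg
      (eq_zero_of_mem_Vs hw hA hH hF h2 h3) fun n e => ?_
    · exact top_le_iff.1 ((iSup_presComp k).ge.trans (iSup_mono (presComp_le h2 h3)))
    · obtain ⟨c, hc⟩ := Rep.exists_cochain hr e
      exact exists_mem_Vs hw hA hH hF h2 h3 n c _ ⟨e, hc, rfl⟩
  refine ⟨AddEquiv.ofBijective F hbij, fun n z hz m hm => ?_, map_one F,
    fun c z n => ?_, fun a b y z hy hz => ?_⟩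
  · obtain ⟨e, he⟩ := hdeg n z (presComp_le h2 h3 n hz)
    change (F z) m = 0
    rw [← he, DirectSum.of_eq_of_ne _ _ _ hm]
  · change (F (algebraMap k (HHPres k) c * z)) n = _
    rw [← Algebra.smul_def, map_smul]
    change c • (F z) n = Ext.comp _ ((F z) n) _
    refine Eq.trans ?_ (congrArg (fun e => Ext.comp e ((F z) n) (zero_add n))
      (Ext.mk₀_smul c (𝟙 (ModuleCat.of (Env k A) A))).symm)
    rw [Ext.smul_comp, Ext.mk₀_id_comp]
  · obtain ⟨e, he⟩ := hdeg a y (presComp_le h2 h3 a hy)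
    obtain ⟨e', he'⟩ := hdeg b z (presComp_le h2 h3 b hz)
    change (F (y * z)) (a + b) = ((F y) a).comp ((F z) b) rfl
    rw [map_mul, ← he, ← he', DirectSum.of_mul_of, DirectSum.of_eq_same, DirectSum.of_eq_same,
      DirectSum.of_eq_same]
    rfl

end main

lemma natCast_ne_zero_of_ringChar_ne {k : Type*} [Field k] {p : ℕ} (hp : p.Prime)
    (h : ringChar k ≠ p) : (p : k) ≠ 0 := fun h0 =>
  (hp.eq_one_or_self_of_dvd _ ((ringChar.spec k p).1 h0)).elim
    (fun h1 => CharP.ringChar_ne_one h1) h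

end FKH

open scoped DirectSum in
/-- The Hochschild cohomology algebra `HH^•(FK(3))` is isomorphic, as a graded
`k`-algebra, to the quotient of the free graded-commutative algebra on the 14 generators
`x₁, …, x₁₄` (of homological degrees `0,0,0,1,1,1,1,1,2,2,2,2,3,4`) by the ideal generated by
the 63 relations `𝓡₂`: there is an additive bijection `Φ` to `⊕ₙ Extⁿ_{A^e}(A,A)` which is
graded, unital, `k`-linear, and carries the multiplication to the cup (Yoneda composition)
product. -/
theorem FK3_hochschildCohomology_presentation (h2 : ringChar k ≠ 2) (h3 : ringChar k ≠ 3) :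
    ∃ Φ : HHPres k ≃+ (⨁ n : ℕ, HHExt k n),
      (∀ (n : ℕ) (z : HHPres k), z ∈ presComp k n → ∀ m : ℕ, m ≠ n → (Φ z) m = 0) ∧
      (Φ 1 = DirectSum.of (fun n => HHExt k n) 0 (CategoryTheory.Abelian.Ext.mk₀ (𝟙 (AAmod k)))) ∧
      (∀ (c : k) (z : HHPres k) (n : ℕ),
        (Φ (algebraMap k (HHPres k) c * z)) n =
          (CategoryTheory.Abelian.Ext.mk₀ ((c : k) • 𝟙 (AAmod k))).comp ((Φ z) n) (zero_add n)) ∧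
      (∀ (a b : ℕ) (y z : HHPres k), y ∈ presComp k a → z ∈ presComp k b →
        (Φ (y * z)) (a + b) = ((Φ y) a).comp ((Φ z) b) rfl) := by
  have hA (x y m : FK3 k) : (x ⊗ₜ[k] .op y : FKAe k) • m = x * m * y :=
    (TensorProduct.Algebra.smul_def x (MulOpposite.op y) m).trans (mul_assoc x m y).symm
  have h2' : (2 : k) ≠ 0 := by
    exact_mod_cast FKH.natCast_ne_zero_of_ringChar_ne Nat.prime_two h2
  have h3' : (3 : k) ≠ 0 := by
    exact_mod_cast FKH.natCast_ne_zero_of_ringChar_ne Nat.prime_three h3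
  exact FKH.exists_addEquiv (FKH.isFK k) hA h2' h3'
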